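/- arXiv:2504.19582 — 2 statements merged into one kernel-verified Lean document; each statement's English description precedes it below -/
import Mathlib

section
/- There is a function f : ℕ → ℕ, bounded above by a polynomial, such that the following holds for all integers t ≥ 2 and ℓ ≥ 2: if U is a finite simple graph on 2ℓ² vertices with no K_t-minor, then the number of edge subsets S ⊆ E(U) such that the graph whose vertex set is the set of endpoints of edges in S and whose edge set is S is a triangulated ℓ×ℓ double grid is at most ℓ^{f(t)}. -/
open SimpleGraph

/-- `H` is a minor of `G`: there are pairwise disjoint, connected (hence nonempty) branch
sets, one for each vertex of `H`, with an edge of `G` between the branch sets of any two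
adjacent vertices of `H`. -/
def SimpleGraph.HasMinor {α : Type*} {β : Type*} (G : SimpleGraph α) (H : SimpleGraph β) : Prop :=
  ∃ B : β → Set α,
    (∀ b, (SimpleGraph.induce (B b) G).Connected) ∧
    (Pairwise fun b b' => Disjoint (B b) (B b')) ∧
    (∀ b b', H.Adj b b' → ∃ u ∈ B b, ∃ v ∈ B b', G.Adj u v)
/-- Adjacency in the `a × b` grid. -/
def gridAdj {a b : ℕ} (p q : Fin a × Fin b) : Prop :=
  (p.1 = q.1 ∧ (p.2.val + 1 = q.2.val ∨ q.2.val + 1 = p.2.val)) ∨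
  (p.2 = q.2 ∧ (p.1.val + 1 = q.1.val ∨ q.1.val + 1 = p.1.val))

/-- `p` and `q` are diagonally adjacent positions in the `a × b` grid. -/
def diagAdj {a b : ℕ} (p q : Fin a × Fin b) : Prop :=
  (p.1.val + 1 = q.1.val ∨ q.1.val + 1 = p.1.val) ∧
  (p.2.val + 1 = q.2.val ∨ q.2.val + 1 = p.2.val)

/-- `G` is a triangulated `a × b` grid: it contains all grid edges, every edge is a grid
edge or a diagonal, and in each unit cell (with corners `p`, `q`, `r`, `s`, where
`r = p + (1,1)`, `q = p + (1,0)`, `s = p + (0,1)`) exactly one of the two diagonals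
is present. -/
def IsTriangulatedGrid {a b : ℕ} (G : SimpleGraph (Fin a × Fin b)) : Prop :=
  (∀ p q, gridAdj p q → G.Adj p q) ∧
  (∀ p q, G.Adj p q → gridAdj p q ∨ diagAdj p q) ∧
  (∀ p q r s : Fin a × Fin b,
    p.1.val + 1 = r.1.val → p.2.val + 1 = r.2.val →
    q.1.val = r.1.val → q.2.val = p.2.val →
    s.1.val = p.1.val → s.2.val = r.2.val →
    Xor' (G.Adj p r) (G.Adj q s))

/-- `p` lies on the boundary of the `ℓ × ℓ` grid. -/
def onBoundary {ℓ : ℕ} (p : Fin ℓ × Fin ℓ) : Prop :=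
  p.1.val = 0 ∨ p.1.val = ℓ - 1 ∨ p.2.val = 0 ∨ p.2.val = ℓ - 1

/-- `H` is a triangulated `ℓ × ℓ` double grid: two triangulated `ℓ × ℓ` grids, a perfect
matching between the two copies of the grid boundary, and exactly one diagonal inside each
quadrangular face created by two consecutive matching edges. -/
def IsTriangulatedDoubleGrid {ℓ : ℕ} (H : SimpleGraph (Fin 2 × Fin ℓ × Fin ℓ)) : Prop :=
  ∃ G₁ G₂ : SimpleGraph (Fin ℓ × Fin ℓ),
    IsTriangulatedGrid G₁ ∧ IsTriangulatedGrid G₂ ∧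
    (∀ p q, H.Adj (0, p) (0, q) ↔ G₁.Adj p q) ∧
    (∀ p q, H.Adj (1, p) (1, q) ↔ G₂.Adj p q) ∧
    (∀ p, H.Adj (0, p) (1, p) ↔ onBoundary p) ∧
    (∀ p q, p ≠ q → H.Adj (0, p) (1, q) → onBoundary p ∧ onBoundary q ∧ gridAdj p q) ∧
    (∀ p q, gridAdj p q → onBoundary p → onBoundary q →
      Xor' (H.Adj (0, p) (1, q)) (H.Adj (0, q) (1, p)))

/-- The vertex set `S` is nonempty and induces a connected subgraph of `G`. -/
abbrev IsConn {V : Type*} (G : SimpleGraph V) (S : Set V) : Prop :=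
  (SimpleGraph.induce S G).Connected

lemma isConn_union_of_adj {V : Type*} {G : SimpleGraph V} {S T : Set V} (hS : IsConn G S)
    (hT : IsConn G T) {a b : V} (ha : a ∈ S) (hb : b ∈ T) (hab : G.Adj a b) :
    IsConn G (S ∪ T) :=
  connected_induce_union hS.preconnected hT.preconnected ha hb hab

lemma isConn_union_of_mem {V : Type*} {G : SimpleGraph V} {S T : Set V} (hS : IsConn G S)
    (hT : IsConn G T) {a : V} (ha : a ∈ S) (hb : a ∈ T) : IsConn G (S ∪ T) :=
  induce_union_connected hS.preconnected hT.preconnected ⟨a, ha, hb⟩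

lemma isConn_singleton {V : Type*} (G : SimpleGraph V) (a : V) : IsConn G {a} := by
  have : Nonempty ({a} : Set V) := ⟨⟨a, rfl⟩⟩
  exact ⟨fun u v => by rw [Subsingleton.elim u v]⟩

lemma IsConn.image {V W : Type*} {G : SimpleGraph W} (f : V → W) {S : Set V}
    (hS : IsConn (G.comap f) S) : IsConn G (f '' S) := by
  let φ : SimpleGraph.induce S (G.comap f) →g SimpleGraph.induce (f '' S) G :=
    ⟨fun v => ⟨f v.1, v.1, v.2, rfl⟩, fun h => h⟩
  refine hS.map φ ?_
  rintro ⟨_, v, hv, rfl⟩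
  exact ⟨⟨v, hv⟩, rfl⟩

lemma isConn_path {V : Type*} {G : SimpleGraph V} (f : ℕ → V) {a b : ℕ} (hab : a ≤ b)
    (h : ∀ i, a ≤ i → i < b → G.Adj (f i) (f (i + 1))) : IsConn G (f '' Set.Icc a b) := by
  induction b, hab using Nat.le_induction with
  | base => simpa using isConn_singleton G (f a)
  | succ n hn ih =>
    have hset : f '' Set.Icc a (n + 1) = f '' Set.Icc a n ∪ {f (n + 1)} := by
      rw [← Set.image_singleton, ← Set.image_union]
      congr 1
      ext i
      simp only [Set.mem_Icc, Set.mem_union, Set.mem_singleton_iff]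
      omega
    rw [hset]
    exact isConn_union_of_adj (ih fun i h1 h2 => h i h1 (by omega)) (isConn_singleton G _)
      ⟨n, ⟨hn, le_rfl⟩, rfl⟩ rfl (h n hn (by omega))

/-- The part of column `y` in rows `a, …, b`. -/
def vseg (y a b : ℕ) : Set (ℕ × ℕ) := {z | z.2 = y ∧ a ≤ z.1 ∧ z.1 ≤ b}

/-- The part of row `x` in columns `a, …, b`. -/
def hseg (x a b : ℕ) : Set (ℕ × ℕ) := {z | z.1 = x ∧ a ≤ z.2 ∧ z.2 ≤ b}

@[simp] lemma mem_vseg {y a b : ℕ} {z : ℕ × ℕ} : z ∈ vseg y a b ↔ z.2 = y ∧ a ≤ z.1 ∧ z.1 ≤ b :=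
  Iff.rfl

@[simp] lemma mem_hseg {x a b : ℕ} {z : ℕ × ℕ} : z ∈ hseg x a b ↔ z.1 = x ∧ a ≤ z.2 ∧ z.2 ≤ b :=
  Iff.rfl

/-- `Γ` contains all grid edges in rows `lo, …, hi` and columns `0, …, b - 1`. -/
structure ContainsGrid (Γ : SimpleGraph (ℕ × ℕ)) (lo hi b : ℕ) : Prop where
  vert : ∀ x y, lo ≤ x → x < hi → y < b → Γ.Adj (x, y) (x + 1, y)
  horiz : ∀ x y, lo ≤ x → x ≤ hi → y + 1 < b → Γ.Adj (x, y) (x, y + 1)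

lemma ContainsGrid.mono {Γ : SimpleGraph (ℕ × ℕ)} {lo hi b lo' hi' : ℕ}
    (h : ContainsGrid Γ lo hi b) (h1 : lo ≤ lo') (h2 : hi' ≤ hi) : ContainsGrid Γ lo' hi' b :=
  ⟨fun x y hx hx' hy => h.vert x y (by omega) (by omega) hy,
    fun x y hx hx' hy => h.horiz x y (by omega) (by omega) hy⟩

lemma ContainsGrid.isConn_vseg {Γ : SimpleGraph (ℕ × ℕ)} {lo hi b : ℕ}
    (h : ContainsGrid Γ lo hi b) {y x x' : ℕ} (hx : lo ≤ x) (hxx : x ≤ x') (hx' : x' ≤ hi)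
    (hy : y < b) : IsConn Γ (vseg y x x') := by
  have hset : vseg y x x' = (fun i => (i, y)) '' Set.Icc x x' := by
    ext ⟨u, v⟩
    simp only [mem_vseg, Set.mem_image, Set.mem_Icc, Prod.mk.injEq]
    constructor
    · rintro ⟨rfl, h1, h2⟩
      exact ⟨u, ⟨h1, h2⟩, rfl, rfl⟩
    · rintro ⟨i, ⟨h1, h2⟩, rfl, rfl⟩
      exact ⟨rfl, h1, h2⟩
  rw [hset]
  exact isConn_path _ hxx fun i h1 h2 => h.vert i y (by omega) (by omega) hy

lemma ContainsGrid.isConn_hseg {Γ : SimpleGraph (ℕ × ℕ)} {lo hi b : ℕ}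
    (h : ContainsGrid Γ lo hi b) {x y y' : ℕ} (hx : lo ≤ x) (hx' : x ≤ hi) (hyy : y ≤ y')
    (hy : y' < b) : IsConn Γ (hseg x y y') := by
  have hset : hseg x y y' = (fun i => (x, i)) '' Set.Icc y y' := by
    ext ⟨u, v⟩
    simp only [mem_hseg, Set.mem_image, Set.mem_Icc, Prod.mk.injEq]
    constructor
    · rintro ⟨rfl, h1, h2⟩
      exact ⟨v, ⟨h1, h2⟩, rfl, rfl⟩
    · rintro ⟨i, ⟨h1, h2⟩, rfl, rfl⟩
      exact ⟨rfl, h1, h2⟩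
  rw [hset]
  exact isConn_path _ hyy fun i h1 h2 => h.horiz x i hx hx' (by omega)

/-- A family of disjoint connected sets ("strings") in rows `lo, …, hi` and columns `< b`; the
`p`-th one contains column `α p` of the top row and column `β p` of the bottom row. -/
structure Strings (Γ : SimpleGraph (ℕ × ℕ)) (b lo hi : ℕ) {ι : Type*} (α β : ι → ℕ)
    (Q : ι → Set (ℕ × ℕ)) : Prop where
  conn : ∀ p, IsConn Γ (Q p)
  disj : ∀ p p', p ≠ p' → ∀ z, z ∈ Q p → z ∈ Q p' → False
  box : ∀ p, ∀ z ∈ Q p, lo ≤ z.1 ∧ z.1 ≤ hi ∧ z.2 < b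
  top : ∀ p, (lo, α p) ∈ Q p
  bot : ∀ p, (hi, β p) ∈ Q p

lemma Strings.relabel {Γ : SimpleGraph (ℕ × ℕ)} {b lo hi : ℕ} {ι κ : Type*} {α β : ι → ℕ}
    {Q : ι → Set (ℕ × ℕ)} (h : Strings Γ b lo hi α β Q) {σ : κ → ι} (hσ : Function.Injective σ) :
    Strings Γ b lo hi (α ∘ σ) (β ∘ σ) (Q ∘ σ) :=
  ⟨fun _ => h.conn _, fun _ _ hp => h.disj _ _ (hσ.ne hp), fun _ => h.box _, fun _ => h.top _,
    fun _ => h.bot _⟩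

lemma Strings.append {Γ : SimpleGraph (ℕ × ℕ)} {b lo mid hi : ℕ} {ι : Type*} {α β γ : ι → ℕ}
    {Q Q' : ι → Set (ℕ × ℕ)} (h : Strings Γ b lo mid α β Q)
    (h' : Strings Γ b (mid + 1) hi β γ Q')
    (hv : ∀ y, y < b → Γ.Adj (mid, y) (mid + 1, y)) :
    Strings Γ b lo hi α γ (fun p => Q p ∪ Q' p) where
  conn p := isConn_union_of_adj (h.conn p) (h'.conn p) (h.bot p) (h'.top p)
    (hv _ (h.box p _ (h.bot p)).2.2)
  disj p p' hp z hz hz' := by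
    rcases hz with hz | hz <;> rcases hz' with hz' | hz'
    · exact h.disj p p' hp z hz hz'
    · have := h.box p z hz; have := h'.box p' z hz'; omega
    · have := h'.box p z hz; have := h.box p' z hz'; omega
    · exact h'.disj p p' hp z hz hz'
  box p z hz := by
    have h1 := h.box p _ (h.top p)
    have h2 := h'.box p _ (h'.bot p)
    simp only at h1 h2
    rcases hz with hz | hz
    · have := h.box p z hz; omega
    · have := h'.box p z hz; omega
  top p := Or.inl (h.top p)
  bot p := Or.inr (h'.bot p)

lemma strings_straight {Γ : SimpleGraph (ℕ × ℕ)} {b lo hi : ℕ} (hg : ContainsGrid Γ lo hi b)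
    (hlo : lo ≤ hi) {ι : Type*} {α : ι → ℕ} (hα : Function.Injective α) (hb : ∀ p, α p < b) :
    Strings Γ b lo hi α α (fun p => vseg (α p) lo hi) where
  conn p := hg.isConn_vseg le_rfl hlo le_rfl (hb p)
  disj _ _ hp _ hz hz' := hp (hα (hz.1.symm.trans hz'.1))
  box p _ hz := ⟨hz.2.1, hz.2.2, hz.1 ▸ hb p⟩
  top _ := ⟨rfl, le_rfl, hlo⟩
  bot _ := ⟨rfl, hlo, le_rfl⟩

/-- Three segments leading from column `p` to column `q` along row `m`. -/
def zpath (lo hi m p q : ℕ) : Set (ℕ × ℕ) :=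
  vseg p lo m ∪ hseg m (min p q) (max p q) ∪ vseg q m hi

lemma ContainsGrid.isConn_zpath {Γ : SimpleGraph (ℕ × ℕ)} {lo hi b : ℕ}
    (h : ContainsGrid Γ lo hi b) {m p q : ℕ} (h1 : lo ≤ m) (h2 : m ≤ hi) (hp : p < b)
    (hq : q < b) : IsConn Γ (zpath lo hi m p q) := by
  refine isConn_union_of_mem (a := (m, q)) (isConn_union_of_mem (a := (m, p))
    (h.isConn_vseg le_rfl h1 h2 hp) (h.isConn_hseg h1 h2 (by omega) (by omega)) ?_ ?_)
    (h.isConn_vseg h1 h2 le_rfl hq) ?_ ?_ <;> simp <;> omega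

lemma strings_shift_out {Γ : SimpleGraph (ℕ × ℕ)} {b lo hi t : ℕ} (hg : ContainsGrid Γ lo hi b)
    (ht : lo + t ≤ hi + 1) {α : Fin t → ℕ} (hα : StrictMono α)
    (hle : ∀ p : Fin t, p.val ≤ α p) (hb : ∀ p, α p < b) :
    Strings Γ b lo hi (fun p : Fin t => p.val) α
      (fun p => zpath lo hi (lo + (t - 1 - p.val)) p.val (α p)) where
  conn p := by
    have := hle p; have := hb p; have := p.2
    exact hg.isConn_zpath (by omega) (by omega) (by omega) (by omega)
  disj := by
    have key : ∀ p p' : Fin t, p < p' → ∀ z,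
        z ∈ zpath lo hi (lo + (t - 1 - p.val)) p.val (α p) →
        z ∈ zpath lo hi (lo + (t - 1 - p'.val)) p'.val (α p') → False := by
      intro p p' hp z hz hz'
      have h1 := hα hp
      have h2 := hle p
      have h3 := hle p'
      have h4 := p.2
      have h5 := p'.2
      rw [Fin.lt_def] at hp
      simp only [zpath, Set.mem_union, mem_vseg, mem_hseg] at hz hz'
      rw [min_eq_left h2, max_eq_right h2] at hz
      rw [min_eq_left h3, max_eq_right h3] at hz'
      rcases hz with (⟨_, _, _⟩ | ⟨_, _, _⟩) | ⟨_, _, _⟩ <;>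
      rcases hz' with (⟨_, _, _⟩ | ⟨_, _, _⟩) | ⟨_, _, _⟩ <;> omega
    intro p p' hp z hz hz'
    rcases lt_or_gt_of_ne hp with h | h
    · exact key _ _ h z hz hz'
    · exact key _ _ h z hz' hz
  box p z hz := by
    have := hle p; have := hb p; have := p.2
    simp only [zpath, Set.mem_union, mem_vseg, mem_hseg] at hz
    omega
  top p := by simp [zpath]
  bot p := by
    have := p.2
    simp [zpath]; omega

lemma strings_shift_in {Γ : SimpleGraph (ℕ × ℕ)} {b lo hi t : ℕ} (hg : ContainsGrid Γ lo hi b)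
    (ht : lo + t ≤ hi + 1) {α : Fin t → ℕ} (hα : StrictMono α)
    (hle : ∀ p : Fin t, p.val ≤ α p) (hb : ∀ p, α p < b) :
    Strings Γ b lo hi α (fun p : Fin t => p.val)
      (fun p => zpath lo hi (lo + p.val) (α p) p.val) where
  conn p := by
    have := hle p; have := hb p; have := p.2
    exact hg.isConn_zpath (by omega) (by omega) (by omega) (by omega)
  disj := by
    have key : ∀ p p' : Fin t, p < p' → ∀ z,
        z ∈ zpath lo hi (lo + p.val) (α p) p.val →
        z ∈ zpath lo hi (lo + p'.val) (α p') p'.val → False := by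
      intro p p' hp z hz hz'
      have h1 := hα hp
      have h2 := hle p
      have h3 := hle p'
      have h4 := p.2
      have h5 := p'.2
      rw [Fin.lt_def] at hp
      simp only [zpath, Set.mem_union, mem_vseg, mem_hseg] at hz hz'
      rw [min_eq_right h2, max_eq_left h2] at hz
      rw [min_eq_right h3, max_eq_left h3] at hz'
      rcases hz with (⟨_, _, _⟩ | ⟨_, _, _⟩) | ⟨_, _, _⟩ <;>
      rcases hz' with (⟨_, _, _⟩ | ⟨_, _, _⟩) | ⟨_, _, _⟩ <;> omega
    intro p p' hp z hz hz'
    rcases lt_or_gt_of_ne hp with h | h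
    · exact key _ _ h z hz hz'
    · exact key _ _ h z hz' hz
  box p z hz := by
    have := hle p; have := hb p; have := p.2
    simp only [zpath, Set.mem_union, mem_vseg, mem_hseg] at hz
    omega
  top p := by simp [zpath]
  bot p := by
    have := p.2
    simp [zpath]; omega

lemma exists_strings_through {Γ : SimpleGraph (ℕ × ℕ)} {b lo hi t : ℕ}
    (hg : ContainsGrid Γ lo hi b) {x y : ℕ} (hlo : lo + t ≤ x) (hhi : x + t ≤ hi) (c : Fin t)
    (hy : t ≤ y) (hyb : y + t < b) :
    ∃ Q, Strings Γ b lo hi (fun p : Fin t => p.val) (fun p : Fin t => p.val) Q ∧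
      (x, y) ∈ Q c := by
  have hc := c.2
  let α : Fin t → ℕ := fun p => y + p.val - c.val
  have hα : StrictMono α := fun p q hpq => by
    rw [Fin.lt_def] at hpq
    simp only [α]; omega
  have hle : ∀ p : Fin t, p.val ≤ α p := fun p => by simp only [α]; omega
  have hb : ∀ p, α p < b := fun p => by have := p.2; simp only [α]; omega
  have s1 := strings_shift_out (hg.mono (lo' := lo) (hi' := lo + t - 1) le_rfl (by omega))
    (by omega) hα hle hb
  have s2 := strings_straight (hg.mono (lo' := lo + t - 1 + 1) (hi' := hi - t) (by omega)
    (by omega)) (by omega) hα.injective hb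
  have s3 := strings_shift_in (hg.mono (lo' := hi - t + 1) (hi' := hi) (by omega) (by omega))
    (by omega) hα hle hb
  refine ⟨_, (s1.append s2 fun y hy => hg.vert _ _ (by omega) (by omega) hy).append s3
    fun y hy => hg.vert _ _ (by omega) (by omega) hy, ?_⟩
  left; right
  simp only [mem_vseg, α]
  omega

/-- `u` and `v` are adjacent in `Γ`, but they are not neighbours in the grid, and if they are
opposite corners of a grid cell, then the two other corners are adjacent too. -/
structure CrossPair (Γ : SimpleGraph (ℕ × ℕ)) (u v : ℕ × ℕ) : Prop where
  adj : Γ.Adj u v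
  not_horiz : u.1 = v.1 → ¬ (u.2 + 1 = v.2 ∨ v.2 + 1 = u.2)
  not_vert : u.2 = v.2 → ¬ (u.1 + 1 = v.1 ∨ v.1 + 1 = u.1)
  diag : (u.1 + 1 = v.1 ∨ v.1 + 1 = u.1) → (u.2 + 1 = v.2 ∨ v.2 + 1 = u.2) →
    Γ.Adj (u.1, v.2) (v.1, u.2)

lemma CrossPair.symm {Γ : SimpleGraph (ℕ × ℕ)} {u v : ℕ × ℕ} (h : CrossPair Γ u v) :
    CrossPair Γ v u :=
  ⟨h.adj.symm, fun h1 h2 => h.not_horiz h1.symm h2.symm, fun h1 h2 => h.not_vert h1.symm h2.symm,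
    fun h1 h2 => (h.diag h1.symm h2.symm).symm⟩

/-- Two disjoint connected sets `C` and `D` in rows `lo, …, hi` that meet the top row in columns
`y` and `y + 1` and the bottom row in the opposite order. -/
structure IsSwap (Γ : SimpleGraph (ℕ × ℕ)) (lo hi y y' : ℕ) (γC γD : ℕ)
    (C D : Set (ℕ × ℕ)) : Prop where
  connC : IsConn Γ C
  connD : IsConn Γ D
  disj : ∀ z, z ∈ C → z ∈ D → False
  boxC : ∀ z ∈ C, lo ≤ z.1 ∧ z.1 ≤ hi ∧ y ≤ z.2 + 1 ∧ z.2 ≤ y' + 1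
  boxD : ∀ z ∈ D, lo ≤ z.1 ∧ z.1 ≤ hi ∧ y ≤ z.2 + 1 ∧ z.2 ≤ y' + 1
  topC : (lo, y) ∈ C
  topD : (lo, y + 1) ∈ D
  botC : (hi, γC) ∈ C
  botD : (hi, γD) ∈ D
  lt : γD < γC

lemma exists_isSwap {Γ : SimpleGraph (ℕ × ℕ)} {b lo hi : ℕ}
    (hg : ContainsGrid Γ lo hi b) {u v : ℕ × ℕ} (h : CrossPair Γ u v) (hu : lo ≤ u.1)
    (hu' : u.1 ≤ hi) (hv : lo ≤ v.1) (hv' : v.1 ≤ hi) (hy : 1 ≤ u.2) (huv : u.2 ≤ v.2)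
    (hb : v.2 + 1 < b) :
    ∃ γC γD C D, IsSwap Γ lo hi u.2 v.2 γC γD C D := by
  obtain ⟨x₁, y₁⟩ := u
  obtain ⟨x₂, y₂⟩ := v
  simp only at hu hu' hv hv' hy huv hb ⊢
  have hV : ∀ {y x x'}, lo ≤ x → x ≤ x' → x' ≤ hi → y < b → IsConn Γ (vseg y x x') :=
    fun h1 h2 h3 h4 => hg.isConn_vseg h1 h2 h3 h4
  have hne := h.adj.ne
  have hnh := h.not_horiz
  have hnv := h.not_vert
  simp only [ne_eq, Prod.mk.injEq] at hne hnh hnv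
  rcases (by omega : y₁ + 2 ≤ y₂ ∨ y₂ = y₁ + 1 ∨ y₂ = y₁) with h2 | rfl | rfl
  · refine ⟨y₂, y₁ + 1, vseg y₁ lo x₁ ∪ vseg y₂ x₂ hi, vseg (y₁ + 1) lo hi, ?_⟩
    refine ⟨isConn_union_of_adj (a := (x₁, y₁)) (b := (x₂, y₂)) (hV ?_ ?_ ?_ ?_)
      (hV ?_ ?_ ?_ ?_) ?_ ?_ h.adj, hV ?_ ?_ ?_ ?_, ?_, ?_, ?_, ?_, ?_, ?_, ?_, ?_⟩
    all_goals try simp only [Set.mem_union, mem_vseg, true_and, and_true, le_refl]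
    all_goals omega
  · rcases (by omega : x₁ < x₂ ∨ x₂ < x₁) with h3 | h3
    · refine ⟨y₁ + 1, y₁, vseg y₁ lo x₁ ∪ vseg (y₁ + 1) x₂ hi,
        vseg (y₁ + 1) lo (x₂ - 1) ∪ vseg y₁ (x₁ + 1) hi, ?_⟩
      have hD : IsConn Γ (vseg (y₁ + 1) lo (x₂ - 1) ∪ vseg y₁ (x₁ + 1) hi) := by
        by_cases h4 : x₂ = x₁ + 1
        · subst h4
          refine isConn_union_of_adj (a := (x₁, y₁ + 1)) (b := (x₁ + 1, y₁)) (hV ?_ ?_ ?_ ?_)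
            (hV ?_ ?_ ?_ ?_) ?_ ?_ (h.diag (Or.inl rfl) (Or.inl rfl))
          all_goals try simp only [mem_vseg, true_and, le_refl]
          all_goals omega
        · refine isConn_union_of_adj (a := (x₁ + 1, y₁ + 1)) (b := (x₁ + 1, y₁))
            (hV ?_ ?_ ?_ ?_) (hV ?_ ?_ ?_ ?_) ?_ ?_ (hg.horiz _ _ ?_ ?_ ?_).symm
          all_goals try simp only [mem_vseg, true_and, le_refl]
          all_goals omega
      refine ⟨isConn_union_of_adj (a := (x₁, y₁)) (b := (x₂, y₁ + 1)) (hV ?_ ?_ ?_ ?_)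
        (hV ?_ ?_ ?_ ?_) ?_ ?_ h.adj, hD, ?_, ?_, ?_, ?_, ?_, ?_, ?_, ?_⟩
      all_goals try simp only [Set.mem_union, mem_vseg, true_and, and_true, le_refl]
      all_goals omega
    · refine ⟨y₁ + 1, y₁, vseg y₁ lo (x₁ - 1) ∪ vseg (y₁ + 1) (x₂ + 1) hi,
        vseg (y₁ + 1) lo x₂ ∪ vseg y₁ x₁ hi, ?_⟩
      have hC : IsConn Γ (vseg y₁ lo (x₁ - 1) ∪ vseg (y₁ + 1) (x₂ + 1) hi) := by
        by_cases h4 : x₁ = x₂ + 1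
        · subst h4
          refine isConn_union_of_adj (a := (x₂, y₁)) (b := (x₂ + 1, y₁ + 1)) (hV ?_ ?_ ?_ ?_)
            (hV ?_ ?_ ?_ ?_) ?_ ?_ (h.diag (Or.inr rfl) (Or.inl rfl)).symm
          all_goals try simp only [mem_vseg, true_and, le_refl]
          all_goals omega
        · refine isConn_union_of_adj (a := (x₂ + 1, y₁)) (b := (x₂ + 1, y₁ + 1))
            (hV ?_ ?_ ?_ ?_) (hV ?_ ?_ ?_ ?_) ?_ ?_ (hg.horiz _ _ ?_ ?_ ?_)
          all_goals try simp only [mem_vseg, true_and, le_refl]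
          all_goals omega
      refine ⟨hC, isConn_union_of_adj (a := (x₂, y₁ + 1)) (b := (x₁, y₁)) (hV ?_ ?_ ?_ ?_)
        (hV ?_ ?_ ?_ ?_) ?_ ?_ h.adj.symm, ?_, ?_, ?_, ?_, ?_, ?_, ?_, ?_⟩
      all_goals try simp only [Set.mem_union, mem_vseg, true_and, and_true, le_refl]
      all_goals omega
  · have key : ∀ a₁ a₂ : ℕ, a₁ + 2 ≤ a₂ → lo ≤ a₁ → a₂ ≤ hi → Γ.Adj (a₁, y₂) (a₂, y₂) →
        ∃ γC γD C D, IsSwap Γ lo hi y₂ y₂ γC γD C D := by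
      intro a₁ a₂ h3 h4 h5 hadj
      refine ⟨y₂, y₂ - 1, vseg y₂ lo a₁ ∪ vseg y₂ a₂ hi,
        vseg (y₂ + 1) lo (a₁ + 1) ∪ hseg (a₁ + 1) (y₂ - 1) (y₂ + 1) ∪
          vseg (y₂ - 1) (a₁ + 1) hi, ?_⟩
      have hD : IsConn Γ (vseg (y₂ + 1) lo (a₁ + 1) ∪ hseg (a₁ + 1) (y₂ - 1) (y₂ + 1) ∪
          vseg (y₂ - 1) (a₁ + 1) hi) := by
        refine isConn_union_of_mem (a := (a₁ + 1, y₂ - 1)) (isConn_union_of_mem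
          (a := (a₁ + 1, y₂ + 1)) (hV ?_ ?_ ?_ ?_) (hg.isConn_hseg ?_ ?_ ?_ ?_) ?_ ?_)
          (hV ?_ ?_ ?_ ?_) ?_ ?_
        all_goals try simp only [Set.mem_union, mem_vseg, mem_hseg, true_and, and_true, le_refl]
        all_goals omega
      refine ⟨isConn_union_of_adj (a := (a₁, y₂)) (b := (a₂, y₂)) (hV ?_ ?_ ?_ ?_)
        (hV ?_ ?_ ?_ ?_) ?_ ?_ hadj, hD, ?_, ?_, ?_, ?_, ?_, ?_, ?_, ?_⟩
      all_goals try simp only [Set.mem_union, mem_vseg, mem_hseg, true_and, and_true, le_refl]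
      all_goals omega
    rcases (by omega : x₁ + 2 ≤ x₂ ∨ x₂ + 2 ≤ x₁) with h3 | h3
    · exact key x₁ x₂ h3 (by omega) (by omega) h.adj
    · exact key x₂ x₁ h3 (by omega) (by omega) h.adj.symm

/-- The transposition of `c` and `c + 1`. -/
def adjSwap (c p : ℕ) : ℕ := if p = c then c + 1 else if p = c + 1 then c else p

lemma exists_strings_swap {Γ : SimpleGraph (ℕ × ℕ)} {b lo hi t : ℕ}
    (hg : ContainsGrid Γ lo hi b) {u v : ℕ × ℕ} (h : CrossPair Γ u v) (hu : lo + t ≤ u.1)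
    (hu' : u.1 + t ≤ hi) (hv : lo + t ≤ v.1) (hv' : v.1 + t ≤ hi) (huy : t + 1 ≤ u.2)
    (hub : u.2 + t + 1 < b) (hvy : t + 1 ≤ v.2) (hvb : v.2 + t + 1 < b) {c : ℕ}
    (hc : c + 1 < t) :
    ∃ Q, Strings Γ b lo hi (fun p : Fin t => p.val) (fun p : Fin t => adjSwap c p.val) Q := by
  wlog huv : u.2 ≤ v.2 generalizing u v
  · exact this h.symm hv hv' hu hu' hvy hvb huy hub (by omega)
  obtain ⟨γC, γD, C, D, hs⟩ := exists_isSwap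
    (hg.mono (lo' := lo + t - 1 + 1) (hi' := hi - t) (by omega) (by omega)) h (by omega)
    (by omega) (by omega) (by omega) (by omega) huv (by omega)
  obtain ⟨-, -, hC, -⟩ := hs.boxC _ hs.botC
  obtain ⟨-, -, -, hD⟩ := hs.boxD _ hs.botD
  obtain ⟨-, -, hD', -⟩ := hs.boxD _ hs.botD
  obtain ⟨-, -, -, hC'⟩ := hs.boxC _ hs.botC
  have hlt := hs.lt
  simp only at hC hC' hD hD'
  let out : ℕ → ℕ := fun p => if p < c then u.2 - 1 + p - c else v.2 + p - c
  let α : Fin t → ℕ := fun p =>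
    if p.val = c then u.2 else if p.val = c + 1 then u.2 + 1 else out p.val
  let β : Fin t → ℕ := fun p =>
    if p.val = c then γD else if p.val = c + 1 then γC else out p.val
  have hα : StrictMono α := fun p q hpq => by
    rw [Fin.lt_def] at hpq
    simp only [α, out]; split_ifs <;> omega
  have hαle : ∀ p : Fin t, p.val ≤ α p := fun p => by
    simp only [α, out]; split_ifs <;> omega
  have hαb : ∀ p, α p < b := fun p => by
    have := p.2; simp only [α, out]; split_ifs <;> omega
  have hβ : StrictMono β := fun p q hpq => by
    rw [Fin.lt_def] at hpq
    simp only [β, out]; split_ifs <;> omega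
  have hβle : ∀ p : Fin t, p.val ≤ β p := fun p => by
    simp only [β, out]; split_ifs <;> omega
  have hβb : ∀ p, β p < b := fun p => by
    have := p.2; simp only [β, out]; split_ifs <;> omega
  have hst : ∀ p, p < t → adjSwap c p < t := fun p hp => by
    simp only [adjSwap]; split_ifs <;> omega
  let σ : Fin t → Fin t := fun p => ⟨adjSwap c p.val, hst _ p.2⟩
  have hσ : Function.Injective σ := fun p q hpq => by
    simp only [σ, adjSwap, Fin.mk.injEq] at hpq
    ext
    split_ifs at hpq <;> omega
  have s1 := strings_shift_out (hg.mono (lo' := lo) (hi' := lo + t - 1) le_rfl (by omega))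
    (by omega) hα hαle hαb
  have s3 := (strings_shift_in (hg.mono (lo' := hi - t + 1) (hi' := hi) (by omega) (by omega))
    (by omega) hβ hβle hβb).relabel hσ
  have s2 : Strings Γ b (lo + t - 1 + 1) (hi - t) α (β ∘ σ) (fun p : Fin t =>
      if p.val = c then C else if p.val = c + 1 then D else
        vseg (out p.val) (lo + t - 1 + 1) (hi - t)) := by
    have hsegs := hg.mono (lo' := lo + t - 1 + 1) (hi' := hi - t) (by omega) (by omega)
    refine ⟨fun p => ?_, fun p p' hp z hz hz' => ?_, fun p z hz => ?_, fun p => ?_, fun p => ?_⟩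
    · have := hαb p
      simp only [α] at this
      split_ifs with h1 h2
      · exact hs.connC
      · exact hs.connD
      · rw [if_neg h1, if_neg h2] at this
        exact hsegs.isConn_vseg le_rfl (by omega) le_rfl this
    · have hp' : p.val ≠ p'.val := fun h => hp (Fin.ext h)
      have hzC := hs.boxC z
      have hzD := hs.boxD z
      have hzz := hs.disj z
      split_ifs at hz with h1 h2 <;> split_ifs at hz' with h3 h4
      all_goals first
        | omega
        | exact hzz hz hz'
        | exact hzz hz' hz
        | (first
            | have := hzC hz
            | have := hzD hz
            | have := hzC hz'
            | have := hzD hz'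
            | skip)
          simp only [mem_vseg, out] at hz hz'
          split_ifs at hz hz' <;> omega
    · have := hαb p
      simp only [α] at this
      split_ifs at hz with h1 h2
      · have := hs.boxC z hz; omega
      · have := hs.boxD z hz; omega
      · rw [if_neg h1, if_neg h2] at this
        simp only [mem_vseg] at hz
        omega
    · simp only [α]
      split_ifs with h1 h2
      · exact hs.topC
      · exact hs.topD
      · simp only [mem_vseg, true_and]; omega
    · simp only [β, σ, adjSwap, Function.comp]
      split_ifs with h1 h2
      all_goals try omega
      · exact hs.botC
      · exact hs.botD
      · simp only [mem_vseg, true_and]; omega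
  exact ⟨_, (s1.append s2 fun y hy => hg.vert _ _ (by omega) (by omega) hy).append s3
    fun y hy => hg.vert _ _ (by omega) (by omega) hy⟩

lemma exists_strings_colored {Γ : SimpleGraph (ℕ × ℕ)} {b lo hi t : ℕ}
    (hg : ContainsGrid Γ lo hi b) (hlohi : lo ≤ hi) (htb : t ≤ b) (κ : ℕ × ℕ → Fin t)
    (Z : Finset (ℕ × ℕ))
    (hrow : ∀ z ∈ Z, ∀ z' ∈ Z, z ≠ z' → z.1 + 2 * t + 1 ≤ z'.1 ∨ z'.1 + 2 * t + 1 ≤ z.1)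
    (hm : ∀ z ∈ Z, lo + t + 1 ≤ z.1 ∧ z.1 + t ≤ hi ∧ t ≤ z.2 ∧ z.2 + t < b) :
    ∃ h Q, h ≤ hi ∧ (h = lo ∨ ∃ z ∈ Z, h = z.1 + t) ∧
      Strings Γ b lo h (fun p : Fin t => p.val) (fun p : Fin t => p.val) Q ∧
      ∀ z ∈ Z, z ∈ Q (κ z) := by
  revert hrow hm
  refine Finset.induction_on_max_value Prod.fst Z ?_ ?_
  · intro _ _
    exact ⟨lo, _, hlohi, Or.inl rfl, strings_straight (hg.mono le_rfl hlohi) le_rfl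
      Fin.val_injective fun p => p.2.trans_le htb, by simp⟩
  · intro a s ha hmax ih hrow hm
    obtain ⟨h, Q, hh, hcase, hQ, hmem⟩ := ih
      (fun z hz z' hz' => hrow z (Finset.mem_insert_of_mem hz) z' (Finset.mem_insert_of_mem hz'))
      (fun z hz => hm z (Finset.mem_insert_of_mem hz))
    obtain ⟨h1, h2, h3, h4⟩ := hm a (Finset.mem_insert_self _ _)
    have hlt : h + t + 1 ≤ a.1 ∧ lo ≤ h := by
      rcases hcase with rfl | ⟨z, hz, rfl⟩
      · omega
      · have h5 := hrow a (Finset.mem_insert_self _ _) z (Finset.mem_insert_of_mem hz)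
          (fun e => ha (e ▸ hz))
        have h6 := hmax z hz
        have h7 := hm z (Finset.mem_insert_of_mem hz)
        omega
    obtain ⟨Q', hQ', hmem'⟩ := exists_strings_through
      (hg.mono (lo' := h + 1) (hi' := a.1 + t) (by omega) h2) (x := a.1) (y := a.2)
      (by omega) le_rfl (κ a) h3 h4
    refine ⟨a.1 + t, _, h2, Or.inr ⟨a, Finset.mem_insert_self _ _, rfl⟩, hQ.append hQ'
      fun y hy => hg.vert _ _ hlt.2 (by omega) hy, fun z hz => ?_⟩
    rcases Finset.mem_insert.1 hz with rfl | hz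
    · exact Or.inr hmem'
    · exact Or.inl (hmem z hz)

/-- The position after `s` steps of the particle starting in position `p`, when `t` particles
in a row are repeatedly swept by adjacent transpositions from left to right. -/
def sweep (t : ℕ) : ℕ → ℕ → ℕ
  | 0, p => p
  | s + 1, p => adjSwap (s % (t - 1)) (sweep t s p)

lemma adjSwap_lt {t c p : ℕ} (hc : c + 1 < t) (hp : p < t) : adjSwap c p < t := by
  simp only [adjSwap]; split_ifs <;> omega

lemma adjSwap_injective (c : ℕ) : Function.Injective (adjSwap c) := fun p q h => by
  simp only [adjSwap] at h; split_ifs at h <;> omega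

lemma sweep_lt {t p : ℕ} (ht : 2 ≤ t) (hp : p < t) : ∀ s, sweep t s p < t
  | 0 => hp
  | s + 1 => adjSwap_lt (by have := Nat.mod_lt s (show 0 < t - 1 by omega); omega)
      (sweep_lt ht hp s)

lemma sweep_injective (t : ℕ) : ∀ s, Function.Injective (sweep t s)
  | 0 => fun _ _ h => h
  | s + 1 => (adjSwap_injective _).comp (sweep_injective t s)

lemma sweep_add {t r q : ℕ} (hq : q ≤ t - 1) (p : ℕ) :
    sweep t (r * (t - 1) + q) p =
      if sweep t (r * (t - 1)) p = 0 then q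
      else if sweep t (r * (t - 1)) p ≤ q then sweep t (r * (t - 1)) p - 1
      else sweep t (r * (t - 1)) p := by
  induction q with
  | zero => simp only [add_zero]; split_ifs <;> omega
  | succ q ih =>
    have hmod : (r * (t - 1) + q) % (t - 1) = q := by
      rw [Nat.mul_add_mod_self_right, Nat.mod_eq_of_lt (by omega)]
    rw [← add_assoc, sweep, hmod, ih (by omega)]
    simp only [adjSwap]
    split_ifs <;> omega

lemma sweep_mul {t p : ℕ} (hp : p < t) : ∀ r ≤ p, sweep t (r * (t - 1)) p = p - r
  | 0, _ => by simp [sweep]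
  | r + 1, hr => by
    rw [Nat.succ_mul, sweep_add le_rfl, sweep_mul hp r (by omega)]
    split_ifs <;> omega

lemma exists_sweep_consecutive {t p p' : ℕ} (hpp : p < p') (hp : p' < t) :
    ∃ s ≤ t * t, sweep t s p + 1 = sweep t s p' := by
  refine ⟨p * (t - 1) + (p' - p - 1), ?_, ?_⟩
  · have h1 : p * (t - 1) ≤ (t - 1) * (t - 1) := Nat.mul_le_mul_right _ (by omega)
    obtain ⟨k, rfl⟩ : ∃ k, t = k + 1 := ⟨t - 1, by omega⟩
    simp only [Nat.add_sub_cancel] at *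
    have h2 : (k + 1) * (k + 1) = k * k + 2 * k + 1 := by ring
    omega
  · rw [sweep_add (by omega), sweep_add (by omega), sweep_mul (by omega) p le_rfl,
      sweep_mul hp p (by omega)]
    split_ifs <;> omega

lemma exists_strings_sweep {Γ : SimpleGraph (ℕ × ℕ)} {b lo hi t : ℕ}
    (hg : ContainsGrid Γ lo hi b) (hlohi : lo ≤ hi) (htb : t ≤ b) (ht : 2 ≤ t) {N : ℕ}
    (u v : ℕ → ℕ × ℕ) (hcross : ∀ s < N, CrossPair Γ (u s) (v s))
    (hsep : ∀ s s', s < s' → s' < N →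
      max (u s).1 (v s).1 + 2 * t + 1 ≤ min (u s').1 (v s').1)
    (hm : ∀ s < N, ∀ z, z = u s ∨ z = v s →
      lo + t + 1 ≤ z.1 ∧ z.1 + t ≤ hi ∧ t + 1 ≤ z.2 ∧ z.2 + t + 1 < b) :
    ∀ n ≤ N, ∃ h Q, lo ≤ h ∧ h ≤ hi ∧
      (h = lo ∨ ∃ s < n, h = max (u s).1 (v s).1 + t) ∧
      Strings Γ b lo h (fun p : Fin t => p.val) (fun p : Fin t => sweep t n p.val) Q ∧
      ∀ s ≤ n, ∃ x, lo ≤ x ∧ x ≤ h ∧ ∀ p : Fin t, (x, sweep t s p.val) ∈ Q p := by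
  intro n hn
  induction n with
  | zero =>
    have hQ := strings_straight (hg.mono le_rfl hlohi) le_rfl
      (Fin.val_injective (n := t)) fun p => p.2.trans_le htb
    refine ⟨lo, _, le_rfl, hlohi, Or.inl rfl, hQ, fun s hs => ⟨lo, le_rfl, le_rfl, fun p => ?_⟩⟩
    obtain rfl : s = 0 := by omega
    exact hQ.bot p
  | succ n ih =>
    obtain ⟨h, Q, hloh, hh, hcase, hQ, hmem⟩ := ih (by omega)
    have hu := hm n (by omega) (u n) (Or.inl rfl)
    have hv := hm n (by omega) (v n) (Or.inr rfl)
    have hlt : h + t + 1 ≤ min (u n).1 (v n).1 := by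
      rcases hcase with rfl | ⟨s, hs, rfl⟩
      · omega
      · have := hsep s n hs (by omega)
        omega
    have hmod := Nat.mod_lt n (show 0 < t - 1 by omega)
    obtain ⟨Q', hQ'⟩ := exists_strings_swap (t := t)
      (hg.mono (lo' := h + 1) (hi' := max (u n).1 (v n).1 + t) (by omega) (by omega))
      (hcross n (by omega)) (by omega) (by omega) (by omega) (by omega) (by omega) (by omega)
      (by omega) (by omega) (c := n % (t - 1)) (by omega)
    have hσ : Function.Injective fun p : Fin t => (⟨sweep t n p.val, sweep_lt ht p.2 n⟩ : Fin t) :=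
      fun p q hpq => Fin.ext (sweep_injective t n (Fin.mk.inj_iff.1 hpq))
    have hQ'' := hQ.append (hQ'.relabel hσ) fun y hy => hg.vert _ _ hloh (by omega) hy
    refine ⟨max (u n).1 (v n).1 + t, _, by omega, by omega, Or.inr ⟨n, by omega, rfl⟩, hQ'',
      fun s hs => ?_⟩
    rcases Nat.lt_or_ge n s with hns | hns
    · obtain rfl : s = n + 1 := by omega
      exact ⟨_, by omega, le_rfl, fun p => hQ''.bot p⟩
    · obtain ⟨x, hx, hx', hxp⟩ := hmem s hns
      exact ⟨x, hx, by omega, fun p => Or.inl (hxp p)⟩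

lemma exists_strings_pairwise_adj {Γ : SimpleGraph (ℕ × ℕ)} {b lo hi t : ℕ}
    (hg : ContainsGrid Γ lo hi b) (hlohi : lo ≤ hi) (htb : t ≤ b) (ht : 2 ≤ t)
    (u v : ℕ → ℕ × ℕ) (hcross : ∀ s < t * t, CrossPair Γ (u s) (v s))
    (hsep : ∀ s s', s < s' → s' < t * t →
      max (u s).1 (v s).1 + 2 * t + 1 ≤ min (u s').1 (v s').1)
    (hm : ∀ s < t * t, ∀ z, z = u s ∨ z = v s →
      lo + t + 1 ≤ z.1 ∧ z.1 + t ≤ hi ∧ t + 1 ≤ z.2 ∧ z.2 + t + 1 < b) :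
    ∃ h Q, h ≤ hi ∧
      Strings Γ b lo h (fun p : Fin t => p.val) (fun p : Fin t => sweep t (t * t) p.val) Q ∧
      ∀ p p' : Fin t, p ≠ p' → ∃ z ∈ Q p, ∃ z' ∈ Q p', Γ.Adj z z' := by
  obtain ⟨h, Q, -, hh, -, hQ, hmem⟩ :=
    exists_strings_sweep hg hlohi htb ht u v hcross hsep hm (t * t) le_rfl
  refine ⟨h, Q, hh, hQ, ?_⟩
  have key : ∀ p p' : Fin t, p < p' → ∃ z ∈ Q p, ∃ z' ∈ Q p', Γ.Adj z z' := by
    intro p p' hpp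
    obtain ⟨s, hs, hcons⟩ := exists_sweep_consecutive (Fin.lt_def.1 hpp) p'.2
    obtain ⟨x, hx, hx', hxp⟩ := hmem s hs
    refine ⟨_, hxp p, _, hxp p', ?_⟩
    rw [← hcons]
    have := sweep_lt ht p'.2 s
    exact hg.horiz _ _ hx (by omega) (by omega)
  intro p p' hpp
  rcases lt_or_gt_of_ne hpp with hlt | hlt
  · exact key p p' hlt
  · obtain ⟨z, hz, z', hz', hadj⟩ := key p' p hlt
    exact ⟨z', hz', z, hz, hadj.symm⟩

/-- `G` has a `K_t`-minor whose branch sets are contained in `A`. -/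
def HasCliqueMinorIn {V : Type*} (G : SimpleGraph V) (A : Set V) (t : ℕ) : Prop :=
  ∃ B : Fin t → Set V, (∀ j, IsConn G (B j)) ∧
    (∀ j k, j ≠ k → ∀ v, v ∈ B j → v ∈ B k → False) ∧ (∀ j, B j ⊆ A) ∧
    ∀ j k, j ≠ k → ∃ u ∈ B j, ∃ v ∈ B k, G.Adj u v

lemma HasCliqueMinorIn.hasMinor {V : Type*} {G : SimpleGraph V} {A : Set V} {t : ℕ}
    (h : HasCliqueMinorIn G A t) : G.HasMinor (⊤ : SimpleGraph (Fin t)) := by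
  obtain ⟨B, hconn, hdisj, -, hadj⟩ := h
  exact ⟨B, hconn, fun j k hjk => Set.disjoint_left.2 fun v => hdisj j k hjk v,
    fun j k hjk => hadj j k hjk⟩

lemma HasCliqueMinorIn.of_comap {V W : Type*} {G : SimpleGraph V} {f : W → V} {A : Set W}
    {A' : Set V} {t : ℕ} (h : HasCliqueMinorIn (G.comap f) A t) (hinj : Set.InjOn f A)
    (hmaps : Set.MapsTo f A A') : HasCliqueMinorIn G A' t := by
  obtain ⟨B, hconn, hdisj, hsub, hadj⟩ := h
  refine ⟨fun j => f '' B j, fun j => (hconn j).image f, ?_, ?_, ?_⟩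
  · rintro j k hjk _ ⟨u, hu, rfl⟩ ⟨v, hv, huv⟩
    obtain rfl := hinj (hsub k hv) (hsub j hu) huv
    exact hdisj j k hjk _ hu hv
  · rintro j _ ⟨u, hu, rfl⟩
    exact hmaps (hsub j hu)
  · intro j k hjk
    obtain ⟨u, hu, v, hv, huv⟩ := hadj j k hjk
    exact ⟨_, ⟨u, hu, rfl⟩, _, ⟨v, hv, rfl⟩, huv⟩

lemma hasCliqueMinorIn_of_families {V : Type*} {G : SimpleGraph V} {A : Set V} {t : ℕ}
    {P P' : Fin t → Set V} (hP : ∀ j, IsConn G (P j)) (hP' : ∀ j, IsConn G (P' j))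
    (hd : ∀ j k, j ≠ k → ∀ v, v ∈ P j → v ∈ P k → False)
    (hd' : ∀ j k, j ≠ k → ∀ v, v ∈ P' j → v ∈ P' k → False)
    (hdd : ∀ j k, j ≠ k → ∀ v, v ∈ P j → v ∈ P' k → False)
    (hA : ∀ j, P j ⊆ A) (hA' : ∀ j, P' j ⊆ A)
    (hadj : ∀ j k, ∃ u ∈ P j, ∃ v ∈ P' k, G.Adj u v) : HasCliqueMinorIn G A t := by
  refine ⟨fun j => P j ∪ P' j, fun j => ?_, ?_, fun j => Set.union_subset (hA j) (hA' j), ?_⟩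
  · obtain ⟨u, hu, v, hv, huv⟩ := hadj j j
    exact isConn_union_of_adj (hP j) (hP' j) hu hv huv
  · rintro j k hjk v (hv | hv) (hv' | hv')
    · exact hd j k hjk v hv hv'
    · exact hdd j k hjk v hv hv'
    · exact hdd k j hjk.symm v hv' hv
    · exact hd' j k hjk v hv hv'
  · intro j k hjk
    obtain ⟨u, hu, v, hv, huv⟩ := hadj j k
    exact ⟨u, Or.inl hu, v, Or.inr hv, huv⟩

/-- The positions in rows `lo, …, hi` and columns `0, …, b - 1`. -/
def slab (lo hi b : ℕ) : Set (ℕ × ℕ) := {z | lo ≤ z.1 ∧ z.1 ≤ hi ∧ z.2 < b}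

lemma exists_connected_colored {V ι : Type*} [Fintype ι] {G : SimpleGraph V} {ψ : ℕ × ℕ → V}
    {lo hi b t : ℕ} (hg : ContainsGrid (G.comap ψ) lo hi b) (hψ : Set.InjOn ψ (slab lo hi b))
    (hlohi : lo ≤ hi) (htb : t ≤ b) (ht : 0 < t) (z : ι → ℕ × ℕ) (κ : ι → Fin t)
    (hrow : ∀ i i', i ≠ i' → (z i).1 + 2 * t + 1 ≤ (z i').1 ∨ (z i').1 + 2 * t + 1 ≤ (z i).1)
    (hm : ∀ i, lo + t + 1 ≤ (z i).1 ∧ (z i).1 + t ≤ hi ∧ t ≤ (z i).2 ∧ (z i).2 + t < b) :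
    ∃ P : Fin t → Set V, (∀ j, IsConn G (P j)) ∧
      (∀ j k, j ≠ k → ∀ v, v ∈ P j → v ∈ P k → False) ∧ (∀ j, P j ⊆ ψ '' slab lo hi b) ∧
      ∀ i, ψ (z i) ∈ P (κ i) := by
  classical
  have hz : Function.Injective z := fun i i' h => by
    by_contra hne
    have := hrow i i' hne
    rw [h] at this
    omega
  obtain ⟨h, Q, hh, -, hQ, hmem⟩ := exists_strings_colored hg hlohi htb
    (Function.extend z κ fun _ => ⟨0, ht⟩) (Finset.univ.image z)
    (by
      intro w hw w' hw' hne
      obtain ⟨i, -, rfl⟩ := Finset.mem_image.1 hw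
      obtain ⟨i', -, rfl⟩ := Finset.mem_image.1 hw'
      exact hrow i i' fun e => hne (e ▸ rfl))
    (by
      intro w hw
      obtain ⟨i, -, rfl⟩ := Finset.mem_image.1 hw
      exact hm i)
  have hslab : ∀ p, Q p ⊆ slab lo hi b := fun p w hw => by
    have := hQ.box p w hw
    exact ⟨this.1, by omega, this.2.2⟩
  refine ⟨fun p => ψ '' Q p, fun p => (hQ.conn p).image ψ, ?_, fun p =>
    Set.image_mono (hslab p), fun i => ⟨z i, ?_, rfl⟩⟩
  · rintro p p' hp _ ⟨u, hu, rfl⟩ ⟨v, hv, huv⟩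
    obtain rfl := hψ (hslab _ hv) (hslab _ hu) huv
    exact hQ.disj p p' hp _ hu hv
  · have := hmem (z i) (Finset.mem_image_of_mem z (Finset.mem_univ i))
    rwa [hz.extend_apply] at this

lemma hasCliqueMinorIn_of_crossPairs {V : Type*} {G : SimpleGraph V} {ψ : ℕ × ℕ → V}
    {lo hi b t : ℕ} (hg : ContainsGrid (G.comap ψ) lo hi b) (hψ : Set.InjOn ψ (slab lo hi b))
    (hlohi : lo ≤ hi) (htb : t ≤ b) (ht : 2 ≤ t)
    (u v : ℕ → ℕ × ℕ) (hcross : ∀ s < t * t, CrossPair (G.comap ψ) (u s) (v s))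
    (hsep : ∀ s s', s < s' → s' < t * t →
      max (u s).1 (v s).1 + 2 * t + 1 ≤ min (u s').1 (v s').1)
    (hm : ∀ s < t * t, ∀ z, z = u s ∨ z = v s →
      lo + t + 1 ≤ z.1 ∧ z.1 + t ≤ hi ∧ t + 1 ≤ z.2 ∧ z.2 + t + 1 < b) :
    HasCliqueMinorIn G (ψ '' slab lo hi b) t := by
  obtain ⟨h, Q, hh, hQ, hadj⟩ :=
    exists_strings_pairwise_adj hg hlohi htb ht u v hcross hsep hm
  refine HasCliqueMinorIn.of_comap (f := ψ) (A := slab lo hi b) ⟨Q, hQ.conn, hQ.disj,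
    fun p w hw => ?_, hadj⟩ hψ (Set.mapsTo_image _ _)
  have := hQ.box p w hw
  exact ⟨this.1, by omega, this.2.2⟩

/-- The vertex set of the `ℓ × ℓ` double grid, as triples (layer, row, column). -/
def dbox (ℓ : ℕ) : Set (ℕ × ℕ × ℕ) := {v | v.1 < 2 ∧ v.2.1 < ℓ ∧ v.2.2 < ℓ}

/-- The edges that a triangulated double grid has to contain. -/
structure ContainsDoubleGrid (H : SimpleGraph (ℕ × ℕ × ℕ)) (ℓ : ℕ) : Prop where
  horiz : ∀ s x y, s < 2 → x < ℓ → y + 1 < ℓ → H.Adj (s, x, y) (s, x, y + 1)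
  vert : ∀ s x y, s < 2 → x + 1 < ℓ → y < ℓ → H.Adj (s, x, y) (s, x + 1, y)
  cell : ∀ s x y, s < 2 → x + 1 < ℓ → y + 1 < ℓ →
    H.Adj (s, x, y) (s, x + 1, y + 1) ∨ H.Adj (s, x, y + 1) (s, x + 1, y)
  rung : ∀ x y, x < ℓ → y < ℓ → (x = 0 ∨ x = ℓ - 1 ∨ y = 0 ∨ y = ℓ - 1) →
    H.Adj (0, x, y) (1, x, y)
  quad_vert : ∀ x y, x + 1 < ℓ → y < ℓ → (y = 0 ∨ y = ℓ - 1) →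
    H.Adj (0, x, y) (1, x + 1, y) ∨ H.Adj (1, x, y) (0, x + 1, y)
  quad_horiz : ∀ x y, x < ℓ → y + 1 < ℓ → (x = 0 ∨ x = ℓ - 1) →
    H.Adj (0, x, y) (1, x, y + 1) ∨ H.Adj (1, x, y) (0, x, y + 1)

/-- Exchange of rows and columns. -/
def transp (v : ℕ × ℕ × ℕ) : ℕ × ℕ × ℕ := (v.1, v.2.2, v.2.1)

lemma ContainsDoubleGrid.transp {H : SimpleGraph (ℕ × ℕ × ℕ)} {ℓ : ℕ}
    (h : ContainsDoubleGrid H ℓ) : ContainsDoubleGrid (H.comap transp) ℓ where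
  horiz s x y hs hx hy := h.vert s y x hs hy hx
  vert s x y hs hx hy := h.horiz s y x hs hy hx
  cell s x y hs hx hy := (h.cell s y x hs hy hx).imp id fun h => h.symm
  rung x y hx hy hxy := h.rung y x hy hx (by tauto)
  quad_vert x y hx hy hxy := h.quad_horiz y x hy hx hxy
  quad_horiz x y hx hy hxy := h.quad_vert y x hy hx hxy

/-- Position `(x, k)` on the cylinder formed by the rows of the double grid, where the columns
of the cylinder are counted from `h`. -/
def cyl (ℓ h : ℕ) (z : ℕ × ℕ) : ℕ × ℕ × ℕ :=
  if z.2 + h < ℓ then (0, z.1, z.2 + h)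
  else if z.2 + h < 2 * ℓ then (1, z.1, 2 * ℓ - 1 - (z.2 + h))
  else if z.2 + h < 3 * ℓ then (0, z.1, z.2 + h - 2 * ℓ)
  else (1, z.1, 4 * ℓ - 1 - (z.2 + h))

/-- The position on the cylinder of a vertex of the double grid. -/
def cylCoord (ℓ h : ℕ) (v : ℕ × ℕ × ℕ) : ℕ × ℕ :=
  (v.2.1, if v.1 = 0 then (if h ≤ v.2.2 then v.2.2 - h else v.2.2 + 2 * ℓ - h)
    else (if h ≤ 2 * ℓ - 1 - v.2.2 then 2 * ℓ - 1 - v.2.2 - h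
      else 2 * ℓ - 1 - v.2.2 + 2 * ℓ - h))

lemma cylCoord_lt {ℓ h : ℕ} (hh : h < 2 * ℓ) {v : ℕ × ℕ × ℕ} (hv : v ∈ dbox ℓ) :
    (cylCoord ℓ h v).2 < 2 * ℓ := by
  obtain ⟨s, x, y⟩ := v
  simp only [dbox, Set.mem_ofPred_eq, cylCoord] at hv ⊢
  split_ifs <;> omega

lemma cyl_cylCoord {ℓ h : ℕ} (hh : h < 2 * ℓ) {v : ℕ × ℕ × ℕ} (hv : v ∈ dbox ℓ) :
    cyl ℓ h (cylCoord ℓ h v) = v := by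
  obtain ⟨s, x, y⟩ := v
  simp only [dbox, Set.mem_ofPred_eq, cylCoord, cyl] at hv ⊢
  split_ifs <;> (simp only [Prod.mk.injEq, true_and]; omega)

lemma cyl_mem {ℓ h : ℕ} (hh : h < 2 * ℓ) {z : ℕ × ℕ} (hz : z.1 < ℓ) (hz' : z.2 < 2 * ℓ) :
    cyl ℓ h z ∈ dbox ℓ := by
  simp only [dbox, Set.mem_ofPred_eq, cyl]
  split_ifs <;> (simp only []; omega)

lemma cyl_injOn {ℓ h lo hi b : ℕ} (hh : h < 2 * ℓ) (hb : b ≤ 2 * ℓ) :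
    Set.InjOn (cyl ℓ h) (slab lo hi b) := by
  rintro ⟨x, y⟩ ⟨-, -, hy⟩ ⟨x', y'⟩ ⟨-, -, hy'⟩ heq
  simp only [cyl] at heq hy hy'
  split_ifs at heq <;> (simp only [Prod.mk.injEq, true_and] at heq ⊢; omega)

lemma cyl_succ {ℓ h : ℕ} (hh : h < 2 * ℓ) {k : ℕ} (hk : k + 1 < 2 * ℓ) :
    (∃ s y, s < 2 ∧ y + 1 < ℓ ∧
      ((∀ x, cyl ℓ h (x, k) = (s, x, y) ∧ cyl ℓ h (x, k + 1) = (s, x, y + 1)) ∨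
        ∀ x, cyl ℓ h (x, k + 1) = (s, x, y) ∧ cyl ℓ h (x, k) = (s, x, y + 1))) ∨
    ∃ y, y < ℓ ∧ (y = 0 ∨ y = ℓ - 1) ∧
      ((∀ x, cyl ℓ h (x, k) = (0, x, y) ∧ cyl ℓ h (x, k + 1) = (1, x, y)) ∨
        ∀ x, cyl ℓ h (x, k + 1) = (0, x, y) ∧ cyl ℓ h (x, k) = (1, x, y)) := by
  have h0 : ∀ x k, k + h < ℓ → cyl ℓ h (x, k) = (0, x, k + h) := fun x k hk => by
    simp only [cyl, if_pos hk]
  have h1 : ∀ x k, ℓ ≤ k + h → k + h < 2 * ℓ → cyl ℓ h (x, k) = (1, x, 2 * ℓ - 1 - (k + h)) :=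
    fun x k hk hk' => by simp only [cyl, if_neg hk.not_gt, if_pos hk']
  have h2 : ∀ x k, 2 * ℓ ≤ k + h → k + h < 3 * ℓ → cyl ℓ h (x, k) = (0, x, k + h - 2 * ℓ) :=
    fun x k hk hk' => by
      simp only [cyl, if_neg hk.not_gt, if_neg (by omega : ¬ k + h < ℓ), if_pos hk']
  have h3 : ∀ x k, 3 * ℓ ≤ k + h → cyl ℓ h (x, k) = (1, x, 4 * ℓ - 1 - (k + h)) :=
    fun x k hk => by
      simp only [cyl, if_neg hk.not_gt, if_neg (by omega : ¬ k + h < ℓ),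
        if_neg (by omega : ¬ k + h < 2 * ℓ)]
  rcases (by omega : k + h + 1 < ℓ ∨ k + h + 1 = ℓ ∨ (ℓ ≤ k + h ∧ k + h + 1 < 2 * ℓ) ∨
    k + h + 1 = 2 * ℓ ∨ (2 * ℓ ≤ k + h ∧ k + h + 1 < 3 * ℓ) ∨ k + h + 1 = 3 * ℓ ∨
    3 * ℓ ≤ k + h) with hc | hc | hc | hc | hc | hc | hc
  · refine Or.inl ⟨0, k + h, by omega, by omega, Or.inl fun x => ⟨h0 _ _ (by omega), ?_⟩⟩
    rw [h0 _ _ (by omega), add_right_comm]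
  · refine Or.inr ⟨k + h, by omega, by omega, Or.inl fun x => ⟨h0 _ _ (by omega), ?_⟩⟩
    rw [h1 _ _ (by omega) (by omega)]
    congr 2
    omega
  · refine Or.inl ⟨1, 2 * ℓ - 1 - (k + 1 + h), by omega, by omega, Or.inr fun x =>
      ⟨h1 _ _ (by omega) (by omega), ?_⟩⟩
    rw [h1 _ _ (by omega) (by omega)]
    congr 2
    omega
  · refine Or.inr ⟨0, by omega, by omega, Or.inr fun x => ⟨?_, ?_⟩⟩
    · rw [h2 _ _ (by omega) (by omega)]
      congr 2
      omega
    · rw [h1 _ _ (by omega) (by omega)]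
      congr 2
      omega
  · refine Or.inl ⟨0, k + h - 2 * ℓ, by omega, by omega, Or.inl fun x =>
      ⟨h2 _ _ (by omega) (by omega), ?_⟩⟩
    rw [h2 _ _ (by omega) (by omega)]
    congr 2
    omega
  · refine Or.inr ⟨k + h - 2 * ℓ, by omega, by omega, Or.inl fun x =>
      ⟨h2 _ _ (by omega) (by omega), ?_⟩⟩
    rw [h3 _ _ (by omega)]
    congr 2
    omega
  · refine Or.inl ⟨1, 4 * ℓ - 1 - (k + 1 + h), by omega, by omega, Or.inr fun x =>
      ⟨h3 _ _ (by omega), ?_⟩⟩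
    rw [h3 _ _ (by omega)]
    congr 2
    omega

lemma ContainsDoubleGrid.cyl_horiz {H : SimpleGraph (ℕ × ℕ × ℕ)} {ℓ : ℕ}
    (hH : ContainsDoubleGrid H ℓ) {h x k : ℕ} (hh : h < 2 * ℓ) (hx : x < ℓ)
    (hk : k + 1 < 2 * ℓ) : H.Adj (cyl ℓ h (x, k)) (cyl ℓ h (x, k + 1)) := by
  rcases cyl_succ hh hk with ⟨s, y, hs, hy, he | he⟩ | ⟨y, hy, hy', he | he⟩ <;>
    rw [(he x).1, (he x).2]
  · exact hH.horiz s x y hs hx hy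
  · exact (hH.horiz s x y hs hx hy).symm
  · exact hH.rung x y hx hy (by tauto)
  · exact (hH.rung x y hx hy (by tauto)).symm

lemma ContainsDoubleGrid.cyl_vert {H : SimpleGraph (ℕ × ℕ × ℕ)} {ℓ : ℕ}
    (hH : ContainsDoubleGrid H ℓ) {h x k : ℕ} (hh : h < 2 * ℓ) (hx : x + 1 < ℓ)
    (hk : k < 2 * ℓ) : H.Adj (cyl ℓ h (x, k)) (cyl ℓ h (x + 1, k)) := by
  simp only [cyl]
  split_ifs <;> exact hH.vert _ _ _ (by omega) hx (by omega)

lemma ContainsDoubleGrid.cyl_cell {H : SimpleGraph (ℕ × ℕ × ℕ)} {ℓ : ℕ}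
    (hH : ContainsDoubleGrid H ℓ) {h x k : ℕ} (hh : h < 2 * ℓ) (hx : x + 1 < ℓ)
    (hk : k + 1 < 2 * ℓ) :
    H.Adj (cyl ℓ h (x, k)) (cyl ℓ h (x + 1, k + 1)) ∨
      H.Adj (cyl ℓ h (x, k + 1)) (cyl ℓ h (x + 1, k)) := by
  rcases cyl_succ hh hk with ⟨s, y, hs, hy, he | he⟩ | ⟨y, hy, hy', he | he⟩ <;>
    rw [(he x).1, (he x).2, (he (x + 1)).1, (he (x + 1)).2]
  · exact hH.cell s x y hs hx hy
  · exact (hH.cell s x y hs hx hy).symm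
  · exact hH.quad_vert x y hx hy hy'
  · exact (hH.quad_vert x y hx hy hy').symm

lemma ContainsDoubleGrid.containsGrid_cyl {H : SimpleGraph (ℕ × ℕ × ℕ)} {ℓ : ℕ}
    (hH : ContainsDoubleGrid H ℓ) {U : SimpleGraph (ℕ × ℕ × ℕ)} (hU : H ≤ U) {h lo hi b : ℕ}
    (hh : h < 2 * ℓ) (hhi : hi < ℓ) (hb : b ≤ 2 * ℓ) :
    ContainsGrid (U.comap (cyl ℓ h)) lo hi b where
  vert x y _ hx hy := hU (hH.cyl_vert hh (by omega) (by omega))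
  horiz x y _ hx hy := hU (hH.cyl_horiz hh (by omega) (by omega))

lemma ContainsDoubleGrid.crossPair {H : SimpleGraph (ℕ × ℕ × ℕ)} {ℓ : ℕ}
    (hH : ContainsDoubleGrid H ℓ) {U : SimpleGraph (ℕ × ℕ × ℕ)} (hU : H ≤ U) {h : ℕ}
    (hh : h < 2 * ℓ) {u v : ℕ × ℕ × ℕ} (hu : u ∈ dbox ℓ) (hv : v ∈ dbox ℓ) (hadj : U.Adj u v)
    (hnadj : ¬ H.Adj u v) :
    CrossPair (U.comap (cyl ℓ h)) (cylCoord ℓ h u) (cylCoord ℓ h v) := by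
  have hu1 : (cylCoord ℓ h u).1 < ℓ := hu.2.1
  have hv1 : (cylCoord ℓ h v).1 < ℓ := hv.2.1
  have hu2 := cylCoord_lt hh hu
  have hv2 := cylCoord_lt hh hv
  rw [← cyl_cylCoord hh hu, ← cyl_cylCoord hh hv] at hadj hnadj
  generalize cylCoord ℓ h u = z at *
  generalize cylCoord ℓ h v = w at *
  obtain ⟨x, y⟩ := z
  obtain ⟨x', y'⟩ := w
  simp only at hu1 hv1 hu2 hv2
  refine ⟨hadj, ?_, ?_, ?_⟩ <;> simp only
  · rintro rfl (rfl | rfl)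
    · exact hnadj (hH.cyl_horiz hh hu1 hv2)
    · exact hnadj (hH.cyl_horiz hh hu1 hu2).symm
  · rintro rfl (rfl | rfl)
    · exact hnadj (hH.cyl_vert hh hv1 hu2)
    · exact hnadj (hH.cyl_vert hh hu1 hu2).symm
  · rintro (rfl | rfl) (rfl | rfl) <;> refine hU ?_
    · exact (hH.cyl_cell hh hv1 hv2).resolve_left hnadj
    · exact (hH.cyl_cell hh hv1 hu2).resolve_right hnadj
    · exact ((hH.cyl_cell hh hu1 hv2).resolve_right fun h => hnadj h.symm).symm
    · exact ((hH.cyl_cell hh hu1 hu2).resolve_left fun h => hnadj h.symm).symm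

lemma exists_cyl_shift {ℓ t : ℕ} (R : Finset (ℕ × ℕ × ℕ)) (hR : ∀ v ∈ R, v ∈ dbox ℓ)
    (hcard : R.card * (2 * t + 4) < 2 * ℓ) :
    ∃ h < 2 * ℓ, ∀ v ∈ R, t + 1 ≤ (cylCoord ℓ h v).2 ∧ (cylCoord ℓ h v).2 + t + 1 < 2 * ℓ := by
  classical
  let bad : Finset ℕ := (Finset.range (t + 2)) ∪ Finset.Ico (2 * ℓ - (t + 2)) (2 * ℓ)
  have hbad : bad.card ≤ 2 * t + 4 := by
    refine (Finset.card_union_le _ _).trans ?_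
    rw [Finset.card_range, Nat.card_Ico]
    omega
  let F : (ℕ × ℕ × ℕ) × ℕ → ℕ := fun p => (cylCoord ℓ p.2 p.1).2
  have hlt : ((R ×ˢ bad).image F).card < (Finset.range (2 * ℓ)).card := by
    refine Finset.card_image_le.trans_lt ?_
    rw [Finset.card_product, Finset.card_range]
    exact (Nat.mul_le_mul_left _ hbad).trans_lt hcard
  obtain ⟨h, hh, hnot⟩ := Finset.exists_mem_notMem_of_card_lt_card hlt
  rw [Finset.mem_range] at hh
  refine ⟨h, hh, fun v hv => ?_⟩
  have hv' := hR v hv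
  have hcol := cylCoord_lt hh hv'
  by_contra hcon
  refine hnot (Finset.mem_image.2 ⟨(v, (cylCoord ℓ h v).2), Finset.mem_product.2 ⟨hv, ?_⟩, ?_⟩)
  · simp only [bad, Finset.mem_union, Finset.mem_range, Finset.mem_Ico]
    omega
  · obtain ⟨s, x, y⟩ := v
    simp only [dbox, Set.mem_ofPred_eq, cylCoord, F] at hv' ⊢
    split_ifs <;> omega

/-- The natural numbers `x` and `y` differ by at least `d`. -/
def FarApart (d x y : ℕ) : Prop := x + d ≤ y ∨ y + d ≤ x

lemma FarApart.symm {d x y : ℕ} (h : FarApart d x y) : FarApart d y x := Or.symm h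

lemma FarApart.mono {d d' x y : ℕ} (h : FarApart d x y) (hd : d' ≤ d) : FarApart d' x y :=
  h.imp (fun h => by omega) fun h => by omega

lemma transp_injective : Function.Injective transp := by
  rintro ⟨s, x, y⟩ ⟨s', x', y'⟩ h
  simp only [transp, Prod.mk.injEq] at h ⊢
  tauto

lemma transp_mem {ℓ : ℕ} {v : ℕ × ℕ × ℕ} (hv : v ∈ dbox ℓ) : transp v ∈ dbox ℓ :=
  ⟨hv.1, hv.2.2, hv.2.1⟩

lemma HasCliqueMinorIn.mono {V : Type*} {G : SimpleGraph V} {A A' : Set V} {t : ℕ}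
    (h : HasCliqueMinorIn G A t) (hA : A ⊆ A') : HasCliqueMinorIn G A' t := by
  obtain ⟨B, h1, h2, h3, h4⟩ := h
  exact ⟨B, h1, h2, fun j => (h3 j).trans hA, h4⟩

lemma cyl_image_slab {ℓ h lo hi b : ℕ} (hh : h < 2 * ℓ) (hhi : hi < ℓ) (hb : b ≤ 2 * ℓ) :
    cyl ℓ h '' slab lo hi b ⊆ dbox ℓ := by
  rintro _ ⟨z, hz, rfl⟩
  exact cyl_mem hh (hz.2.1.trans_lt hhi) (hz.2.2.trans_le hb)

lemma cylCoord_transp_cases (ℓ h : ℕ) (v : ℕ × ℕ × ℕ) :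
    (h ≤ v.2.1 ∧ (cylCoord ℓ h (transp v)).2 = v.2.1 - h) ∨
    (v.2.1 < h ∧ (cylCoord ℓ h (transp v)).2 = v.2.1 + 2 * ℓ - h) ∨
    (h ≤ 2 * ℓ - 1 - v.2.1 ∧ (cylCoord ℓ h (transp v)).2 = 2 * ℓ - 1 - v.2.1 - h) ∨
    (2 * ℓ - 1 - v.2.1 < h ∧
      (cylCoord ℓ h (transp v)).2 = 2 * ℓ - 1 - v.2.1 + 2 * ℓ - h) := by
  obtain ⟨s, x, y⟩ := v
  have ht : transp (s, x, y) = (s, y, x) := rfl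
  rw [ht]
  simp only [cylCoord]
  split_ifs <;> omega

/-- `e` is a pair of vertices of the double grid that is an edge of `U` but not of `H`. -/
structure IsJump (H U : SimpleGraph (ℕ × ℕ × ℕ)) (ℓ : ℕ)
    (e : (ℕ × ℕ × ℕ) × (ℕ × ℕ × ℕ)) : Prop where
  fst_mem : e.1 ∈ dbox ℓ
  snd_mem : e.2 ∈ dbox ℓ
  adj : U.Adj e.1 e.2
  not_adj : ¬ H.Adj e.1 e.2

lemma exists_indexing {α : Type*} {t : ℕ} {T : Finset α} (hT : t * t ≤ T.card) :
    ∃ e : Fin t × Fin t → α, Function.Injective e ∧ ∀ i, e i ∈ T := by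
  have hcard : Fintype.card (Fin t × Fin t) ≤ Fintype.card T := by simpa using hT
  obtain ⟨f⟩ := Function.Embedding.nonempty_of_card_le hcard
  exact ⟨fun i => (f i).1, Subtype.val_injective.comp f.injective, fun i => (f i).2⟩

lemma exists_increasing_enumeration {α : Type*} [Nonempty α] {T : Finset α} {f : α → ℕ}
    (hf : Set.InjOn f T) : ∃ e : ℕ → α, (∀ s < T.card, e s ∈ T) ∧
      ∀ s s', s < s' → s' < T.card → f (e s) < f (e s') := by
  classical
  have hcard : (T.image f).card = T.card := Finset.card_image_of_injOn hf
  let g := (T.image f).orderEmbOfFin hcard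
  have hg : ∀ s : Fin T.card, ∃ a ∈ T, f a = g s := fun s =>
    Finset.mem_image.1 ((T.image f).orderEmbOfFin_mem hcard s)
  choose a ha hfa using hg
  refine ⟨fun s => if h : s < T.card then a ⟨s, h⟩ else Classical.arbitrary α, ?_, ?_⟩
  · intro s hs
    simp only [dif_pos hs]
    exact ha _
  · intro s s' hss hs'
    simp only [dif_pos hs', dif_pos (hss.trans hs'), hfa]
    exact g.strictMono hss

lemma hasCliqueMinorIn_of_long_jumps {H U : SimpleGraph (ℕ × ℕ × ℕ)} {ℓ t : ℕ}
    (hH : ContainsDoubleGrid H ℓ) (hU : H ≤ U) (ht : 2 ≤ t)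
    (hℓ : 2 * (t * t) * (2 * t + 4) < 2 * ℓ) {T : Finset ((ℕ × ℕ × ℕ) × (ℕ × ℕ × ℕ))}
    (hT : t * t ≤ T.card) (hjump : ∀ e ∈ T, IsJump H U ℓ e)
    (hm : ∀ e ∈ T, (t + 1 ≤ e.1.2.1 ∧ e.1.2.1 + t < ℓ) ∧ t + 1 ≤ e.2.2.1 ∧ e.2.2.1 + t < ℓ)
    (hlong : ∀ e ∈ T, FarApart (2 * t + 1) e.1.2.1 e.2.2.1)
    (hfar : ∀ e ∈ T, ∀ e' ∈ T, e ≠ e' → FarApart (2 * t + 1) e.1.2.1 e'.1.2.1 ∧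
      FarApart (2 * t + 1) e.1.2.1 e'.2.2.1 ∧ FarApart (2 * t + 1) e.2.2.1 e'.2.2.1) :
    HasCliqueMinorIn U (dbox ℓ) t := by
  classical
  obtain ⟨e, he, heT⟩ := exists_indexing hT
  let w : (Fin t × Fin t) ⊕ (Fin t × Fin t) → ℕ × ℕ × ℕ :=
    Sum.elim (fun i => (e i).1) fun i => (e i).2
  have hw : ∀ i, w i ∈ dbox ℓ := by
    rintro (i | i)
    · exact (hjump _ (heT i)).fst_mem
    · exact (hjump _ (heT i)).snd_mem
  obtain ⟨h, hh, hcol⟩ := exists_cyl_shift (t := t) (Finset.univ.image w)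
    (by
      intro v hv
      obtain ⟨i, -, rfl⟩ := Finset.mem_image.1 hv
      exact hw i)
    (by
      refine lt_of_le_of_lt (Nat.mul_le_mul_right _ (Finset.card_image_le.trans ?_)) hℓ
      simp only [Finset.card_univ, Fintype.card_sum, Fintype.card_prod, Fintype.card_fin]
      omega)
  have hℓt : t < ℓ := by
    have : t * 1 ≤ t * t := Nat.mul_le_mul_left _ (by omega)
    have : 2 * (t * t) * 1 ≤ 2 * (t * t) * (2 * t + 4) := Nat.mul_le_mul_left _ (by omega)
    omega
  obtain ⟨P, hP, hPd, hPA, hmem⟩ := exists_connected_colored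
    (hH.containsGrid_cyl hU (lo := 0) (hi := ℓ - 1) hh (by omega) le_rfl)
    (cyl_injOn hh le_rfl) (by omega) (by omega) (by omega) (fun i => cylCoord ℓ h (w i))
    (Sum.elim Prod.fst Prod.snd)
    (by
      have key : ∀ i i', i ≠ i' → FarApart (2 * t + 1) (w i).2.1 (w i').2.1 := by
        rintro (i | i) (i' | i') hne
        · exact (hfar _ (heT i) _ (heT i') (he.ne fun h => hne (h ▸ rfl))).1
        · by_cases h : i = i'
          · exact h ▸ hlong _ (heT i)
          · exact (hfar _ (heT i) _ (heT i') (he.ne h)).2.1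
        · by_cases h : i' = i
          · exact h ▸ (hlong _ (heT i')).symm
          · exact (hfar _ (heT i') _ (heT i) (he.ne h)).2.1.symm
        · exact (hfar _ (heT i) _ (heT i') (he.ne fun h => hne (h ▸ rfl))).2.2
      intro i i' hne
      have := key i i' hne
      simp only [FarApart, cylCoord] at this ⊢
      omega)
    (by
      intro i
      have h1 := hcol (w i) (Finset.mem_image_of_mem w (Finset.mem_univ i))
      have h2 : t + 1 ≤ (w i).2.1 ∧ (w i).2.1 + t < ℓ := by
        rcases i with i | i
        · exact (hm _ (heT i)).1
        · exact (hm _ (heT i)).2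
      have h3 : (cylCoord ℓ h (w i)).1 = (w i).2.1 := rfl
      omega)
  have hA : ∀ j, P j ⊆ dbox ℓ := fun j => (hPA j).trans (cyl_image_slab hh (by omega) le_rfl)
  refine hasCliqueMinorIn_of_families hP hP hPd hPd hPd hA hA fun j k => ?_
  refine ⟨_, hmem (Sum.inl (j, k)), _, hmem (Sum.inr (j, k)), ?_⟩
  rw [cyl_cylCoord hh (hw _), cyl_cylCoord hh (hw _)]
  exact (hjump _ (heT (j, k))).adj

lemma hasCliqueMinorIn_of_short_jumps {H U : SimpleGraph (ℕ × ℕ × ℕ)} {ℓ t : ℕ}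
    (hH : ContainsDoubleGrid H ℓ) (hU : H ≤ U) (ht : 2 ≤ t)
    (hℓ : 2 * (t * t) * (2 * t + 4) < 2 * ℓ) {T : Finset ((ℕ × ℕ × ℕ) × (ℕ × ℕ × ℕ))}
    (hT : t * t ≤ T.card) (hjump : ∀ e ∈ T, IsJump H U ℓ e)
    (hm : ∀ e ∈ T, (t + 1 ≤ e.1.2.1 ∧ e.1.2.1 + t < ℓ) ∧ t + 1 ≤ e.2.2.1 ∧ e.2.2.1 + t < ℓ)
    (hshort : ∀ e ∈ T, ¬ FarApart (2 * t + 1) e.1.2.1 e.2.2.1)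
    (hfar : ∀ e ∈ T, ∀ e' ∈ T, e ≠ e' → FarApart (6 * t + 6) e.1.2.1 e'.1.2.1) :
    HasCliqueMinorIn U (dbox ℓ) t := by
  classical
  obtain ⟨T', hT', hcard⟩ := Finset.exists_subset_card_eq hT
  have hinj : Set.InjOn (fun e : (ℕ × ℕ × ℕ) × (ℕ × ℕ × ℕ) => e.1.2.1) T' := by
    intro e he e' he' heq
    by_contra hne
    have := hfar e (hT' he) e' (hT' he') hne
    simp only [FarApart] at this heq
    omega
  obtain ⟨e, he, hmono⟩ := exists_increasing_enumeration hinj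
  rw [hcard] at he hmono
  obtain ⟨h, hh, hcol⟩ := exists_cyl_shift (t := t) (T'.image Prod.fst ∪ T'.image Prod.snd)
    (by
      intro v hv
      rcases Finset.mem_union.1 hv with hv | hv <;> obtain ⟨i, hi, rfl⟩ := Finset.mem_image.1 hv
      · exact (hjump _ (hT' hi)).fst_mem
      · exact (hjump _ (hT' hi)).snd_mem)
    (by
      refine lt_of_le_of_lt (Nat.mul_le_mul_right _ ((Finset.card_union_le _ _).trans ?_)) hℓ
      have h1 := Finset.card_image_le (s := T') (f := Prod.fst)
      have h2 := Finset.card_image_le (s := T') (f := Prod.snd)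
      omega)
  have hℓt : t < ℓ := by
    have : t * 1 ≤ t * t := Nat.mul_le_mul_left _ (by omega)
    have : 2 * (t * t) * 1 ≤ 2 * (t * t) * (2 * t + 4) := Nat.mul_le_mul_left _ (by omega)
    omega
  refine (hasCliqueMinorIn_of_crossPairs
    (hH.containsGrid_cyl hU (lo := 0) (hi := ℓ - 1) hh (by omega) le_rfl)
    (cyl_injOn hh le_rfl) (by omega) (by omega) ht (fun s => cylCoord ℓ h (e s).1)
    (fun s => cylCoord ℓ h (e s).2) ?_ ?_ ?_).mono (cyl_image_slab hh (by omega) le_rfl)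
  · intro s hs
    have := hjump _ (hT' (he s hs))
    exact hH.crossPair hU hh this.fst_mem this.snd_mem this.adj this.not_adj
  · intro s s' hss hs'
    have h1 := hmono s s' hss hs'
    have h2 := hshort _ (hT' (he s (hss.trans hs')))
    have h3 := hshort _ (hT' (he s' hs'))
    have h4 := hfar _ (hT' (he s (hss.trans hs'))) _ (hT' (he s' hs'))
      (fun h => by rw [h] at h1; exact lt_irrefl _ h1)
    simp only [FarApart, cylCoord] at *
    omega
  · rintro s hs z (rfl | rfl)
    · have h1 := (hm _ (hT' (he s hs))).1
      have h2 := hcol (e s).1 (Finset.mem_union_left _ (Finset.mem_image_of_mem _ (he s hs)))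
      have h3 : (cylCoord ℓ h (e s).1).1 = (e s).1.2.1 := rfl
      omega
    · have h1 := (hm _ (hT' (he s hs))).2
      have h2 := hcol (e s).2 (Finset.mem_union_right _ (Finset.mem_image_of_mem _ (he s hs)))
      have h3 : (cylCoord ℓ h (e s).2).1 = (e s).2.2.1 := rfl
      omega

lemma hasCliqueMinorIn_of_row_far {H U : SimpleGraph (ℕ × ℕ × ℕ)} {ℓ t : ℕ}
    (hH : ContainsDoubleGrid H ℓ) (hU : H ≤ U) (ht : 2 ≤ t)
    (hℓ : 2 * (t * t) * (2 * t + 4) < 2 * ℓ) {T : Finset ((ℕ × ℕ × ℕ) × (ℕ × ℕ × ℕ))}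
    (hT : 2 * (t * t) ≤ T.card) (hjump : ∀ e ∈ T, IsJump H U ℓ e)
    (hm : ∀ e ∈ T, (t + 1 ≤ e.1.2.1 ∧ e.1.2.1 + t < ℓ) ∧ t + 1 ≤ e.2.2.1 ∧ e.2.2.1 + t < ℓ)
    (hfar : ∀ e ∈ T, ∀ e' ∈ T, e ≠ e' → FarApart (6 * t + 6) e.1.2.1 e'.1.2.1 ∧
      FarApart (6 * t + 6) e.1.2.1 e'.2.2.1 ∧ FarApart (6 * t + 6) e.2.2.1 e'.2.2.1) :
    HasCliqueMinorIn U (dbox ℓ) t := by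
  classical
  have hsplit := Finset.card_filter_add_card_filter_not (s := T)
    (fun e => FarApart (2 * t + 1) e.1.2.1 e.2.2.1)
  rcases (by omega : t * t ≤ (T.filter fun e => FarApart (2 * t + 1) e.1.2.1 e.2.2.1).card ∨
    t * t ≤ (T.filter fun e => ¬ FarApart (2 * t + 1) e.1.2.1 e.2.2.1).card) with h | h
  · refine hasCliqueMinorIn_of_long_jumps hH hU ht hℓ h
      (fun e he => hjump e (Finset.mem_filter.1 he).1)
      (fun e he => hm e (Finset.mem_filter.1 he).1)
      (fun e he => (Finset.mem_filter.1 he).2) fun e he e' he' hne => ?_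
    obtain ⟨h1, h2, h3⟩ := hfar e (Finset.mem_filter.1 he).1 e' (Finset.mem_filter.1 he').1 hne
    exact ⟨h1.mono (by omega), h2.mono (by omega), h3.mono (by omega)⟩
  · exact hasCliqueMinorIn_of_short_jumps hH hU ht hℓ h
      (fun e he => hjump e (Finset.mem_filter.1 he).1)
      (fun e he => hm e (Finset.mem_filter.1 he).1)
      (fun e he => (Finset.mem_filter.1 he).2) fun e he e' he' hne =>
        (hfar e (Finset.mem_filter.1 he).1 e' (Finset.mem_filter.1 he').1 hne).1

lemma hasCliqueMinorIn_of_two_regions {H U : SimpleGraph (ℕ × ℕ × ℕ)} {ℓ t lo hi h b : ℕ}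
    (hH : ContainsDoubleGrid H ℓ) (hU : H ≤ U) (ht : 2 ≤ t)
    (hℓ : 2 * (t * t) * (2 * t + 4) < 2 * ℓ) {T : Finset ((ℕ × ℕ × ℕ) × (ℕ × ℕ × ℕ))}
    (hT : t * t ≤ T.card) (hjump : ∀ e ∈ T, IsJump H U ℓ e) (hlo : lo ≤ hi) (hhi : hi < ℓ)
    (hh : h < 2 * ℓ) (htb : t ≤ b) (hb : b ≤ 2 * ℓ)
    (hdisj : ∀ z, z.2 < b → lo ≤ (cyl ℓ h z).2.2 → (cyl ℓ h z).2.2 ≤ hi → False)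
    (hrow : ∀ e ∈ T, lo + t + 1 ≤ e.2.2.1 ∧ e.2.2.1 + t ≤ hi)
    (hcol : ∀ e ∈ T, t + 1 ≤ e.1.2.2 ∧ e.1.2.2 + t < ℓ)
    (hcoord : ∀ e ∈ T, t ≤ (cylCoord ℓ h (transp e.1)).2 ∧
      (cylCoord ℓ h (transp e.1)).2 + t < b)
    (hfar : ∀ e ∈ T, ∀ e' ∈ T, e ≠ e' → FarApart (2 * t + 1) e.2.2.1 e'.2.2.1 ∧
      FarApart (2 * t + 1) e.1.2.2 e'.1.2.2) :
    HasCliqueMinorIn U (dbox ℓ) t := by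
  classical
  obtain ⟨e, he, heT⟩ := exists_indexing hT
  obtain ⟨h', hh', hcol'⟩ := exists_cyl_shift (t := t) (Finset.univ.image fun i => (e i).2)
    (by
      intro v hv
      obtain ⟨i, -, rfl⟩ := Finset.mem_image.1 hv
      exact (hjump _ (heT i)).snd_mem)
    (by
      refine lt_of_le_of_lt (Nat.mul_le_mul_right _ (Finset.card_image_le.trans ?_)) hℓ
      simp only [Finset.card_univ, Fintype.card_prod, Fintype.card_fin]
      omega)
  have hℓt : t < ℓ := by
    have : t * 1 ≤ t * t := Nat.mul_le_mul_left _ (by omega)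
    have : 2 * (t * t) * 1 ≤ 2 * (t * t) * (2 * t + 4) := Nat.mul_le_mul_left _ (by omega)
    omega
  obtain ⟨P, hP, hPd, hPA, hPmem⟩ := exists_connected_colored
    (hH.containsGrid_cyl hU (lo := lo) (hi := hi) hh' hhi le_rfl)
    (cyl_injOn hh' le_rfl) hlo (by omega) (by omega) (fun i => cylCoord ℓ h' (e i).2)
    (Prod.fst : Fin t × Fin t → Fin t)
    (fun i i' hne => (hfar _ (heT i) _ (heT i') (he.ne hne)).1.imp
      (fun h => by rw [add_assoc]; exact h) fun h => by rw [add_assoc]; exact h)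
    (by
      intro i
      have h1 := hcol' (e i).2 (Finset.mem_image_of_mem _ (Finset.mem_univ i))
      have h2 := hrow _ (heT i)
      have h3 : (cylCoord ℓ h' (e i).2).1 = (e i).2.2.1 := rfl
      omega)
  have hUt : H.comap transp ≤ U.comap transp := fun a b hab => hU hab
  obtain ⟨P', hP', hPd', hPA', hPmem'⟩ := exists_connected_colored (G := U)
    (ψ := fun z => transp (cyl ℓ h z))
    (hH.transp.containsGrid_cyl hUt (lo := 0) (hi := ℓ - 1) hh (by omega) hb)
    (transp_injective.comp_injOn (cyl_injOn hh hb)) (by omega) (by omega) (by omega)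
    (fun i => cylCoord ℓ h (transp (e i).1))
    (Prod.snd : Fin t × Fin t → Fin t)
    (fun i i' hne => (hfar _ (heT i) _ (heT i') (he.ne hne)).2.imp
      (fun h => by rw [add_assoc]; exact h) fun h => by rw [add_assoc]; exact h)
    (by
      intro i
      have h1 := hcoord _ (heT i)
      have h2 := hcol _ (heT i)
      have h3 : (cylCoord ℓ h (transp (e i).1)).1 = (e i).1.2.2 := rfl
      omega)
  refine hasCliqueMinorIn_of_families hP hP' hPd hPd' ?_
    (fun j => (hPA j).trans (cyl_image_slab hh' hhi le_rfl)) ?_ fun j k => ?_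
  · intro j k _ v hv hv'
    obtain ⟨z, hz, rfl⟩ := hPA j hv
    obtain ⟨w, hw, hwz⟩ := hPA' k hv'
    have hrowz : (cyl ℓ h' z).2.1 = z.1 := by
      simp only [cyl]; split_ifs <;> rfl
    have hwrow : (cyl ℓ h w).2.2 = (cyl ℓ h' z).2.1 := congrArg (fun v => v.2.1) hwz
    exact hdisj w hw.2.2 (by rw [hwrow, hrowz]; exact hz.1) (by rw [hwrow, hrowz]; exact hz.2.1)
  · intro j v hv
    obtain ⟨w, hw, rfl⟩ := hPA' j hv
    exact transp_mem (cyl_mem hh (by have := hw.2.1; omega) (hw.2.2.trans_le hb))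
  · have h1 := hPmem (j, k)
    have h2 := hPmem' (j, k)
    have hj := hjump _ (heT (j, k))
    rw [cyl_cylCoord hh' hj.snd_mem] at h1
    simp only [cyl_cylCoord hh (transp_mem hj.fst_mem)] at h2
    exact ⟨_, h1, _, h2, hj.adj.symm⟩

lemma hasCliqueMinorIn_of_same_row {H U : SimpleGraph (ℕ × ℕ × ℕ)} {ℓ t x₀ : ℕ}
    (hH : ContainsDoubleGrid H ℓ) (hU : H ≤ U) (ht : 2 ≤ t)
    (hℓ : 2 * (t * t) * (2 * t + 4) < 2 * ℓ) {T : Finset ((ℕ × ℕ × ℕ) × (ℕ × ℕ × ℕ))}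
    (hT : 2 * (t * t) ≤ T.card) (hjump : ∀ e ∈ T, IsJump H U ℓ e)
    (hx₀ : ∀ e ∈ T, e.1.2.1 = x₀)
    (hrow : ∀ e ∈ T, (t + 1 ≤ e.2.2.1 ∧ e.2.2.1 + t < ℓ) ∧ FarApart (4 * t + 4) x₀ e.2.2.1)
    (hcol : ∀ e ∈ T, t + 1 ≤ e.1.2.2 ∧ e.1.2.2 + t < ℓ)
    (hfar : ∀ e ∈ T, ∀ e' ∈ T, e ≠ e' → FarApart (2 * t + 1) e.2.2.1 e'.2.2.1 ∧
      FarApart (2 * t + 1) e.1.2.2 e'.1.2.2) :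
    HasCliqueMinorIn U (dbox ℓ) t := by
  classical
  have htt : 0 < t * t := Nat.mul_pos (by omega) (by omega)
  have hsplit := Finset.card_filter_add_card_filter_not (s := T)
    (fun e => x₀ + (4 * t + 4) ≤ e.2.2.1)
  rcases (by omega : t * t ≤ (T.filter fun e => x₀ + (4 * t + 4) ≤ e.2.2.1).card ∨
    t * t ≤ (T.filter fun e => ¬ x₀ + (4 * t + 4) ≤ e.2.2.1).card) with h | h
  · obtain ⟨e₀, he₀⟩ := Finset.card_pos.1 (htt.trans_le h)
    have h0 := hrow e₀ (Finset.mem_filter.1 he₀).1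
    have h0' := (Finset.mem_filter.1 he₀).2
    refine hasCliqueMinorIn_of_two_regions (lo := x₀ + (2 * t + 3)) (hi := ℓ - 1)
      (h := 2 * ℓ - 1 - (x₀ + (2 * t + 2))) (b := 2 * (x₀ + (2 * t + 3))) hH hU ht hℓ h
      (fun e he => hjump e (Finset.mem_filter.1 he).1) (by omega) (by omega) (by omega)
      (by omega) (by omega) ?_ ?_ (fun e he => hcol e (Finset.mem_filter.1 he).1) ?_
      fun e he e' he' => hfar e (Finset.mem_filter.1 he).1 e' (Finset.mem_filter.1 he').1
    · intro z hz h1 h2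
      simp only [cyl] at h1 h2
      split_ifs at h1 h2 <;> (simp only at h1 h2; omega)
    · intro e he
      have h1 := hrow e (Finset.mem_filter.1 he).1
      have h2 := (Finset.mem_filter.1 he).2
      omega
    · intro e he
      have h1 := hx₀ e (Finset.mem_filter.1 he).1
      have h2 := cylCoord_transp_cases ℓ (2 * ℓ - 1 - (x₀ + (2 * t + 2))) e.1
      rw [h1] at h2
      omega
  · obtain ⟨e₀, he₀⟩ := Finset.card_pos.1 (htt.trans_le h)
    have h0 := hrow e₀ (Finset.mem_filter.1 he₀).1
    have h0' := (Finset.mem_filter.1 he₀).2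
    have h0'' : x₀ < ℓ := by
      rw [← hx₀ e₀ (Finset.mem_filter.1 he₀).1]
      exact (hjump e₀ (Finset.mem_filter.1 he₀).1).fst_mem.2.1
    simp only [FarApart] at h0
    refine hasCliqueMinorIn_of_two_regions (lo := 0) (hi := x₀ - (2 * t + 3))
      (h := x₀ - (2 * t + 2)) (b := 2 * (ℓ - (x₀ - (2 * t + 2)))) hH hU ht hℓ h
      (fun e he => hjump e (Finset.mem_filter.1 he).1) (by omega) (by omega) (by omega)
      (by omega) (by omega) ?_ ?_ (fun e he => hcol e (Finset.mem_filter.1 he).1) ?_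
      fun e he e' he' => hfar e (Finset.mem_filter.1 he).1 e' (Finset.mem_filter.1 he').1
    · intro z hz h1 h2
      simp only [cyl] at h1 h2
      split_ifs at h1 h2 <;> (simp only at h1 h2; omega)
    · intro e he
      have h1 := hrow e (Finset.mem_filter.1 he).1
      have h2 := (Finset.mem_filter.1 he).2
      simp only [FarApart] at h1
      omega
    · intro e he
      have h1 := hx₀ e (Finset.mem_filter.1 he).1
      have h2 := cylCoord_transp_cases ℓ (x₀ - (2 * t + 2)) e.1
      rw [h1] at h2
      omega

/-- The natural numbers at distance less than `d` from `x`. -/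
def window (d x : ℕ) : Finset ℕ := Finset.Ico (x + 1 - d) (x + d)

lemma card_window_le (d x : ℕ) : (window d x).card ≤ 2 * d := by
  simp only [window, Nat.card_Ico]
  omega

lemma farApart_of_notMem_window {d x y : ℕ} (h : y ∉ window d x) : FarApart d x y := by
  simp only [window, Finset.mem_Ico, FarApart] at h ⊢
  omega

lemma self_mem_window {d : ℕ} (hd : 0 < d) (x : ℕ) : x ∈ window d x := by
  simp only [window, Finset.mem_Ico]
  omega

/-- The coordinates of the `ℓ × ℓ` grid that are close to `0` or to `ℓ`. -/
def margin (ℓ t : ℕ) : Finset ℕ := Finset.range (t + 1) ∪ Finset.Ico (ℓ - t) ℓ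

lemma card_margin_le (ℓ t : ℕ) : (margin ℓ t).card ≤ 2 * t + 1 := by
  refine (Finset.card_union_le _ _).trans ?_
  simp only [Finset.card_range, Nat.card_Ico]
  omega

lemma bounds_of_notMem_margin {ℓ t x : ℕ} (hx : x < ℓ) (h : x ∉ margin ℓ t) :
    t + 1 ≤ x ∧ x + t < ℓ := by
  simp only [margin, Finset.mem_union, Finset.mem_range, Finset.mem_Ico] at h
  omega

lemma exists_far_or_cover {α : Type*} (M : Finset α) (F : α → Finset ℕ)
    (hne : ∀ e ∈ M, (F e).Nonempty) (hF : ∀ e ∈ M, (F e).card ≤ 2) (bad : Finset ℕ) {d : ℕ}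
    (hd : 0 < d) (k : ℕ) :
    (∃ T ⊆ M, T.card = k ∧ (∀ e ∈ T, ∀ x ∈ F e, x ∉ bad) ∧
      ∀ e ∈ T, ∀ e' ∈ T, e ≠ e' → ∀ x ∈ F e, ∀ y ∈ F e', FarApart d x y) ∨
    ∃ A : Finset ℕ, A.card ≤ bad.card + 4 * d * k ∧ ∀ e ∈ M, ∃ x ∈ F e, x ∈ A := by
  classical
  induction k with
  | zero => exact Or.inl ⟨∅, by simp⟩
  | succ k ih =>
    rcases ih with ⟨T, hTM, hT, hbad, hfar⟩ | ⟨A, hA, hcover⟩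
    · let A := bad ∪ T.biUnion fun e => (F e).biUnion (window d)
      by_cases hcover : ∀ e ∈ M, ∃ x ∈ F e, x ∈ A
      · refine Or.inr ⟨A, (Finset.card_union_le _ _).trans (Nat.add_le_add_left ?_ _), hcover⟩
        have h1 : ∀ e ∈ T, ((F e).biUnion (window d)).card ≤ 4 * d := by
          intro e he
          have h2 := Finset.card_biUnion_le_card_mul (F e) (window d) (2 * d)
            fun x _ => card_window_le d x
          have h3 := Nat.mul_le_mul_right (2 * d) (hF e (hTM he))
          omega
        have h2 := Finset.card_biUnion_le_card_mul T (fun e => (F e).biUnion (window d)) _ h1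
        rw [hT] at h2
        nlinarith
      · push Not at hcover
        obtain ⟨e, heM, he⟩ := hcover
        have hwin : ∀ e' ∈ T, ∀ y ∈ F e', ∀ x ∈ F e, x ∉ window d y := by
          intro e' he' y hy x hx hxy
          exact he x hx (Finset.mem_union_right _ (Finset.mem_biUnion.2
            ⟨e', he', Finset.mem_biUnion.2 ⟨y, hy, hxy⟩⟩))
        have heT : e ∉ T := by
          intro heT
          obtain ⟨x, hx⟩ := hne e heM
          exact hwin e heT x hx x hx (self_mem_window hd x)
        refine Or.inl ⟨insert e T, Finset.insert_subset heM hTM, by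
          rw [Finset.card_insert_of_notMem heT, hT], ?_, ?_⟩
        · intro e' he' x hx
          rcases Finset.mem_insert.1 he' with rfl | he'
          · exact fun hxb => he x hx (Finset.mem_union_left _ hxb)
          · exact hbad e' he' x hx
        · intro e₁ h₁ e₂ h₂ hne₁₂ x hx y hy
          rcases Finset.mem_insert.1 h₁ with rfl | h₁' <;>
            rcases Finset.mem_insert.1 h₂ with rfl | h₂'
          · exact (hne₁₂ rfl).elim
          · exact (farApart_of_notMem_window (hwin e₂ h₂' y hy x hx)).symm
          · exact farApart_of_notMem_window (hwin e₁ h₁' x hx y hy)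
          · exact hfar e₁ h₁' e₂ h₂' hne₁₂ x hx y hy
    · refine Or.inr ⟨A, hA.trans ?_, hcover⟩
      exact Nat.add_le_add_left (Nat.mul_le_mul_left _ k.le_succ) _

lemma card_le_of_coords {α : Type*} {M : Finset α} {v : α → ℕ × ℕ × ℕ} (hv : Set.InjOn v M)
    {A B : Finset ℕ} (hlayer : ∀ e ∈ M, (v e).1 < 2) (hA : ∀ e ∈ M, (v e).2.1 ∈ A)
    (hB : ∀ e ∈ M, (v e).2.2 ∈ B) : M.card ≤ 2 * (A.card * B.card) := by
  have h := Finset.card_le_card_of_injOn (t := Finset.range 2 ×ˢ A ×ˢ B) v (fun e he =>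
    Finset.mem_product.2 ⟨Finset.mem_range.2 (hlayer e he),
      Finset.mem_product.2 ⟨hA e he, hB e he⟩⟩) hv
  simpa using h

/-- Bound on the number of jumps with pairwise far rows that leave a common row and enter a
common column. -/
def farJumpBound (t : ℕ) : ℕ := 2 * (2 * t + 1 + 4 * (2 * t + 1) * (2 * (t * t))) + 1

/-- Bound on the number of disjoint jumps that leave a common row and enter a common column. -/
def rowColBound (t : ℕ) : ℕ :=
  2 * (2 * t + 1 + 2 * (4 * t + 4) + 4 * (2 * t + 1) * farJumpBound t)

/-- Bound on the number of rows needed to meet all jumps. -/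
def coverBound (t : ℕ) : ℕ := 2 * t + 1 + 4 * (6 * t + 6) * (2 * (t * t))

/-- Bound on the number of disjoint jumps in a graph without a `K_t` minor. -/
def jumpBound (t : ℕ) : ℕ :=
  2 * (t * t * (2 * t + 4) * (t * t * (2 * t + 4))) +
    coverBound t * coverBound t * (4 * rowColBound t)

lemma card_le_rowColBound {H U : SimpleGraph (ℕ × ℕ × ℕ)} {ℓ t x₀ y₀ : ℕ}
    (hH : ContainsDoubleGrid H ℓ) (hU : H ≤ U) (ht : 2 ≤ t)
    (hℓ : 2 * (t * t) * (2 * t + 4) < 2 * ℓ) (hminor : ¬ HasCliqueMinorIn U (dbox ℓ) t)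
    {M : Finset ((ℕ × ℕ × ℕ) × (ℕ × ℕ × ℕ))} (hjump : ∀ e ∈ M, IsJump H U ℓ e)
    (hfst : Set.InjOn Prod.fst (M : Set ((ℕ × ℕ × ℕ) × (ℕ × ℕ × ℕ))))
    (hsnd : Set.InjOn Prod.snd (M : Set ((ℕ × ℕ × ℕ) × (ℕ × ℕ × ℕ))))
    (hx₀ : ∀ e ∈ M, e.1.2.1 = x₀) (hy₀ : ∀ e ∈ M, e.2.2.2 = y₀) :
    M.card ≤ rowColBound t := by
  rcases exists_far_or_cover M (fun e => {e.2.2.1}) (by simp) (by simp)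
    (margin ℓ t ∪ window (4 * t + 4) x₀) (d := 2 * t + 1) (by omega) (farJumpBound t) with
    ⟨T, hTM, hT, hbad, hfar⟩ | ⟨A, hA, hcover⟩
  · simp only [Finset.mem_singleton, forall_eq, Finset.mem_union, not_or] at hbad hfar
    rcases exists_far_or_cover T (fun e => {e.1.2.2}) (by simp) (by simp)
      (margin ℓ t) (d := 2 * t + 1) (by omega) (2 * (t * t)) with
      ⟨T', hTT', hT', hbad', hfar'⟩ | ⟨A, hA, hcover⟩
    · simp only [Finset.mem_singleton, forall_eq] at hbad' hfar'
      refine absurd (hasCliqueMinorIn_of_same_row (x₀ := x₀) hH hU ht hℓ hT'.ge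
        (fun e he => hjump e (hTM (hTT' he))) (fun e he => hx₀ e (hTM (hTT' he)))
        (fun e he => ⟨?_, ?_⟩) (fun e he => ?_) fun e he e' he' hne => ⟨?_, ?_⟩) hminor
      · exact bounds_of_notMem_margin (hjump e (hTM (hTT' he))).snd_mem.2.1 (hbad e (hTT' he)).1
      · exact farApart_of_notMem_window (hbad e (hTT' he)).2
      · exact bounds_of_notMem_margin (hjump e (hTM (hTT' he))).fst_mem.2.2 (hbad' e he)
      · exact hfar e (hTT' he) e' (hTT' he') hne
      · exact hfar' e he e' he' hne
    · simp only [Finset.mem_singleton, exists_eq_left] at hcover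
      have h1 := card_le_of_coords (B := A) (A := {x₀}) (hfst.mono (Finset.coe_subset.2 hTM))
        (fun e he => (hjump e (hTM he)).fst_mem.1)
        (fun e he => Finset.mem_singleton.2 (hx₀ e (hTM he))) hcover
      have h2 := card_margin_le ℓ t
      simp only [hT, farJumpBound, Finset.card_singleton, one_mul] at h1
      omega
  · simp only [Finset.mem_singleton, exists_eq_left] at hcover
    have h1 := card_le_of_coords (A := A) (B := {y₀}) hsnd
      (fun e he => (hjump e he).snd_mem.1) hcover
      (fun e he => Finset.mem_singleton.2 (hy₀ e he))
    have h2 := card_margin_le ℓ t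
    have h3 := card_window_le (4 * t + 4) x₀
    have h4 := Finset.card_union_le (margin ℓ t) (window (4 * t + 4) x₀)
    simp only [rowColBound, Finset.card_singleton, mul_one] at h1 ⊢
    omega

lemma exists_row_cover {H U : SimpleGraph (ℕ × ℕ × ℕ)} {ℓ t : ℕ}
    (hH : ContainsDoubleGrid H ℓ) (hU : H ≤ U) (ht : 2 ≤ t)
    (hℓ : 2 * (t * t) * (2 * t + 4) < 2 * ℓ) (hminor : ¬ HasCliqueMinorIn U (dbox ℓ) t)
    {M : Finset ((ℕ × ℕ × ℕ) × (ℕ × ℕ × ℕ))} (hjump : ∀ e ∈ M, IsJump H U ℓ e) :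
    ∃ A : Finset ℕ, A.card ≤ coverBound t ∧ ∀ e ∈ M, e.1.2.1 ∈ A ∨ e.2.2.1 ∈ A := by
  rcases exists_far_or_cover M (fun e => {e.1.2.1, e.2.2.1}) (by simp)
    (fun e _ => Finset.card_le_two) (margin ℓ t) (d := 6 * t + 6) (by omega) (2 * (t * t)) with
    ⟨T, hTM, hT, hbad, hfar⟩ | ⟨A, hA, hcover⟩
  · refine absurd (hasCliqueMinorIn_of_row_far hH hU ht hℓ hT.ge (fun e he => hjump e (hTM he))
      (fun e he => ⟨?_, ?_⟩) fun e he e' he' hne => ⟨?_, ?_, ?_⟩) hminor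
    · exact bounds_of_notMem_margin (hjump e (hTM he)).fst_mem.2.1 (hbad e he _ (by simp))
    · exact bounds_of_notMem_margin (hjump e (hTM he)).snd_mem.2.1 (hbad e he _ (by simp))
    · exact hfar e he e' he' hne _ (by simp) _ (by simp)
    · exact hfar e he e' he' hne _ (by simp) _ (by simp)
    · exact hfar e he e' he' hne _ (by simp) _ (by simp)
  · have h := card_margin_le ℓ t
    refine ⟨A, by simp only [coverBound]; omega, fun e he => ?_⟩
    simpa using hcover e he

lemma exists_column_cover {H U : SimpleGraph (ℕ × ℕ × ℕ)} {ℓ t : ℕ}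
    (hH : ContainsDoubleGrid H ℓ) (hU : H ≤ U) (ht : 2 ≤ t)
    (hℓ : 2 * (t * t) * (2 * t + 4) < 2 * ℓ) (hminor : ¬ HasCliqueMinorIn U (dbox ℓ) t)
    {M : Finset ((ℕ × ℕ × ℕ) × (ℕ × ℕ × ℕ))} (hjump : ∀ e ∈ M, IsJump H U ℓ e) :
    ∃ A : Finset ℕ, A.card ≤ coverBound t ∧ ∀ e ∈ M, e.1.2.2 ∈ A ∨ e.2.2.2 ∈ A := by
  classical
  obtain ⟨A, hA, hcover⟩ := exists_row_cover (U := U.comap transp)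
    (M := M.image (Prod.map transp transp)) hH.transp (fun _ _ h => hU h) ht hℓ
    (fun h => hminor (h.of_comap transp_injective.injOn fun v hv => transp_mem hv))
    (by
      intro e he
      obtain ⟨e, he', rfl⟩ := Finset.mem_image.1 he
      have h := hjump e he'
      exact ⟨transp_mem h.fst_mem, transp_mem h.snd_mem, h.adj, h.not_adj⟩)
  exact ⟨A, hA, fun e he => hcover _ (Finset.mem_image_of_mem _ he)⟩

lemma card_le_jumpBound {H U : SimpleGraph (ℕ × ℕ × ℕ)} {ℓ t : ℕ}
    (hH : ContainsDoubleGrid H ℓ) (hU : H ≤ U) (ht : 2 ≤ t)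
    (hminor : ¬ HasCliqueMinorIn U (dbox ℓ) t)
    {M : Finset ((ℕ × ℕ × ℕ) × (ℕ × ℕ × ℕ))} (hjump : ∀ e ∈ M, IsJump H U ℓ e)
    (hfst : Set.InjOn Prod.fst (M : Set ((ℕ × ℕ × ℕ) × (ℕ × ℕ × ℕ))))
    (hsnd : Set.InjOn Prod.snd (M : Set ((ℕ × ℕ × ℕ) × (ℕ × ℕ × ℕ)))) :
    M.card ≤ jumpBound t := by
  classical
  by_cases hℓ : 2 * (t * t) * (2 * t + 4) < 2 * ℓ
  · obtain ⟨A, hA, hAM⟩ := exists_row_cover hH hU ht hℓ hminor hjump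
    obtain ⟨B, hB, hBM⟩ := exists_column_cover hH hU ht hℓ hminor hjump
    let P : ℕ × ℕ → Finset ((ℕ × ℕ × ℕ) × (ℕ × ℕ × ℕ)) := fun z =>
      (M.filter (fun e => e.1.2.1 = z.1 ∧ e.1.2.2 = z.2) ∪
        M.filter fun e => e.2.2.1 = z.1 ∧ e.2.2.2 = z.2) ∪
      (M.filter (fun e => e.1.2.1 = z.1 ∧ e.2.2.2 = z.2) ∪
        M.filter fun e => e.2.2.1 = z.1 ∧ e.1.2.2 = z.2)
    have hsub : M ⊆ (A ×ˢ B).biUnion P := by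
      intro e he
      simp only [P, Finset.mem_biUnion, Finset.mem_product, Finset.mem_union, Finset.mem_filter,
        he, true_and, Prod.exists]
      rcases hAM e he with h1 | h1 <;> rcases hBM e he with h2 | h2
      · exact ⟨_, _, ⟨h1, h2⟩, by simp⟩
      · exact ⟨_, _, ⟨h1, h2⟩, by simp⟩
      · exact ⟨_, _, ⟨h1, h2⟩, by simp⟩
      · exact ⟨_, _, ⟨h1, h2⟩, by simp⟩
    have htwo : 2 ≤ rowColBound t := by simp only [rowColBound]; omega
    have hP : ∀ z ∈ A ×ˢ B, (P z).card ≤ 4 * rowColBound t := by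
      intro z _
      have h1 : (M.filter fun e => e.1.2.1 = z.1 ∧ e.1.2.2 = z.2).card ≤ 2 := by
        simpa using card_le_of_coords (A := {z.1}) (B := {z.2})
          (hfst.mono (Finset.coe_subset.2 (Finset.filter_subset _ _)))
          (fun e he => (hjump e (Finset.mem_filter.1 he).1).fst_mem.1)
          (fun e he => Finset.mem_singleton.2 (Finset.mem_filter.1 he).2.1)
          (fun e he => Finset.mem_singleton.2 (Finset.mem_filter.1 he).2.2)
      have h2 : (M.filter fun e => e.2.2.1 = z.1 ∧ e.2.2.2 = z.2).card ≤ 2 := by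
        simpa using card_le_of_coords (A := {z.1}) (B := {z.2})
          (hsnd.mono (Finset.coe_subset.2 (Finset.filter_subset _ _)))
          (fun e he => (hjump e (Finset.mem_filter.1 he).1).snd_mem.1)
          (fun e he => Finset.mem_singleton.2 (Finset.mem_filter.1 he).2.1)
          (fun e he => Finset.mem_singleton.2 (Finset.mem_filter.1 he).2.2)
      have h3 : (M.filter fun e => e.1.2.1 = z.1 ∧ e.2.2.2 = z.2).card ≤ rowColBound t :=
        card_le_rowColBound hH hU ht hℓ hminor
          (fun e he => hjump e (Finset.mem_filter.1 he).1)
          (hfst.mono (Finset.coe_subset.2 (Finset.filter_subset _ _)))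
          (hsnd.mono (Finset.coe_subset.2 (Finset.filter_subset _ _)))
          (fun e he => (Finset.mem_filter.1 he).2.1) fun e he => (Finset.mem_filter.1 he).2.2
      have h4 : (M.filter fun e => e.2.2.1 = z.1 ∧ e.1.2.2 = z.2).card ≤ rowColBound t := by
        rw [← Finset.card_image_of_injective _ Prod.swap_injective]
        have hmem : ∀ e ∈ (M.filter fun e => e.2.2.1 = z.1 ∧ e.1.2.2 = z.2).image Prod.swap,
            e.swap ∈ M ∧ e.1.2.1 = z.1 ∧ e.2.2.2 = z.2 := by
          intro e he
          obtain ⟨e, he', rfl⟩ := Finset.mem_image.1 he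
          exact Finset.mem_filter.1 he'
        refine card_le_rowColBound (x₀ := z.1) (y₀ := z.2) hH hU ht hℓ hminor (fun e he => ?_)
          (fun e he e' he' h => ?_) (fun e he e' he' h => ?_) (fun e he => (hmem e he).2.1)
          fun e he => (hmem e he).2.2
        · have h := hjump _ (hmem e he).1
          exact ⟨h.snd_mem, h.fst_mem, h.adj.symm, fun hadj => h.not_adj hadj.symm⟩
        · exact Prod.swap_injective (hsnd (hmem e he).1 (hmem e' he').1 h)
        · exact Prod.swap_injective (hfst (hmem e he).1 (hmem e' he').1 h)
      have h5 : (P z).card ≤ _ := Finset.card_union_le _ _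
      have h6 := Finset.card_union_le (M.filter fun e => e.1.2.1 = z.1 ∧ e.1.2.2 = z.2)
        (M.filter fun e => e.2.2.1 = z.1 ∧ e.2.2.2 = z.2)
      have h7 := Finset.card_union_le (M.filter fun e => e.1.2.1 = z.1 ∧ e.2.2.2 = z.2)
        (M.filter fun e => e.2.2.1 = z.1 ∧ e.1.2.2 = z.2)
      omega
    have hcard := (Finset.card_le_card hsub).trans
      (Finset.card_biUnion_le_card_mul _ _ _ hP)
    rw [Finset.card_product] at hcard
    have := Nat.mul_le_mul_right (4 * rowColBound t) (Nat.mul_le_mul hA hB)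
    simp only [jumpBound]
    omega
  · have h1 : ℓ ≤ t * t * (2 * t + 4) := by
      rw [mul_assoc] at hℓ
      omega
    have h2 := card_le_of_coords (A := Finset.range ℓ) (B := Finset.range ℓ) hfst
      (fun e he => (hjump e he).fst_mem.1)
      (fun e he => Finset.mem_range.2 (hjump e he).fst_mem.2.1)
      fun e he => Finset.mem_range.2 (hjump e he).fst_mem.2.2
    rw [Finset.card_range] at h2
    have h3 := Nat.mul_le_mul h1 h1
    simp only [jumpBound]
    omega

/-- The vertex of the double grid with the given layer, row and column. -/
def vtx (ℓ : ℕ) [NeZero ℓ] (v : ℕ × ℕ × ℕ) : Fin 2 × Fin ℓ × Fin ℓ :=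
  (Fin.ofNat 2 v.1, Fin.ofNat ℓ v.2.1, Fin.ofNat ℓ v.2.2)

/-- Layer, row and column of a vertex of the double grid. -/
def coords {ℓ : ℕ} (w : Fin 2 × Fin ℓ × Fin ℓ) : ℕ × ℕ × ℕ := (w.1, w.2.1, w.2.2)

lemma coords_mem {ℓ : ℕ} (w : Fin 2 × Fin ℓ × Fin ℓ) : coords w ∈ dbox ℓ :=
  ⟨w.1.isLt, w.2.1.isLt, w.2.2.isLt⟩

lemma vtx_coords {ℓ : ℕ} [NeZero ℓ] (w : Fin 2 × Fin ℓ × Fin ℓ) : vtx ℓ (coords w) = w := by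
  simp only [vtx, coords, Fin.ofNat_val_eq_self]

lemma coords_injective {ℓ : ℕ} : Function.Injective (coords (ℓ := ℓ)) := by
  rintro ⟨s, x, y⟩ ⟨s', x', y'⟩ h
  simp only [coords, Prod.mk.injEq, Fin.val_inj] at h ⊢
  exact h

lemma vtx_mk {ℓ : ℕ} [NeZero ℓ] {s x y : ℕ} (hs : s < 2) (hx : x < ℓ) (hy : y < ℓ) :
    vtx ℓ (s, x, y) = (⟨s, hs⟩, ⟨x, hx⟩, ⟨y, hy⟩) :=
  vtx_coords (⟨s, hs⟩, ⟨x, hx⟩, ⟨y, hy⟩)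

lemma coords_vtx {ℓ : ℕ} [NeZero ℓ] {v : ℕ × ℕ × ℕ} (hv : v ∈ dbox ℓ) :
    coords (vtx ℓ v) = v := by
  obtain ⟨s, x, y⟩ := v
  rw [vtx_mk hv.1 hv.2.1 hv.2.2]
  rfl

lemma vtx_injOn (ℓ : ℕ) [NeZero ℓ] : Set.InjOn (vtx ℓ) (dbox ℓ) := fun u hu v hv h => by
  rw [← coords_vtx hu, ← coords_vtx hv, h]

lemma IsTriangulatedDoubleGrid.exists_layer {ℓ : ℕ} {H : SimpleGraph (Fin 2 × Fin ℓ × Fin ℓ)}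
    (hH : IsTriangulatedDoubleGrid H) (s : Fin 2) :
    ∃ G : SimpleGraph (Fin ℓ × Fin ℓ), IsTriangulatedGrid G ∧
      ∀ p q, H.Adj (s, p) (s, q) ↔ G.Adj p q := by
  obtain ⟨G₁, G₂, hG₁, hG₂, h₁, h₂, -⟩ := hH
  fin_cases s
  exacts [⟨G₁, hG₁, h₁⟩, ⟨G₂, hG₂, h₂⟩]

lemma IsTriangulatedDoubleGrid.exists_diagonal {ℓ : ℕ}
    {H : SimpleGraph (Fin 2 × Fin ℓ × Fin ℓ)} (hH : IsTriangulatedDoubleGrid H)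
    {p q : Fin ℓ × Fin ℓ} (hpq : gridAdj p q) (hp : onBoundary p) (hq : onBoundary q) :
    H.Adj (0, p) (1, q) ∨ H.Adj (1, p) (0, q) := by
  obtain ⟨G₁, G₂, -, -, -, -, -, -, h⟩ := hH
  exact (Xor.or (h p q hpq hp hq)).imp id fun h => h.symm

lemma IsTriangulatedDoubleGrid.containsDoubleGrid {ℓ : ℕ} [NeZero ℓ]
    {H : SimpleGraph (Fin 2 × Fin ℓ × Fin ℓ)} (hH : IsTriangulatedDoubleGrid H) :
    ContainsDoubleGrid (H.comap (vtx ℓ)) ℓ where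
  horiz s x y hs hx hy := by
    obtain ⟨G, hG, hadj⟩ := hH.exists_layer ⟨s, hs⟩
    rw [comap_adj, vtx_mk hs hx (by omega), vtx_mk hs hx hy, hadj]
    exact hG.1 _ _ (Or.inl ⟨rfl, Or.inl rfl⟩)
  vert s x y hs hx hy := by
    obtain ⟨G, hG, hadj⟩ := hH.exists_layer ⟨s, hs⟩
    rw [comap_adj, vtx_mk hs (by omega) hy, vtx_mk hs hx hy, hadj]
    exact hG.1 _ _ (Or.inr ⟨rfl, Or.inl rfl⟩)
  cell s x y hs hx hy := by
    obtain ⟨G, hG, hadj⟩ := hH.exists_layer ⟨s, hs⟩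
    rw [comap_adj, comap_adj, vtx_mk hs (by omega) (by omega), vtx_mk hs hx hy,
      vtx_mk hs (by omega) hy, vtx_mk hs hx (by omega), hadj, hadj]
    exact (Xor.or (hG.2.2 (⟨x, by omega⟩, ⟨y, by omega⟩) (⟨x + 1, hx⟩, ⟨y, by omega⟩)
      (⟨x + 1, hx⟩, ⟨y + 1, hy⟩) (⟨x, by omega⟩, ⟨y + 1, hy⟩) rfl rfl rfl rfl rfl rfl)).imp
      id fun h => h.symm
  rung x y hx hy hxy := by
    rw [comap_adj, vtx_mk (by omega) hx hy, vtx_mk (by omega) hx hy]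
    obtain ⟨G₁, G₂, -, -, -, -, h, -⟩ := hH
    exact (h _).2 hxy
  quad_vert x y hx hy hxy := by
    rw [comap_adj, comap_adj, vtx_mk (by omega) (by omega) hy, vtx_mk (by omega) hx hy,
      vtx_mk (by omega) (by omega) hy, vtx_mk (by omega) hx hy]
    exact hH.exists_diagonal (Or.inr ⟨rfl, Or.inl rfl⟩) (Or.inr (Or.inr hxy))
      (Or.inr (Or.inr hxy))
  quad_horiz x y hx hy hxy := by
    rw [comap_adj, comap_adj, vtx_mk (by omega) hx (by omega), vtx_mk (by omega) hx hy,
      vtx_mk (by omega) hx (by omega), vtx_mk (by omega) hx hy]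
    exact hH.exists_diagonal (Or.inl ⟨rfl, Or.inl rfl⟩) (hxy.imp id Or.inl)
      (hxy.imp id Or.inl)

lemma near_of_gridAdj {ℓ : ℕ} {p q : Fin ℓ × Fin ℓ} (h : gridAdj p q ∨ diagAdj p q ∨ p = q) :
    q.1.val ∈ Finset.Icc (p.1.val - 1) (p.1.val + 1) ∧
      q.2.val ∈ Finset.Icc (p.2.val - 1) (p.2.val + 1) := by
  simp only [gridAdj, diagAdj, Prod.ext_iff, Fin.ext_iff] at h
  simp only [Finset.mem_Icc]
  omega

lemma IsTriangulatedDoubleGrid.near {ℓ : ℕ} {H : SimpleGraph (Fin 2 × Fin ℓ × Fin ℓ)}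
    (hH : IsTriangulatedDoubleGrid H) {u v : Fin 2 × Fin ℓ × Fin ℓ} (huv : H.Adj u v) :
    v.2.1.val ∈ Finset.Icc (u.2.1.val - 1) (u.2.1.val + 1) ∧
      v.2.2.val ∈ Finset.Icc (u.2.2.val - 1) (u.2.2.val + 1) := by
  obtain ⟨s, p⟩ := u
  obtain ⟨s', q⟩ := v
  refine near_of_gridAdj ?_
  by_cases hs : s = s'
  · subst hs
    obtain ⟨G, hG, hadj⟩ := hH.exists_layer s
    exact (hG.2.1 p q ((hadj p q).1 huv)).imp id Or.inl
  · by_cases hpq : p = q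
    · exact Or.inr (Or.inr hpq)
    · obtain ⟨G₁, G₂, -, -, -, -, -, h, -⟩ := hH
      have hsym : gridAdj q p → gridAdj p q := by
        simp only [gridAdj, Fin.ext_iff]
        omega
      have hcases : s = 0 ∧ s' = 1 ∨ s = 1 ∧ s' = 0 := by omega
      rcases hcases with ⟨rfl, rfl⟩ | ⟨rfl, rfl⟩
      · exact Or.inl (h p q hpq huv).2.2
      · exact Or.inl (hsym (h q p (Ne.symm hpq) huv.symm).2.2)

lemma IsTriangulatedDoubleGrid.card_neighbors_le {ℓ : ℕ}
    {H : SimpleGraph (Fin 2 × Fin ℓ × Fin ℓ)} (hH : IsTriangulatedDoubleGrid H) {α : Type*}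
    {M : Finset α} {f : α → Fin 2 × Fin ℓ × Fin ℓ} (hf : Set.InjOn f M)
    (u : Fin 2 × Fin ℓ × Fin ℓ) (hM : ∀ e ∈ M, H.Adj u (f e)) : M.card ≤ 18 := by
  have h := card_le_of_coords (v := fun e => coords (f e)) (coords_injective.comp_injOn hf)
    (fun e _ => (coords_mem (f e)).1) (fun e he => (hH.near (hM e he)).1)
    fun e he => (hH.near (hM e he)).2
  have hIcc : ∀ x : ℕ, (Finset.Icc (x - 1) (x + 1)).card ≤ 3 := fun x => by
    rw [Nat.card_Icc]
    omega
  have := Nat.mul_le_mul (hIcc u.2.1) (hIcc u.2.2)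
  omega

lemma exists_maximal_matching {α : Type*} (D : Finset (α × α)) :
    ∃ M ⊆ D, Set.InjOn Prod.fst (M : Set (α × α)) ∧ Set.InjOn Prod.snd (M : Set (α × α)) ∧
      ∀ e ∈ D, ∃ e' ∈ M, e.1 = e'.1 ∨ e.2 = e'.2 := by
  classical
  obtain ⟨M, hM⟩ := Finset.exists_maximal (s := D.powerset.filter fun M : Finset (α × α) =>
    Set.InjOn Prod.fst (M : Set (α × α)) ∧ Set.InjOn Prod.snd (M : Set (α × α)))
    ⟨∅, by simp⟩
  obtain ⟨hMD, hfst, hsnd⟩ := Finset.mem_filter.1 hM.prop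
  rw [Finset.mem_powerset] at hMD
  refine ⟨M, hMD, hfst, hsnd, fun e he => ?_⟩
  by_contra! hcon
  have heM : e ∉ M := fun h => (hcon e h).1 rfl
  have hins : insert e M ∈ D.powerset.filter fun M : Finset (α × α) =>
      Set.InjOn Prod.fst (M : Set (α × α)) ∧ Set.InjOn Prod.snd (M : Set (α × α)) := by
    refine Finset.mem_filter.2
      ⟨Finset.mem_powerset.2 (Finset.insert_subset he hMD), ?_, ?_⟩
    · rw [Finset.coe_insert, Set.injOn_insert (by exact_mod_cast heM)]
      exact ⟨hfst, fun ⟨e', he', h⟩ => (hcon e' he').1 h.symm⟩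
    · rw [Finset.coe_insert, Set.injOn_insert (by exact_mod_cast heM)]
      exact ⟨hsnd, fun ⟨e', he', h⟩ => (hcon e' he').2 h.symm⟩
  exact heM (hM.le_of_ge hins (Finset.subset_insert e M) (Finset.mem_insert_self e M))

lemma card_new_matching_le {V : Type*} {G U : SimpleGraph V} {ℓ t : ℕ} [NeZero ℓ]
    {H : SimpleGraph (Fin 2 × Fin ℓ × Fin ℓ)} (hH : IsTriangulatedDoubleGrid H) (φ : G ≃g H)
    (hGU : G ≤ U) (ht : 2 ≤ t) (hminor : ¬ U.HasMinor (⊤ : SimpleGraph (Fin t)))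
    {M : Finset (V × V)} (hM : ∀ e ∈ M, U.Adj e.1 e.2 ∧ ¬ G.Adj e.1 e.2)
    (hfst : Set.InjOn Prod.fst (M : Set (V × V))) (hsnd : Set.InjOn Prod.snd (M : Set (V × V))) :
    M.card ≤ jumpBound t := by
  classical
  let c : V → ℕ × ℕ × ℕ := fun u => coords (φ u)
  let f : ℕ × ℕ × ℕ → V := fun v => φ.symm (vtx ℓ v)
  have hc : Function.Injective c := coords_injective.comp φ.injective
  have hfc : ∀ u, f (c u) = u := fun u => by simp [f, c, vtx_coords]
  have hadj : ∀ u v, (H.comap (vtx ℓ)).Adj u v ↔ G.Adj (f u) (f v) := fun u v =>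
    φ.symm.map_rel_iff.symm
  rw [← Finset.card_image_of_injective M (hc.prodMap hc)]
  refine card_le_jumpBound (U := U.comap f) hH.containsDoubleGrid
    (fun u v h => hGU ((hadj u v).1 h)) ht (fun h => hminor (h.of_comap (A' := Set.univ)
      (φ.symm.injective.comp_injOn (vtx_injOn ℓ)) (Set.mapsTo_univ _ _)).hasMinor) ?_ ?_ ?_
  · intro e he
    obtain ⟨e, he', rfl⟩ := Finset.mem_image.1 he
    refine ⟨coords_mem _, coords_mem _, ?_, ?_⟩
    · simpa [hfc] using (hM e he').1
    · rw [hadj]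
      simpa [hfc] using (hM e he').2
  · rw [Finset.coe_image]
    rintro _ ⟨e, he, rfl⟩ _ ⟨e', he', rfl⟩ h
    rw [hfst he he' (hc h)]
  · rw [Finset.coe_image]
    rintro _ ⟨e, he, rfl⟩ _ ⟨e', he', rfl⟩ h
    rw [hsnd he he' (hc h)]

lemma card_new_darts_le {V : Type*} {G G' U : SimpleGraph V} {ℓ t : ℕ} [NeZero ℓ]
    {H H' : SimpleGraph (Fin 2 × Fin ℓ × Fin ℓ)} (hH : IsTriangulatedDoubleGrid H)
    (hH' : IsTriangulatedDoubleGrid H') (φ : G ≃g H) (φ' : G' ≃g H')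
    (hGU : G ≤ U) (hGU' : G' ≤ U) (ht : 2 ≤ t)
    (hminor : ¬ U.HasMinor (⊤ : SimpleGraph (Fin t))) {D : Finset (V × V)}
    (hD : ∀ e ∈ D, G'.Adj e.1 e.2 ∧ ¬ G.Adj e.1 e.2) : D.card ≤ 36 * jumpBound t := by
  classical
  obtain ⟨M, hMD, hfst, hsnd, hcover⟩ := exists_maximal_matching D
  have hM := card_new_matching_le hH φ hGU ht hminor
    (fun e he => ⟨hGU' (hD e (hMD he)).1, (hD e (hMD he)).2⟩) hfst hsnd
  have hsub : D ⊆ M.biUnion fun e' =>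
      (D.filter fun e => e.1 = e'.1) ∪ D.filter fun e => e.2 = e'.2 := by
    intro e he
    obtain ⟨e', he', h⟩ := hcover e he
    simp only [Finset.mem_biUnion, Finset.mem_union, Finset.mem_filter, he, true_and]
    exact ⟨e', he', h⟩
  have hdeg : ∀ e' ∈ M, ((D.filter fun e => e.1 = e'.1) ∪
      D.filter fun e => e.2 = e'.2).card ≤ 36 := by
    intro e' _
    have h1 : (D.filter fun e => e.1 = e'.1).card ≤ 18 := by
      refine hH'.card_neighbors_le (f := fun e => φ' e.2) ?_ (φ' e'.1) fun e he => ?_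
      · intro e₁ h₁ e₂ h₂ h
        exact Prod.ext ((Finset.mem_filter.1 h₁).2.trans (Finset.mem_filter.1 h₂).2.symm)
          (φ'.injective h)
      · rw [← (Finset.mem_filter.1 he).2]
        exact φ'.map_rel_iff.2 (hD e (Finset.mem_filter.1 he).1).1
    have h2 : (D.filter fun e => e.2 = e'.2).card ≤ 18 := by
      refine hH'.card_neighbors_le (f := fun e => φ' e.1) ?_ (φ' e'.2) fun e he => ?_
      · intro e₁ h₁ e₂ h₂ h
        exact Prod.ext (φ'.injective h)
          ((Finset.mem_filter.1 h₁).2.trans (Finset.mem_filter.1 h₂).2.symm)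
      · rw [← (Finset.mem_filter.1 he).2]
        exact φ'.map_rel_iff.2 (hD e (Finset.mem_filter.1 he).1).1.symm
    exact (Finset.card_union_le _ _).trans (by omega)
  have h := (Finset.card_le_card hsub).trans (Finset.card_biUnion_le_card_mul _ _ _ hdeg)
  omega

lemma ncard_setOf_ncard_le {α : Type*} [Fintype α] (d : ℕ) :
    {X : Set α | X.ncard ≤ d}.ncard ≤ (Fintype.card α + 1) ^ d := by
  classical
  have hsub : {X : Set α | X.ncard ≤ d} ⊆
      (fun g : Fin d → Option α => {a | some a ∈ Set.range g}) '' Set.univ := by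
    intro X hX
    have hcard : X.toFinset.card ≤ d := by rwa [← Set.ncard_eq_toFinset_card']
    let e := X.toFinset.equivFin
    refine ⟨fun i => if h : i.1 < X.toFinset.card then some (e.symm ⟨i, h⟩).1 else none,
      trivial, Set.ext fun a => ⟨?_, fun ha => ?_⟩⟩
    · rintro ⟨i, hi⟩
      by_cases h : i.1 < X.toFinset.card
      · beta_reduce at hi
        rw [dif_pos h, Option.some.injEq] at hi
        rw [← hi]
        exact Set.mem_toFinset.1 (e.symm ⟨i, h⟩).2
      · beta_reduce at hi
        rw [dif_neg h] at hi
        cases hi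
    · have ha' : a ∈ X.toFinset := Set.mem_toFinset.2 ha
      refine ⟨⟨(e ⟨a, ha'⟩).1, (e ⟨a, ha'⟩).2.trans_le hcard⟩, ?_⟩
      beta_reduce
      rw [dif_pos (e ⟨a, ha'⟩).2, Fin.eta, Equiv.symm_apply_apply]
  refine (Set.ncard_le_ncard hsub).trans ((Set.ncard_image_le).trans ?_)
  rw [Set.ncard_univ, Nat.card_eq_fintype_card]
  simp

lemma ncard_le_of_ncard_sdiff_le {α : Type*} [Fintype α] {𝒮 : Set (Set α)} {d : ℕ}
    (h : ∀ S ∈ 𝒮, ∀ S' ∈ 𝒮, (S' \ S).ncard ≤ d) :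
    𝒮.ncard ≤ (Fintype.card α + 1) ^ (2 * d) := by
  rcases 𝒮.eq_empty_or_nonempty with rfl | ⟨S₀, hS₀⟩
  · simp
  have hle := Set.ncard_le_ncard_of_injOn
    (t := {X : Set α | X.ncard ≤ d} ×ˢ {X : Set α | X.ncard ≤ d})
    (fun S => (S \ S₀, S₀ \ S)) (fun S hS => ⟨h S₀ hS₀ S hS, h S hS S₀ hS₀⟩) (s := 𝒮) (by
      intro S _ S' _ heq
      simp only [Prod.mk.injEq, Set.ext_iff, Set.mem_sdiff] at heq ⊢
      intro x
      have h1 := heq.1 x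
      have h2 := heq.2 x
      tauto)
  refine hle.trans ?_
  rw [Set.ncard_prod, two_mul, pow_add]
  exact Nat.mul_le_mul (ncard_setOf_ncard_le d) (ncard_setOf_ncard_le d)

lemma nonempty_iso_of_induce_support {V W : Type*} [Fintype V] [Fintype W]
    {G : SimpleGraph V} {H : SimpleGraph W} (hcard : Fintype.card V = Fintype.card W)
    (φ : G.induce G.support ≃g H) : Nonempty (G ≃g H) := by
  classical
  have huniv : G.support = Set.univ := by
    refine Set.eq_of_subset_of_ncard_le (Set.subset_univ _) ?_
    rw [Set.ncard_univ, Nat.card_eq_fintype_card, hcard, ← Nat.card_eq_fintype_card,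
      ← Nat.card_congr φ.toEquiv, Set.ncard_def, Set.encard]
    simp
  rw [huniv] at φ
  exact ⟨(induceUnivIso G).symm.trans φ⟩

lemma jumpBound_le (t : ℕ) : jumpBound t ≤ 8000000 * (t + 1) ^ 10 := by
  obtain ⟨s, hs⟩ : ∃ s, s = t + 1 := ⟨_, rfl⟩
  have h0 : 1 ≤ s := by omega
  have hpow : ∀ i j, i ≤ j → s ^ i ≤ s ^ j := fun i j h => Nat.pow_le_pow_right h0 h
  have htt : t * t ≤ s ^ 2 := by nlinarith
  have h1 : farJumpBound t ≤ 40 * s ^ 3 := by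
    have h2 : (2 * t + 1) * (t * t) ≤ 2 * s * s ^ 2 := Nat.mul_le_mul (by omega) htt
    have h3 := hpow 1 3 (by omega)
    have h4 := hpow 0 3 (by omega)
    simp only [farJumpBound]
    nlinarith
  have h2 : rowColBound t ≤ 700 * s ^ 4 := by
    have h2 : (2 * t + 1) * farJumpBound t ≤ 2 * s * (40 * s ^ 3) :=
      Nat.mul_le_mul (by omega) h1
    have h3 := hpow 1 4 (by omega)
    simp only [rowColBound]
    nlinarith
  have h3 : coverBound t ≤ 50 * s ^ 3 := by
    have h2 : (6 * t + 6) * (t * t) ≤ 6 * s * s ^ 2 := Nat.mul_le_mul (by omega) htt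
    have h3 := hpow 1 3 (by omega)
    simp only [coverBound]
    nlinarith
  have h4 : t * t * (2 * t + 4) ≤ s ^ 2 * (4 * s) := Nat.mul_le_mul htt (by omega)
  rw [← hs]
  calc jumpBound t ≤ 2 * (s ^ 2 * (4 * s) * (s ^ 2 * (4 * s))) +
        50 * s ^ 3 * (50 * s ^ 3) * (4 * (700 * s ^ 4)) := by
        simp only [jumpBound]
        gcongr
    _ = 32 * s ^ 6 + 7000000 * s ^ 10 := by ring
    _ ≤ 8000000 * s ^ 10 := by
        have := hpow 6 10 (by omega)
        omega

/-- There is a polynomially bounded function `f : ℕ → ℕ` such that for all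
`t ≥ 2`, `ℓ ≥ 2`, every `K_t`-minor-free graph `U` on `2ℓ²` vertices has at most `ℓ^(f t)`
edge subsets `S ⊆ E(U)` spanning a triangulated `ℓ × ℓ` double grid. -/
theorem statement3 :
    ∃ f : ℕ → ℕ,
      (∃ C c : ℕ, ∀ t, f t ≤ C * (t + 1) ^ c) ∧
      ∀ t ℓ : ℕ, 2 ≤ t → 2 ≤ ℓ →
        ∀ U : SimpleGraph (Fin (2 * ℓ ^ 2)),
          ¬ U.HasMinor (⊤ : SimpleGraph (Fin t)) →
          {S : Set (Sym2 (Fin (2 * ℓ ^ 2))) |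
            S ⊆ U.edgeSet ∧
            ∃ H : SimpleGraph (Fin 2 × Fin ℓ × Fin ℓ),
              IsTriangulatedDoubleGrid H ∧
              Nonempty
                ((SimpleGraph.induce (SimpleGraph.fromEdgeSet S).support
                  (SimpleGraph.fromEdgeSet S)) ≃g H)}.ncard ≤ ℓ ^ f t := by
  classical
  refine ⟨fun t => 504 * jumpBound t, ⟨504 * 8000000, 10, fun t => ?_⟩, ?_⟩
  · rw [mul_assoc]
    exact Nat.mul_le_mul_left _ (jumpBound_le t)
  intro t ℓ ht hℓ U hminor
  have : NeZero ℓ := ⟨by omega⟩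
  have hcard : Fintype.card (Fin (2 * ℓ ^ 2)) = Fintype.card (Fin 2 × Fin ℓ × Fin ℓ) := by
    simp [pow_two]
  have hle : ∀ S ⊆ U.edgeSet, fromEdgeSet S ≤ U := fun S hS u v h =>
    hS ((fromEdgeSet_adj S).1 h).1
  have hedges : Fintype.card (Sym2 (Fin (2 * ℓ ^ 2))) + 1 ≤ ℓ ^ 7 := by
    have h1 : (2 * ℓ ^ 2 + 1).choose 2 ≤ (2 * ℓ ^ 2) ^ 2 := by
      rw [Nat.choose_two_right, Nat.add_sub_cancel]
      refine Nat.div_le_of_le_mul ?_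
      have : 1 ≤ ℓ ^ 2 := Nat.one_le_pow _ _ (by omega)
      nlinarith
    have h2 : 2 * ℓ ^ 2 ≤ ℓ ^ 3 := by
      rw [pow_succ ℓ 2, mul_comm]
      exact Nat.mul_le_mul_left _ hℓ
    have h3 : (2 * ℓ ^ 2) ^ 2 ≤ ℓ ^ 6 := by
      calc (2 * ℓ ^ 2) ^ 2 ≤ (ℓ ^ 3) ^ 2 := Nat.pow_le_pow_left h2 2
        _ = ℓ ^ 6 := by ring
    have h4 : 1 ≤ ℓ ^ 6 := Nat.one_le_pow _ _ (by omega)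
    have h5 : ℓ ^ 6 * 2 ≤ ℓ ^ 7 := by
      rw [pow_succ ℓ 6]
      exact Nat.mul_le_mul_left _ hℓ
    rw [Sym2.card, Fintype.card_fin]
    omega
  refine (ncard_le_of_ncard_sdiff_le (d := 36 * jumpBound t) ?_).trans ?_
  · rintro S ⟨hSU, H, hH, ⟨φ⟩⟩ S' ⟨hSU', H', hH', ⟨φ'⟩⟩
    obtain ⟨φ⟩ := nonempty_iso_of_induce_support hcard φ
    obtain ⟨φ'⟩ := nonempty_iso_of_induce_support hcard φ'
    let D : Finset (Fin (2 * ℓ ^ 2) × Fin (2 * ℓ ^ 2)) := Finset.univ.filter fun e =>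
      (fromEdgeSet S').Adj e.1 e.2 ∧ ¬ (fromEdgeSet S).Adj e.1 e.2
    have hD : D.card ≤ 36 * jumpBound t := card_new_darts_le hH hH' φ φ' (hle S hSU)
      (hle S' hSU') ht hminor fun e he => (Finset.mem_filter.1 he).2
    have hsub : S' \ S ⊆ (fun e : Fin (2 * ℓ ^ 2) × Fin (2 * ℓ ^ 2) => s(e.1, e.2)) '' D := by
      intro z hz
      induction z with
      | _ u v =>
        have hne : u ≠ v := (hSU' hz.1 : U.Adj u v).ne
        refine ⟨(u, v), ?_, rfl⟩
        simp only [D, Finset.coe_filter, Finset.mem_univ, true_and, fromEdgeSet_adj]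
        exact ⟨⟨hz.1, hne⟩, fun h => hz.2 h.1⟩
    refine (Set.ncard_le_ncard hsub).trans ((Set.ncard_image_le (Set.toFinite _)).trans ?_)
    rwa [Set.ncard_coe_finset]
  · calc (Fintype.card (Sym2 (Fin (2 * ℓ ^ 2))) + 1) ^ (2 * (36 * jumpBound t))
        ≤ (ℓ ^ 7) ^ (2 * (36 * jumpBound t)) := Nat.pow_le_pow_left hedges _
      _ = ℓ ^ (504 * jumpBound t) := by
        rw [← pow_mul]
        congr 1
        ring
end

section
/- For every integer k ≥ 1 there is a constant c_k such that for every integer n ≥ 2 there exists a finite simple graph U of treewidth at most 3k−1 with at most n^{c_k} vertices that contains every n-vertex graph of treewidth at most k as an induced subgraph. -/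
open SimpleGraph

/-- `G` has a tree-decomposition of width at most `k`. -/
def HasTreewidthAtMost {V : Type*} (G : SimpleGraph V) (k : ℕ) : Prop :=
  ∃ (ι : Type) (_ : Fintype ι) (T : SimpleGraph ι) (B : ι → Set V),
    T.IsTree ∧
    (∀ v, ∃ t, v ∈ B t) ∧
    (∀ u v, G.Adj u v → ∃ t, u ∈ B t ∧ v ∈ B t) ∧
    (∀ v, (SimpleGraph.induce {t | v ∈ B t} T).Connected) ∧
    (∀ t, (B t).ncard ≤ k + 1)
/-- `U` contains `H` as an induced subgraph. -/
def ContainsInd {α β : Type*} (U : SimpleGraph β) (H : SimpleGraph α) : Prop :=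
  ∃ f : α → β, Function.Injective f ∧ ∀ a b, H.Adj a b ↔ U.Adj (f a) (f b)

/-! ### Rooted trees -/

lemma isTree_parent_unique {ι : Type*} {T : SimpleGraph ι} (hT : T.IsTree) {r t p q : ι}
    (hp : T.Adj t p) (hq : T.Adj t q) (hpd : T.dist p r + 1 = T.dist t r)
    (hqd : T.dist q r + 1 = T.dist t r) : p = q := by
  obtain ⟨P, hP⟩ := hT.connected.exists_walk_length_eq_dist p r
  obtain ⟨Q, hQ⟩ := hT.connected.exists_walk_length_eq_dist q r
  have h1 : (Walk.cons hp P).IsPath := Walk.isPath_of_length_eq_dist _ (by simp; omega)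
  have h2 : (Walk.cons hq Q).IsPath := Walk.isPath_of_length_eq_dist _ (by simp; omega)
  have h3 := (hT.existsUnique_path t r).unique h1 h2
  injection h3

lemma isTree_dist_lt_of_path {ι : Type*} {T : SimpleGraph ι} (hT : T.IsTree) {r u v a : ι}
    (h : T.Adj u v) (p : T.Walk v a) (hp : p.IsPath) (hu : u ∉ p.support)
    (hd : T.dist v r = T.dist u r + 1) : T.dist u r < T.dist a r := by
  induction p generalizing u with
  | nil => omega
  | @cons v w a h' p ih =>
    rw [Walk.cons_isPath_iff] at hp
    have huw : u ≠ w := by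
      rintro rfl
      simp at hu
    rcases hT.dist_eq_dist_add_one_of_adj r h' with h1 | h1
    · rw [dist_comm, dist_comm (v := w)] at h1
      exact absurd (isTree_parent_unique hT h.symm h' hd.symm h1.symm) huw
    · rw [dist_comm, dist_comm (v := v)] at h1
      have := ih h' hp.1 hp.2 h1
      omega

lemma isTree_exists_parent_mem {ι : Type*} {T : SimpleGraph ι} (hT : T.IsTree) {r t a : ι}
    {A : Set ι} (hA : (T.induce A).Connected) (ht : t ∈ A) (ha : a ∈ A) (hta : t ≠ a)
    (hd : T.dist a r ≤ T.dist t r) :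
    ∃ p ∈ A, T.Adj t p ∧ T.dist p r + 1 = T.dist t r := by
  obtain ⟨W, hW⟩ := (hA.preconnected ⟨t, ht⟩ ⟨a, ha⟩).exists_isPath
  cases W with
  | nil => exact absurd rfl hta
  | @cons _ w _ h W =>
    have h' : T.Adj t w := h
    refine ⟨w, w.2, h', ?_⟩
    rcases hT.dist_eq_dist_add_one_of_adj r h' with h1 | h1
    · rw [dist_comm, dist_comm (v := w.1)] at h1
      exact h1.symm
    · exfalso
      rw [dist_comm, dist_comm (v := t)] at h1
      rw [Walk.cons_isPath_iff] at hW
      let f : T.induce A →g T := (Embedding.induce A).toHom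
      have hf : Function.Injective f := (Embedding.induce (G := T) A).injective
      have hts : t ∉ (W.map f).support := by
        rw [Walk.support_map]
        intro hm
        obtain ⟨x, hx, hxt⟩ := List.mem_map.1 hm
        have : x = ⟨t, ht⟩ := Subtype.ext hxt
        exact hW.2 (this ▸ hx)
      have := isTree_dist_lt_of_path hT (a := a) h' (W.map f) (hW.1.map hf) hts h1
      omega

/-! ### Elimination orders -/

/-- A perfect elimination order (of a chordal supergraph of `G`) in which every vertex `v` has at
most `k` predecessors, listed in `K v`. -/
structure ElimOrder {V : Type*} (G : SimpleGraph V) (k : ℕ) where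
  /-- the position of a vertex in the order -/
  ord : V → ℕ
  /-- the earlier neighbours of a vertex in the chordal supergraph -/
  K : V → Finset V
  card_le : ∀ v, (K v).card ≤ k
  lt : ∀ {u v}, u ∈ K v → ord u < ord v
  clique : ∀ {u v w}, u ∈ K w → v ∈ K w → u ≠ v → u ∈ K v ∨ v ∈ K u
  adj : ∀ {u v}, G.Adj u v → u ∈ K v ∨ v ∈ K u

lemma exists_elimOrder {n k : ℕ} {G : SimpleGraph (Fin n)} (h : HasTreewidthAtMost G k) :
    Nonempty (ElimOrder G k) := by
  classical
  obtain ⟨ι, _, T, B, hT, hcov, hadj, hconn, hcard⟩ := h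
  obtain ⟨r⟩ := hT.connected.nonempty
  have htop : ∀ v, ∃ t, v ∈ B t ∧ ∀ s, v ∈ B s → T.dist t r ≤ T.dist s r := by
    intro v
    obtain ⟨t, ht, hmin⟩ := Set.exists_min_image {t | v ∈ B t} (fun t => T.dist t r)
      (Set.toFinite _) (hcov v)
    exact ⟨t, ht, hmin⟩
  choose top htopmem htopmin using htop
  have key : ∀ (m : ℕ) (t : ι) (u v : Fin n), T.dist t r = m → u ∈ B t → v ∈ B t →
      T.dist (top u) r ≤ T.dist (top v) r → u ∈ B (top v) := by
    intro m
    induction m with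
    | zero =>
      intro t u v hm hu hv hd
      by_cases htv : t = top v
      · exact htv ▸ hu
      obtain ⟨p, hp, hp1, hp2⟩ := isTree_exists_parent_mem hT (r := r) (hconn v) hv
        (htopmem v) htv (htopmin v t hv)
      omega
    | succ m ih =>
      intro t u v hm hu hv hd
      by_cases htv : t = top v
      · exact htv ▸ hu
      obtain ⟨p, hp, hp1, hp2⟩ := isTree_exists_parent_mem hT (r := r) (hconn v) hv
        (htopmem v) htv (htopmin v t hv)
      have h3 := htopmin v p hp
      have htu : t ≠ top u := by
        rintro rfl
        omega
      obtain ⟨q, hq, hq1, hq2⟩ := isTree_exists_parent_mem hT (r := r) (hconn u) hu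
        (htopmem u) htu (htopmin u t hu)
      obtain rfl := isTree_parent_unique hT hp1 hq1 hp2 hq2
      exact ih p u v (by omega) hq hp hd
  let o : Fin n → ℕ := fun v => T.dist (top v) r * n + v
  have ho : ∀ u v, o u < o v → T.dist (top u) r ≤ T.dist (top v) r := by
    intro u v huv
    by_contra! hlt
    have : (T.dist (top v) r + 1) * n ≤ T.dist (top u) r * n := Nat.mul_le_mul_right _ hlt
    have h2 := v.2
    simp only [o] at huv
    rw [add_mul] at this
    omega
  have hoi : ∀ u v, u ≠ v → o u < o v ∨ o v < o u := by
    intro u v huv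
    by_contra! hle
    have he : o u = o v := le_antisymm hle.2 hle.1
    apply huv
    have h1 : o u % n = u := by
      exact Nat.mul_add_mod_of_lt u.2
    have h2 : o v % n = v := by
      exact Nat.mul_add_mod_of_lt v.2
    exact Fin.ext (by rw [← h1, ← h2, he])
  refine ⟨⟨o, fun v => Finset.univ.filter fun u => u ∈ B (top v) ∧ o u < o v, ?_, ?_, ?_, ?_⟩⟩
  · intro v
    have h1 := hcard (top v)
    rw [Set.ncard_eq_toFinset_card'] at h1
    have h2 : (Finset.univ.filter fun u => u ∈ B (top v) ∧ o u < o v) ⊆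
        (B (top v)).toFinset.erase v := by
      intro u hu
      simp only [Finset.mem_filter, Finset.mem_univ, true_and] at hu
      simp only [Finset.mem_erase, Set.mem_toFinset]
      refine ⟨?_, hu.1⟩
      rintro rfl
      omega
    have h3 := Finset.card_le_card h2
    rw [Finset.card_erase_of_mem (by simpa using htopmem v)] at h3
    omega
  · intro u v hu
    simp only [Finset.mem_filter] at hu
    exact hu.2.2
  · intro u v w hu hv huv
    simp only [Finset.mem_filter, Finset.mem_univ, true_and] at hu hv ⊢
    rcases hoi u v huv with h | h
    · exact Or.inl ⟨key _ _ u v rfl hu.1 hv.1 (ho _ _ h), h⟩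
    · exact Or.inr ⟨key _ _ v u rfl hv.1 hu.1 (ho _ _ h), h⟩
  · intro u v huv
    obtain ⟨t, hu, hv⟩ := hadj u v huv
    simp only [Finset.mem_filter, Finset.mem_univ, true_and]
    rcases hoi u v huv.ne with h | h
    · exact Or.inl ⟨key _ _ u v rfl hu hv (ho _ _ h), h⟩
    · exact Or.inr ⟨key _ _ v u rfl hv hu (ho _ _ h), h⟩

/-! ### Layouts -/

/-- `Layout G r d W X` means that the vertices in `X` can be placed one at a time, in `d` rounds and
in parallel on both sides of every split, given that the vertices in `W` are already placed and
live, so that at most `r` vertices are live at any time and every vertex is live together with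
each of its neighbours. -/
inductive Layout {V : Type*} [DecidableEq V] (G : SimpleGraph V) (r : ℕ) :
    ℕ → Finset V → Finset V → Prop
  | empty (d : ℕ) (W : Finset V) : Layout G r d W ∅
  | place {d : ℕ} {W X : Finset V} {x : V} (hx : x ∈ X) (hxW : x ∉ W) (hW : W.card < r)
      (hN : ∀ y, G.Adj x y → y ∈ W ∪ X) (h : Layout G r d (insert x W) (X.erase x)) :
      Layout G r (d + 1) W X
  | split {d : ℕ} {W W₁ W₂ X₁ X₂ : Finset V} (hX : Disjoint X₁ X₂) (h₁ : W₁ ⊆ W) (h₂ : W₂ ⊆ W)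
      (hW : Disjoint W (X₁ ∪ X₂)) (hL₁ : Layout G r d W₁ X₁) (hL₂ : Layout G r d W₂ X₂) :
      Layout G r (d + 1) W (X₁ ∪ X₂)

namespace Layout

variable {V : Type*} [DecidableEq V] {G : SimpleGraph V} {r : ℕ}

lemma mono {d d' : ℕ} {W X : Finset V} (h : Layout G r d W X) (hd : d ≤ d') :
    Layout G r d' W X := by
  induction h generalizing d' with
  | empty d W => exact .empty _ _
  | place hx hxW hW hN h ih =>
    obtain ⟨e, rfl⟩ : ∃ e, d' = e + 1 := ⟨d' - 1, by omega⟩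
    exact .place hx hxW hW hN (ih (by omega))
  | split hX h₁ h₂ hW hL₁ hL₂ ih₁ ih₂ =>
    obtain ⟨e, rfl⟩ : ∃ e, d' = e + 1 := ⟨d' - 1, by omega⟩
    exact .split hX h₁ h₂ hW (ih₁ (by omega)) (ih₂ (by omega))

lemma adj_mem {d : ℕ} {W X : Finset V} (h : Layout G r d W X) {x y : V} (hx : x ∈ X)
    (hxy : G.Adj x y) : y ∈ W ∪ X := by
  induction h with
  | empty d W => simp at hx
  | @place d W X z hz hzW hW hN h ih =>
    by_cases hxz : x = z
    · subst hxz
      exact hN y hxy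
    · have := ih (Finset.mem_erase.2 ⟨hxz, hx⟩)
      simp only [Finset.mem_union, Finset.mem_insert, Finset.mem_erase] at this ⊢
      grind
  | split hX h₁ h₂ hW hL₁ hL₂ ih₁ ih₂ =>
    grind

lemma place_finset {d : ℕ} {W X : Finset V} (Z : Finset V) (hZ : Z ⊆ X) (hWX : Disjoint W X)
    (hN : ∀ x ∈ X, ∀ y, G.Adj x y → y ∈ W ∪ X) (hc : (W ∪ Z).card ≤ r)
    (h : Layout G r d (W ∪ Z) (X \ Z)) : Layout G r (d + Z.card) W X := by
  induction Z using Finset.induction_on generalizing W X with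
  | empty => simpa using h
  | insert z Z hz ih =>
    have hzX : z ∈ X := hZ (Finset.mem_insert_self z Z)
    have hzW : z ∉ W := Finset.disjoint_right.1 hWX hzX
    rw [Finset.card_insert_of_notMem hz, ← add_assoc]
    have e : insert z W ∪ Z = W ∪ insert z Z := by grind
    refine .place hzX hzW ?_ (hN z hzX) (ih ?_ ?_ ?_ ?_ ?_)
    · refine lt_of_lt_of_le (Finset.card_lt_card (t := W ∪ insert z Z) ?_) hc
      rw [Finset.ssubset_iff_of_subset Finset.subset_union_left]
      exact ⟨z, by simp, hzW⟩
    · grind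
    · rw [Finset.disjoint_left] at hWX ⊢
      grind
    · intro x hx y hy
      have := hN x (Finset.mem_of_mem_erase hx) y hy
      grind
    · rwa [e]
    · rw [e]
      convert h using 1
      grind

end Layout

namespace ElimOrder

variable {V : Type*} {G : SimpleGraph V} {k : ℕ} (E : ElimOrder G k)

section Descendants

variable [Fintype V]

open Classical in
/-- The descendants of `v` in the elimination forest, including `v` itself. -/
noncomputable def D (v : V) : Finset V :=
  Finset.univ.filter (Relation.ReflTransGen (fun a b => a ∈ E.K b) v)

lemma mem_D {v w : V} : w ∈ E.D v ↔ Relation.ReflTransGen (fun a b => a ∈ E.K b) v w := by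
  simp [D]

lemma self_mem_D (v : V) : v ∈ E.D v := E.mem_D.2 .refl

lemma mem_D_of_mem_K {v w x : V} (hw : w ∈ E.D v) (hx : w ∈ E.K x) : x ∈ E.D v :=
  E.mem_D.2 ((E.mem_D.1 hw).tail hx)

lemma D_subset {v w : V} (hw : w ∈ E.D v) : E.D w ⊆ E.D v := fun _ hx =>
  E.mem_D.2 ((E.mem_D.1 hw).trans (E.mem_D.1 hx))

lemma ord_le_of_mem_D {v w : V} (hw : w ∈ E.D v) : E.ord v ≤ E.ord w := by
  have h := E.mem_D.1 hw
  clear hw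
  induction h with
  | refl => exact le_rfl
  | tail _ h ih => exact ih.trans (E.lt h).le

lemma ord_lt_of_mem_D {v w : V} (hw : w ∈ E.D v) (hne : w ≠ v) : E.ord v < E.ord w := by
  rcases Relation.ReflTransGen.cases_tail (E.mem_D.1 hw) with h | ⟨c, h, hc⟩
  · exact absurd h hne
  · exact (E.ord_le_of_mem_D (E.mem_D.2 h)).trans_lt (E.lt hc)

end Descendants

variable [DecidableEq V]

lemma K_subset_of_mem_D [Fintype V] {v w : V} (hw : w ∈ E.D v) : E.K w ⊆ E.K v ∪ E.D v := by
  have h := E.mem_D.1 hw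
  clear hw
  induction h with
  | refl => exact Finset.subset_union_left
  | @tail b c hb hc ih =>
    intro u hu
    have hbD := E.mem_D.2 hb
    by_cases hub : u = b
    · subst hub
      exact Finset.mem_union_right _ hbD
    rcases E.clique hu hc hub with h | h
    · exact ih h
    · exact Finset.mem_union_right _ (E.mem_D_of_mem_K hbD h)

lemma card_bag_le (v : V) : (insert v (E.K v)).card ≤ k + 1 :=
  (Finset.card_insert_le _ _).trans (Nat.succ_le_succ (E.card_le v))

/-- `X` is closed under descendants, and all proper ancestors of its elements that are relevant
for them and lie outside of `X` lie in `S`. -/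
structure Closed (S X : Finset V) : Prop where
  disj : ∀ x ∈ X, x ∉ S
  K_sub : ∀ x ∈ X, E.K x ⊆ S ∪ X
  up : ∀ x ∈ X, ∀ y, x ∈ E.K y → y ∈ X

variable {E}

namespace Closed

lemma adj_mem {S X : Finset V} (h : E.Closed S X) : ∀ x ∈ X, ∀ y, G.Adj x y → y ∈ S ∪ X := by
  intro x hx y hxy
  rcases E.adj hxy with h1 | h1
  · exact Finset.mem_union_right _ (h.up x hx y h1)
  · exact h.K_sub x hx h1

lemma union {S X Y : Finset V} (hX : E.Closed S X) (hY : E.Closed S Y) : E.Closed S (X ∪ Y) := by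
  obtain ⟨a, b, c⟩ := hX
  obtain ⟨a', b', c'⟩ := hY
  constructor <;> grind

lemma sdiff {S X Y : Finset V} (hX : E.Closed S X) (hY : E.Closed S Y) : E.Closed S (X \ Y) := by
  obtain ⟨a, b, c⟩ := hX
  obtain ⟨a', b', c'⟩ := hY
  constructor <;> grind

lemma empty (S : Finset V) : E.Closed S ∅ := by
  constructor <;> simp

lemma mono {S S' X : Finset V} (h : E.Closed S X) (hS : S ⊆ S') (hd : ∀ x ∈ X, x ∉ S') :
    E.Closed S' X :=
  ⟨hd, fun x hx => (h.K_sub x hx).trans (Finset.union_subset_union_left hS), h.up⟩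

lemma erase {S X : Finset V} {x : V} (h : E.Closed S X) (hK : E.K x ⊆ S) :
    E.Closed (insert x S) (X.erase x) := by
  obtain ⟨a, b, c⟩ := h
  constructor <;> grind

lemma exists_root {S X : Finset V} (h : E.Closed S X) (hX : X.Nonempty) :
    ∃ c ∈ X, E.K c ⊆ S := by
  obtain ⟨c, hc, hmin⟩ := Finset.exists_min_image X E.ord hX
  refine ⟨c, hc, fun u hu => ?_⟩
  rcases Finset.mem_union.1 (h.K_sub c hc hu) with h1 | h1
  · exact h1
  · have := hmin u h1
    have := E.lt hu
    omega

lemma disjoint {S X : Finset V} (h : E.Closed S X) : Disjoint S X :=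
  Finset.disjoint_right.2 h.disj

lemma bag_subset {S X : Finset V} (h : E.Closed S X) {v : V} (hv : v ∈ X) :
    insert v (E.K v) ⊆ S ∪ X :=
  Finset.insert_subset (Finset.mem_union_right _ hv) (h.K_sub v hv)

variable [Fintype V]

lemma D_subset {S X : Finset V} (h : E.Closed S X) {v : V} (hv : v ∈ X) : E.D v ⊆ X := by
  intro w hw
  have h' := E.mem_D.1 hw
  clear hw
  induction h' with
  | refl => exact hv
  | tail _ hc ih => exact h.up _ ih _ hc

lemma K_D (v : V) : E.Closed (E.K v) (E.D v) := by
  refine ⟨fun x hx hx' => ?_, fun x hx => E.K_subset_of_mem_D hx,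
    fun x hx y hy => E.mem_D_of_mem_K hx hy⟩
  have := E.ord_le_of_mem_D hx
  have := E.lt hx'
  omega

lemma bag (v : V) : E.Closed (insert v (E.K v)) ((E.D v).erase v) :=
  (K_D v).erase subset_rfl

lemma subtree {S X : Finset V} (h : E.Closed S X) {v : V} (hv : v ∈ X) (hK : E.K v ⊆ S) :
    E.Closed S (E.D v) :=
  (K_D v).mono hK fun x hx => h.disj x (h.D_subset hv hx)

/-- Split off the parts of `Y` that see only a proper subset of the bag `B`. -/
lemma layout_of_bag {r d : ℕ} {B Y : Finset V} (hY : E.Closed B Y) (hB : B.card ≤ k + 1)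
    (h : ∀ S Z, S.card ≤ k → E.Closed S Z → Z ⊆ Y → Layout G r d S Z) :
    Layout G r (d + (k + 1)) B Y := by
  by_cases hBk : B.card ≤ k
  · exact (h B Y hBk hY subset_rfl).mono (by omega)
  have key : ∀ Q ⊆ B, ∀ Z ⊆ Y, E.Closed B Z → (∀ c ∈ Z, E.K c ⊆ B → ∃ y ∈ Q, y ∉ E.K c) →
      Layout G r (d + Q.card) B Z := by
    intro Q
    induction Q using Finset.induction_on with
    | empty =>
      intro _ Z _ hZ hc
      rcases Z.eq_empty_or_nonempty with rfl | hne
      · exact .empty _ _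
      · obtain ⟨c, hcZ, hcB⟩ := hZ.exists_root hne
        simpa using hc c hcZ hcB
    | insert y Q hy ih =>
      intro hQB Z hZY hZ hc
      have hyB : y ∈ B := hQB (Finset.mem_insert_self _ _)
      let R := Z.filter fun c => E.K c ⊆ B.erase y
      have hsub : ∀ c ∈ R, E.Closed (B.erase y) (E.D c) := by
        intro c hcR
        obtain ⟨hcZ, hcB⟩ := Finset.mem_filter.1 hcR
        exact (K_D c).mono hcB fun x hx hxB =>
          hZ.disj x (hZ.D_subset hcZ hx) (Finset.mem_of_mem_erase hxB)
      have hR : E.Closed (B.erase y) (R.biUnion E.D) := by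
        refine ⟨fun x hx => ?_, fun x hx => ?_, fun x hx z hz => ?_⟩ <;>
          obtain ⟨c, hcR, hxc⟩ := Finset.mem_biUnion.1 hx
        · exact (hsub c hcR).disj x hxc
        · exact ((hsub c hcR).K_sub x hxc).trans (Finset.union_subset_union_right
            (Finset.subset_biUnion_of_mem E.D hcR))
        · exact Finset.mem_biUnion.2 ⟨c, hcR, (hsub c hcR).up x hxc z hz⟩
      have hRZ : R.biUnion E.D ⊆ Z := Finset.biUnion_subset.2 fun c hcR =>
        hZ.D_subset (Finset.mem_filter.1 hcR).1
      have hRB : E.Closed B (R.biUnion E.D) :=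
        hR.mono (Finset.erase_subset _ _) fun x hx => hZ.disj x (hRZ hx)
      rw [Finset.card_insert_of_notMem hy, ← add_assoc, ← Finset.union_sdiff_of_subset hRZ]
      refine .split Finset.disjoint_sdiff (Finset.erase_subset y B) subset_rfl ?_ ?_ ?_
      · rw [Finset.union_sdiff_of_subset hRZ]
        exact hZ.disjoint
      · refine (h _ _ ?_ hR (hRZ.trans hZY)).mono (by omega)
        rw [Finset.card_erase_of_mem hyB]
        omega
      · refine ih ((Finset.subset_insert _ _).trans hQB) _ (Finset.sdiff_subset.trans hZY)
          (hZ.sdiff hRB) ?_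
        intro c hcZ hcB
        obtain ⟨hcZ', hcR⟩ := Finset.mem_sdiff.1 hcZ
        obtain ⟨z, hz, hzc⟩ := hc c hcZ' hcB
        rcases Finset.mem_insert.1 hz with rfl | hz
        · exfalso
          apply hcR
          refine Finset.mem_biUnion.2 ⟨c, Finset.mem_filter.2 ⟨hcZ', ?_⟩, E.self_mem_D c⟩
          exact fun u hu => Finset.mem_erase.2 ⟨by rintro rfl; exact hzc hu, hcB hu⟩
        · exact ⟨z, hz, hzc⟩
  refine (key B subset_rfl Y subset_rfl hY fun c hc hcB => ?_).mono (by omega)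
  by_contra! hall
  have := Finset.card_le_card (show B ⊆ E.K c from hall)
  have := E.card_le c
  omega

/-- A piece all of whose subtrees are small is divided into at most three small pieces. -/
lemma layout_of_small {r d m : ℕ} {S X : Finset V} (hX : E.Closed S X) (hc : X.card < 2 * m)
    (hsmall : ∀ v ∈ X, (E.D v).card < m)
    (h : ∀ Z, E.Closed S Z → Z.card < m → Layout G r d S Z) :
    Layout G r (d + 2) S X := by
  classical
  by_cases hm : m = 0
  · omega
  obtain ⟨Y, hY, hmax⟩ := Finset.exists_max_image
    (X.powerset.filter fun Y => E.Closed S Y ∧ Y.card < m) Finset.card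
    ⟨∅, by simp [Closed.empty]; omega⟩
  simp only [Finset.mem_filter, Finset.mem_powerset, and_imp] at hY hmax
  obtain ⟨hYX, hYS, hYm⟩ := hY
  have hXY := hX.sdiff hYS
  rcases (X \ Y).eq_empty_or_nonempty with he | hne
  · have : X = Y := (Finset.sdiff_eq_empty_iff_subset.1 he).antisymm hYX
    subst this
    exact (h X hYS hYm).mono (by omega)
  obtain ⟨c, hcX, hcS⟩ := hXY.exists_root hne
  have hcD := hXY.subtree hcX hcS
  have hDX := hXY.D_subset hcX
  have hcX' := (Finset.mem_sdiff.1 hcX).1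
  have hdisj : Disjoint Y (E.D c) := by
    rw [Finset.disjoint_left]
    exact fun x hx hx' => (Finset.mem_sdiff.1 (hDX hx')).2 hx
  have hbig : m ≤ (Y ∪ E.D c).card := by
    by_contra! hlt
    have := hmax (Y ∪ E.D c) (Finset.union_subset hYX (hDX.trans Finset.sdiff_subset))
      (hYS.union hcD) hlt
    rw [Finset.card_union_of_disjoint hdisj] at this
    have : 0 < (E.D c).card := Finset.card_pos.2 ⟨c, E.self_mem_D c⟩
    omega
  have hsub : Y ∪ E.D c ⊆ X := Finset.union_subset hYX (hDX.trans Finset.sdiff_subset)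
  have hrest : (X \ (Y ∪ E.D c)).card < m := by
    rw [Finset.card_sdiff_of_subset hsub]
    omega
  rw [← Finset.union_sdiff_of_subset hsub]
  refine .split Finset.disjoint_sdiff subset_rfl subset_rfl ?_ ?_ ?_
  · rw [Finset.union_sdiff_of_subset hsub]
    exact hX.disjoint
  · exact .split hdisj subset_rfl subset_rfl (hYS.union hcD).disjoint (h _ hYS hYm)
      (h _ hcD (hsmall c hcX'))
  · exact (h _ (hX.sdiff (hYS.union hcD)) hrest).mono (by omega)

lemma adj_mem_hole {S X : Finset V} (h : E.Closed S X) (v : V) :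
    ∀ x ∈ X \ (E.D v ∪ E.K v), ∀ y, G.Adj x y →
      y ∈ (S ∪ E.K v) ∪ (X \ (E.D v ∪ E.K v)) := by
  intro x hx y hxy
  have h1 := h.adj_mem x (Finset.mem_sdiff.1 hx).1 y hxy
  have h2 : y ∉ E.D v := by
    intro hy
    have := (K_D v).adj_mem y hy x hxy.symm
    grind
  grind

lemma layout_step_whole {d j : ℕ} (hk : 1 ≤ k)
    (hF : ∀ S X, S.card ≤ k → E.Closed S X → X.card < 2 ^ j → Layout G (3 * k) d S X)
    (hG : ∀ S X v, S.card ≤ k → E.Closed S X → v ∈ X → (X \ E.D v).card < 2 ^ j →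
      Layout G (3 * k) (d + (3 * k + 4)) (S ∪ E.K v) (X \ (E.D v ∪ E.K v)))
    {S X : Finset V} (hS : S.card ≤ k) (hX : E.Closed S X) (hc : X.card < 2 ^ (j + 1)) :
    Layout G (3 * k) (d + (4 * k + 6)) S X := by
  have hsmall : ∀ S X, S.card ≤ k → E.Closed S X → X.card < 2 ^ (j + 1) →
      (∀ v ∈ X, (E.D v).card < 2 ^ j) → Layout G (3 * k) (d + 2) S X :=
    fun S X hS hX hc hs => hX.layout_of_small (by rw [pow_succ'] at hc; exact hc) hs
      fun Z hZ hZc => hF S Z hS hZ hZc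
  by_cases hbig : ∃ v ∈ X, 2 ^ j ≤ (E.D v).card
  swap
  · push Not at hbig
    exact (hsmall S X hS hX hc hbig).mono (by omega)
  obtain ⟨v, hv, hmax⟩ := Finset.exists_max_image (X.filter fun v => 2 ^ j ≤ (E.D v).card) E.ord
    (by simpa [Finset.Nonempty] using hbig)
  obtain ⟨hvX, hvc⟩ := Finset.mem_filter.1 hv
  have hDX := hX.D_subset hvX
  have hvB := hX.bag_subset hvX
  have hB := E.card_bag_le v
  have hSB : (S ∪ insert v (E.K v)).card ≤ 3 * k := by
    have := Finset.card_union_le S (insert v (E.K v))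
    omega
  have hvK : v ∉ E.K v := (K_D (E := E) v).disj v (E.self_mem_D v)
  have hKD := (K_D (E := E) v).disj
  have hvD := E.self_mem_D v
  have hSX := hX.disj
  have eW : S ∪ (insert v (E.K v) \ S) = S ∪ insert v (E.K v) := by grind
  have eX : X \ (insert v (E.K v) \ S) = (X \ (E.D v ∪ E.K v)) ∪ (E.D v).erase v := by grind
  have hPc : (insert v (E.K v) \ S).card ≤ k + 1 :=
    (Finset.card_le_card Finset.sdiff_subset).trans hB
  refine (Layout.place_finset (d := d + (3 * k + 4) + 1) (insert v (E.K v) \ S)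
    (by grind) hX.disjoint hX.adj_mem (by rwa [eW]) ?_).mono (by omega)
  rw [eW, eX]
  refine .split (W₁ := S ∪ E.K v) (W₂ := insert v (E.K v)) ?_ (by grind) (by grind) ?_ ?_ ?_
  · rw [Finset.disjoint_left]
    grind
  · rw [Finset.disjoint_left]
    grind
  · refine hG S X v hS hX hvX ?_
    rw [Finset.card_sdiff_of_subset hDX]
    rw [pow_succ] at hc
    omega
  · refine ((bag v).layout_of_bag hB (d := d + 2) fun S' Z hS' hZ hZY => ?_).mono (by omega)
    refine hsmall S' Z hS' hZ ?_ fun w hw => ?_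
    · exact (Finset.card_le_card (by grind)).trans_lt hc
    · by_contra! hlt
      have hw' := Finset.mem_erase.1 (hZY hw)
      have := hmax w (Finset.mem_filter.2 ⟨hDX hw'.2, hlt⟩)
      have := E.ord_lt_of_mem_D hw'.2 hw'.1
      omega

lemma exists_child {u v : V} (hv : v ∈ E.D u) (hne : v ≠ u) :
    ∃ c ∈ E.D u, c ≠ u ∧ v ∈ E.D c ∧ E.K c ⊆ insert u (E.K u) := by
  classical
  obtain ⟨c, hc, hmin⟩ := Finset.exists_min_image
    ((E.D u).filter fun c => c ≠ u ∧ v ∈ E.D c) E.ord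
    ⟨v, Finset.mem_filter.2 ⟨hv, hne, E.self_mem_D v⟩⟩
  obtain ⟨hcu, hcne, hcv⟩ := Finset.mem_filter.1 hc
  refine ⟨c, hcu, hcne, hcv, fun w hw => ?_⟩
  rcases Finset.mem_union.1 (E.K_subset_of_mem_D hcu hw) with h | h
  · exact Finset.mem_insert_of_mem h
  by_contra hwu
  have hwne : w ≠ u := fun e => hwu (e ▸ Finset.mem_insert_self _ _)
  have hcw : c ∈ E.D w := E.mem_D_of_mem_K (E.self_mem_D w) hw
  have := hmin w (Finset.mem_filter.2 ⟨h, hwne, E.D_subset hcw hcv⟩)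
  have := E.lt hw
  omega

lemma layout_step_hole {d d' j : ℕ} (hk : 1 ≤ k) (hd : d + (2 * k + 3) ≤ d')
    (hF : ∀ S X, S.card ≤ k → E.Closed S X → X.card < 2 ^ (j + 1) → Layout G (3 * k) d' S X)
    (hG : ∀ S X v, S.card ≤ k → E.Closed S X → v ∈ X → (X \ E.D v).card < 2 ^ j →
      Layout G (3 * k) (d + (3 * k + 4)) (S ∪ E.K v) (X \ (E.D v ∪ E.K v)))
    {S X : Finset V} {v : V} (hS : S.card ≤ k) (hX : E.Closed S X) (hvX : v ∈ X)
    (hc : (X \ E.D v).card < 2 ^ (j + 1)) :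
    Layout G (3 * k) (d' + (3 * k + 4)) (S ∪ E.K v) (X \ (E.D v ∪ E.K v)) := by
  have hSX := hX.disj
  have hvS := hX.K_sub v hvX
  have hKDv := (K_D (E := E) v).disj
  by_cases hbig : ∃ u ∈ X, v ∈ E.D u ∧ 2 ^ j ≤ (E.D u \ E.D v).card
  · obtain ⟨u, hu, hmax⟩ := Finset.exists_max_image
      (X.filter fun u => v ∈ E.D u ∧ 2 ^ j ≤ (E.D u \ E.D v).card) E.ord
      (by simpa [Finset.Nonempty] using hbig)
    obtain ⟨huX, hvu, huc⟩ := Finset.mem_filter.1 hu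
    have hne : v ≠ u := by
      rintro rfl
      simp at huc
    obtain ⟨c, hcu, hcne, hvc, hcK⟩ := exists_child hvu hne
    have hDuX := hX.D_subset huX
    have hcX := hDuX hcu
    have hDcu := E.D_subset hcu
    have hDvc := E.D_subset hvc
    have hcsmall : (E.D c \ E.D v).card < 2 ^ j := by
      by_contra! hlt
      have := hmax c (Finset.mem_filter.2 ⟨hcX, hvc, hlt⟩)
      have := E.ord_lt_of_mem_D hcu hcne
      omega
    have hKDc := (K_D (E := E) c).disj
    have hKDu := (K_D (E := E) u).disj
    have hKc := hX.K_sub c hcX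
    have hKu := hX.K_sub u huX
    have hKvc := E.K_subset_of_mem_D hvc
    have hKcu := E.K_subset_of_mem_D hcu
    have huDu := E.self_mem_D u
    have huDc : u ∉ E.D c := by
      intro h
      have := E.ord_le_of_mem_D h
      have := E.ord_lt_of_mem_D hcu hcne
      omega
    have hkc := E.card_le c
    have hkv := E.card_le v
    have hku := E.card_bag_le u
    have eW : S ∪ E.K v ∪ (E.K c \ (S ∪ E.K v)) = S ∪ E.K v ∪ E.K c := by grind
    have eX : (X \ (E.D v ∪ E.K v)) \ (E.K c \ (S ∪ E.K v)) =
        (E.D c \ (E.D v ∪ E.K v)) ∪ (X \ (E.D c ∪ E.K c)) := by grind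
    have eW' : S ∪ E.K c ∪ (insert u (E.K u) \ (S ∪ E.K c)) = S ∪ insert u (E.K u) := by grind
    have eX' : (X \ (E.D c ∪ E.K c)) \ (insert u (E.K u) \ (S ∪ E.K c)) =
        (X \ (E.D u ∪ E.K u)) ∪ ((E.D u).erase u \ E.D c) := by grind
    have hP : (E.K c \ (S ∪ E.K v)).card ≤ k := (Finset.card_le_card Finset.sdiff_subset).trans hkc
    have hP' : (insert u (E.K u) \ (S ∪ E.K c)).card ≤ k + 1 :=
      (Finset.card_le_card Finset.sdiff_subset).trans hku
    have hcard : (S ∪ E.K v ∪ E.K c).card ≤ 3 * k := by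
      have := Finset.card_union_le (S ∪ E.K v) (E.K c)
      have := Finset.card_union_le S (E.K v)
      omega
    have hcard' : (S ∪ insert u (E.K u)).card ≤ 3 * k := by
      have := Finset.card_union_le S (insert u (E.K u))
      omega
    refine (Layout.place_finset (d := d' + (k + 1) + 1 + (k + 1) + 1) (E.K c \ (S ∪ E.K v))
      (by grind) ?_ (hX.adj_mem_hole v) (by rwa [eW]) ?_).mono (by omega)
    · rw [Finset.disjoint_left]
      grind
    rw [eW, eX]
    refine .split (W₁ := E.K c ∪ E.K v) (W₂ := S ∪ E.K c) ?_ (by grind) (by grind) ?_ ?_ ?_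
    · rw [Finset.disjoint_left]
      grind
    · rw [Finset.disjoint_left]
      grind
    · exact (hG (E.K c) (E.D c) v hkc (K_D c) hvc hcsmall).mono (by omega)
    refine (Layout.place_finset (d := d' + (k + 1) + 1) (insert u (E.K u) \ (S ∪ E.K c))
      (by grind) ?_ (hX.adj_mem_hole c) (by rwa [eW']) ?_).mono (by omega)
    · rw [Finset.disjoint_left]
      grind
    rw [eW', eX']
    refine .split (W₁ := S ∪ E.K u) (W₂ := insert u (E.K u)) ?_ (by grind) (by grind) ?_ ?_ ?_
    · rw [Finset.disjoint_left]
      grind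
    · rw [Finset.disjoint_left]
      grind
    · refine (hG S X u hS hX huX ?_).mono (by omega)
      have h1 : X \ E.D v = (X \ E.D u) ∪ (E.D u \ E.D v) := by grind
      have h2 : Disjoint (X \ E.D u) (E.D u \ E.D v) := by
        rw [Finset.disjoint_left]
        grind
      rw [h1, Finset.card_union_of_disjoint h2, pow_succ] at hc
      omega
    · have hcl : E.Closed (insert u (E.K u)) (E.D c) :=
        (bag u).subtree (Finset.mem_erase.2 ⟨hcne, hcu⟩) hcK
      refine ((bag u).sdiff hcl).layout_of_bag hku fun S' Z hS' hZ hZY => ?_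
      exact hF S' Z hS' hZ ((Finset.card_le_card (by grind)).trans_lt hc)
  · push Not at hbig
    obtain ⟨c, hc', hmin⟩ := Finset.exists_min_image (X.filter fun c => v ∈ E.D c) E.ord
      ⟨v, Finset.mem_filter.2 ⟨hvX, E.self_mem_D v⟩⟩
    obtain ⟨hcX, hvc⟩ := Finset.mem_filter.1 hc'
    have hcS : E.K c ⊆ S := by
      intro w hw
      rcases Finset.mem_union.1 (hX.K_sub c hcX hw) with h | h
      · exact h
      have hcw : c ∈ E.D w := E.mem_D_of_mem_K (E.self_mem_D w) hw
      have := hmin w (Finset.mem_filter.2 ⟨h, E.D_subset hcw hvc⟩)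
      have := E.lt hw
      omega
    have hcl := hX.subtree hcX hcS
    have hDcX := hX.D_subset hcX
    have hDvc := E.D_subset hvc
    have hKvc := E.K_subset_of_mem_D hvc
    have eX : X \ (E.D v ∪ E.K v) = (E.D c \ (E.D v ∪ E.K v)) ∪ (X \ E.D c) := by grind
    rw [eX]
    refine (Layout.split (d := d' + (3 * k + 3)) (W₁ := S ∪ E.K v) (W₂ := S) ?_ subset_rfl
      Finset.subset_union_left ?_ ?_ ?_).mono (by omega)
    · rw [Finset.disjoint_left]
      grind
    · rw [Finset.disjoint_left]
      grind
    · exact (hG S (E.D c) v hS hcl hvc (hbig c hcX hvc)).mono (by omega)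
    · refine (hF S (X \ E.D c) hS (hX.sdiff hcl) ?_).mono (by omega)
      exact (Finset.card_le_card (by grind)).trans_lt hc

lemma layout_of_card_lt (hk : 1 ≤ k) (j : ℕ) :
    (∀ S X, S.card ≤ k → E.Closed S X → X.card < 2 ^ j →
      Layout G (3 * k) ((4 * k + 6) * j) S X) ∧
    (∀ S X v, S.card ≤ k → E.Closed S X → v ∈ X → (X \ E.D v).card < 2 ^ j →
      Layout G (3 * k) ((4 * k + 6) * j + (3 * k + 4)) (S ∪ E.K v) (X \ (E.D v ∪ E.K v))) := by
  induction j with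
  | zero =>
    refine ⟨fun S X _ _ hX => ?_, fun S X v _ _ _ hX => ?_⟩
    · obtain rfl : X = ∅ := by simpa using hX
      exact .empty _ _
    · have h : X \ (E.D v ∪ E.K v) = ∅ := by
        have : X \ E.D v = ∅ := Finset.card_eq_zero.1 (by simpa using hX)
        grind
      rw [h]
      exact .empty _ _
  | succ j ih =>
    have hF : ∀ S X, S.card ≤ k → E.Closed S X → X.card < 2 ^ (j + 1) →
        Layout G (3 * k) ((4 * k + 6) * (j + 1)) S X :=
      fun S X hS hX hc => layout_step_whole hk ih.1 ih.2 hS hX hc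
    exact ⟨hF, fun S X v hS hX hv hc =>
      layout_step_hole hk (by rw [mul_add]; omega) hF ih.2 hS hX hv hc⟩

end Closed

lemma layout_univ [Fintype V] (E : ElimOrder G k) (hk : 1 ≤ k) {j : ℕ}
    (hj : Fintype.card V < 2 ^ j) :
    Layout G (3 * k) ((4 * k + 6) * j) ∅ Finset.univ :=
  (Closed.layout_of_card_lt (E := E) hk j).1 ∅ Finset.univ (by simp)
    ⟨by simp, by simp, by simp⟩ (by simpa using hj)

end ElimOrder

/-! ### The universal graph -/

namespace UniversalGraph

/-- A letter either places a new vertex in one of `r` slots, with a prescribed set of slots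
holding its earlier neighbours, or tells the two sides of a split apart. -/
abbrev Letter (r : ℕ) : Type := (Fin r × Finset (Fin r)) ⊕ Bool

/-- The contents of the slots after reading a word (from right to left). The placed vertices are
identified with the words whose leftmost letter places a vertex. -/
def slots {r : ℕ} : List (Letter r) → Fin r → List (Letter r)
  | [] => fun _ => []
  | .inl a :: w => Function.update (slots w) a.1 (.inl a :: w)
  | .inr _ :: w => slots w

/-- The word `p` ends by placing a vertex adjacent to the earlier vertex `q`. -/
def BackAdj {r : ℕ} : List (Letter r) → List (Letter r) → Prop
  | .inl a :: w, q => ∃ i ∈ a.2, i ≠ a.1 ∧ slots w i = q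
  | _, _ => False

/-- The word `p` ends by placing a vertex. -/
def Placing {r : ℕ} (p : List (Letter r)) : Prop := ∃ a w, p = .inl a :: w

/-- The words of length at most `D`. -/
abbrev Word (r D : ℕ) : Type := {p : List (Letter r) // p.length ≤ D}

/-- The vertices of the universal graph. -/
abbrev Vert (r D : ℕ) : Type := {p : List (Letter r) // p.length ≤ D ∧ Placing p}

/-- The universal graph. -/
def graph (r D : ℕ) : SimpleGraph (Vert r D) := SimpleGraph.fromRel fun p q => BackAdj p.1 q.1

/-- The tree of all words of length at most `D`. -/
def tree (r D : ℕ) : SimpleGraph (Word r D) := SimpleGraph.fromRel fun p q => p.1.tail = q.1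

variable {r D : ℕ}

lemma slots_suffix (w : List (Letter r)) (i : Fin r) : slots w i <:+ w := by
  induction w with
  | nil => simp [slots]
  | cons a w ih =>
    rcases a with a | b
    · by_cases h : i = a.1
      · subst h
        simp [slots]
      · simpa [slots, h] using ih.trans (List.suffix_cons _ _)
    · exact ih.trans (List.suffix_cons _ _)

lemma BackAdj.suffix {p q : List (Letter r)} (h : BackAdj p q) :
    q <:+ p ∧ q.length < p.length := by
  rcases p with _ | ⟨a | b, w⟩
  · exact h.elim
  · obtain ⟨i, -, -, rfl⟩ := h
    have := slots_suffix w i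
    exact ⟨this.trans (List.suffix_cons _ _), by simpa using Nat.lt_succ_of_le this.length_le⟩
  · exact h.elim

lemma word_to_fun_injective :
    Function.Injective fun (p : Word r D) (i : Fin D) => p.1[(i : ℕ)]? := by
  intro p q h
  apply Subtype.ext
  apply List.ext_getElem?
  intro i
  by_cases hi : i < D
  · exact congrFun h ⟨i, hi⟩
  · have hp := p.2
    have hq := q.2
    rw [List.getElem?_eq_none (by omega), List.getElem?_eq_none (by omega)]

instance : Finite (Word r D) := Finite.of_injective _ word_to_fun_injective

lemma vert_to_word_injective :
    Function.Injective fun p : Vert r D => (⟨p.1, p.2.1⟩ : Word r D) := by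
  intro p q h
  exact Subtype.ext (congrArg (fun x : Word r D => x.1) h)

instance : Finite (Vert r D) := Finite.of_injective _ vert_to_word_injective

lemma card_vert_le : Nat.card (Vert r D) ≤ (Nat.card (Letter r) + 1) ^ D := by
  have h := Nat.card_le_card_of_injective _
    ((word_to_fun_injective (r := r) (D := D)).comp vert_to_word_injective)
  simpa [Nat.card_fun, Finite.card_option] using h

lemma tree_adj_cons {a : Letter r} {w : List (Letter r)} (h : (a :: w).length ≤ D)
    (h' : w.length ≤ D) : (tree r D).Adj ⟨a :: w, h⟩ ⟨w, h'⟩ := by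
  simp [tree]

lemma tree_isTree : (tree r D).IsTree := by
  have hconn : (tree r D).Connected := by
    rw [SimpleGraph.connected_iff_exists_forall_reachable]
    refine ⟨⟨[], by simp⟩, ?_⟩
    rintro ⟨p, hp⟩
    induction p with
    | nil => exact Reachable.refl _
    | cons a w ih =>
      have hw : w.length ≤ D := by simp at hp; omega
      exact (ih hw).trans (tree_adj_cons hp hw).symm.reachable
  rw [isTree_iff_connected_and_card]
  refine ⟨hconn, le_antisymm ?_ hconn.card_vert_le_card_edgeSet_add_one⟩
  rw [← Finite.card_option]
  have hadj : ∀ p : Word r D, p.1 ≠ [] →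
      (tree r D).Adj p ⟨p.1.tail, by have := p.2; simp; omega⟩ := by
    rintro ⟨p, hp⟩ hne
    cases p with
    | nil => simp at hne
    | cons a w => exact tree_adj_cons hp _
  classical
  refine Nat.card_le_card_of_surjective
    (fun p : Word r D => if h : p.1 = [] then none else
      some (⟨s(p, ⟨p.1.tail, by have := p.2; simp; omega⟩), hadj p h⟩ : (tree r D).edgeSet)) ?_
  rintro (_ | ⟨e, he⟩)
  · exact ⟨⟨[], by simp⟩, by simp⟩
  have hkey : ∀ p q : Word r D, p ≠ q → p.1.tail = q.1 → p.1 ≠ [] := by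
    rintro ⟨p, hp⟩ ⟨q, hq⟩ hne h h'
    apply hne
    subst h'
    exact Subtype.ext h
  induction e using Sym2.ind with
  | _ p q =>
    have he' : p ≠ q ∧ (p.1.tail = q.1 ∨ q.1.tail = p.1) := he
    obtain ⟨hne, h | h⟩ := he'
    · refine ⟨p, ?_⟩
      simp [hkey p q hne h, h]
    · refine ⟨q, ?_⟩
      simp [hkey q p hne.symm h, h, Sym2.eq_swap]

lemma hasTreewidthAtMost_graph (hr : 1 ≤ r) : HasTreewidthAtMost (graph r D) (r - 1) := by
  have hself : ∀ v : Vert r D, ∃ i, slots v.1 i = v.1 := by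
    rintro ⟨_, h, a, w, rfl⟩
    exact ⟨a.1, by simp [slots]⟩
  have hback : ∀ u v : Vert r D, BackAdj u.1 v.1 → ∃ i, slots u.1 i = v.1 := by
    rintro ⟨_, h, a, w, rfl⟩ v ⟨i, _, hi, hv⟩
    exact ⟨i, by simp [slots, hi, hv]⟩
  refine ⟨Word r D, Fintype.ofFinite _, tree r D, fun t => {v | ∃ i, slots t.1 i = v.1},
    tree_isTree, fun v => ⟨⟨v.1, v.2.1⟩, hself v⟩, ?_, ?_, ?_⟩
  · rintro u v ⟨-, h | h⟩
    · exact ⟨⟨u.1, u.2.1⟩, hself u, hback u v h⟩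
    · exact ⟨⟨v.1, v.2.1⟩, hback v u h, hself v⟩
  · intro v
    rw [SimpleGraph.connected_iff_exists_forall_reachable]
    refine ⟨⟨⟨v.1, v.2.1⟩, hself v⟩, ?_⟩
    rintro ⟨⟨p, hp⟩, hv⟩
    induction p with
    | nil =>
      obtain ⟨i, hi⟩ := hv
      obtain ⟨a, w, hw⟩ := v.2.2
      simp [slots, hw] at hi
    | cons a w ih =>
      have hw : w.length ≤ D := by simp at hp; omega
      by_cases hva : a :: w = v.1
      · simp only [hva]
        exact Reachable.refl _
      have hvw : ∃ i, slots w i = v.1 := by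
        obtain ⟨i, hi⟩ := hv
        refine ⟨i, ?_⟩
        rcases a with a | b
        · by_cases h : i = a.1
          · subst h
            simp only [slots, Function.update_self] at hi
            exact absurd hi hva
          · simpa [slots, h] using hi
        · exact hi
      refine (ih hw hvw).trans (Adj.reachable ?_)
      exact (tree_adj_cons hp hw).symm
  · intro t
    change Set.ncard {v : Vert r D | ∃ i, slots t.1 i = v.1} ≤ r - 1 + 1
    rw [← Set.ncard_image_of_injective _ Subtype.val_injective]
    have h1 : Subtype.val '' {v : Vert r D | ∃ i, slots t.1 i = v.1} ⊆
        slots t.1 '' Set.univ := by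
      rintro _ ⟨v, ⟨i, hi⟩, rfl⟩
      exact ⟨i, trivial, hi⟩
    have h2 := Set.ncard_le_ncard h1 (Set.toFinite _)
    have h3 := Set.ncard_image_le (f := slots t.1) (s := Set.univ) (Set.toFinite _)
    rw [Set.ncard_univ, Nat.card_fin] at h3
    omega

lemma not_suffix_of_split {p q w l l' : List (Letter r)} {b b' : Bool} (hb : b ≠ b')
    (hp : p = l ++ (.inr b :: w)) (hq : q = l' ++ (.inr b' :: w)) : ¬ p <:+ q := by
  intro h
  have h1 : (.inr b :: w) <:+ q := (List.IsSuffix.trans ⟨l, hp.symm⟩ h)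
  have h2 : (.inr b' :: w) <:+ q := ⟨l', hq.symm⟩
  have h3 := (List.suffix_of_suffix_length_le h1 h2 (by simp)).eq_of_length (by simp)
  simp at h3
  exact hb h3

lemma exists_embedding {V : Type*} [DecidableEq V] {G : SimpleGraph V} {d : ℕ}
    {W X : Finset V} (h : Layout G r d W X) :
    ∀ (w : List (Letter r)) (g : V → List (Letter r)) (σ : V → Fin r) (P : Finset V),
      W ⊆ P → Disjoint P X → Set.InjOn g P → (∀ y ∈ P, g y <:+ w) →
      (∀ v ∈ W, slots w (σ v) = g v) → Set.InjOn σ W →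
      ∃ f : V → List (Letter r), (∀ v ∉ X, f v = g v) ∧
        (∀ x ∈ X, Placing (f x) ∧ ∃ l, l ≠ [] ∧ l.length ≤ d ∧ f x = l ++ w) ∧
        Set.InjOn f X ∧
        ∀ x ∈ X, ∀ y ∈ P ∪ X, G.Adj x y ↔ (BackAdj (f x) (f y) ∨ BackAdj (f y) (f x)) := by
  classical
  induction h with
  | empty d W =>
    intro w g σ P _ _ _ _ _ _
    exact ⟨g, by simp⟩
  | @place d W X x hx hxW hW hN h ih =>
    intro w g σ P hWP hPX hg hgw hσ hσi
    obtain ⟨s, hs⟩ : ∃ s, s ∉ W.image σ := by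
      by_contra! hall
      have h1 : (W.image σ) = Finset.univ := Finset.eq_univ_iff_forall.2 hall
      have h2 := Finset.card_image_le (f := σ) (s := W)
      rw [h1, Finset.card_univ, Fintype.card_fin] at h2
      omega
    have hsW : ∀ v ∈ W, σ v ≠ s := fun v hv e => hs (Finset.mem_image.2 ⟨v, hv, e⟩)
    have hxP : x ∉ P := Finset.disjoint_right.1 hPX hx
    set N : Finset (Fin r) := (W.filter fun v => G.Adj x v).image σ
    set w' : List (Letter r) := .inl (s, N) :: w with hw'
    have hlen : w'.length = w.length + 1 := by simp [hw']
    have hne : ∀ y ∈ P, y ≠ x := fun y hy e => hxP (e ▸ hy)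
    obtain ⟨f, hf1, hf2, hf3, hf4⟩ := ih w' (Function.update g x w') (Function.update σ x s)
      (insert x P) (Finset.insert_subset_insert _ hWP)
      (by rw [Finset.disjoint_left] at hPX ⊢; grind)
      (by
        intro y hy z hz hyz
        simp only [Finset.coe_insert, Set.mem_insert_iff, Finset.mem_coe] at hy hz
        rcases hy with rfl | hy <;> rcases hz with rfl | hz
        · rfl
        · rw [Function.update_self, Function.update_of_ne (hne z hz)] at hyz
          have := (hgw z hz).length_le
          rw [← hyz] at this
          omega
        · rw [Function.update_self, Function.update_of_ne (hne y hy)] at hyz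
          have := (hgw y hy).length_le
          rw [hyz] at this
          omega
        · rw [Function.update_of_ne (hne y hy), Function.update_of_ne (hne z hz)] at hyz
          exact hg hy hz hyz)
      (by
        intro y hy
        rcases Finset.mem_insert.1 hy with rfl | hy
        · simp
        · rw [Function.update_of_ne (hne y hy)]
          exact (hgw y hy).trans (List.suffix_cons _ _))
      (by
        intro v hv
        rcases Finset.mem_insert.1 hv with rfl | hv
        · simp [hw', slots]
        · rw [Function.update_of_ne (hne v (hWP hv)), Function.update_of_ne (hne v (hWP hv)), hw']
          simp only [slots]
          rw [Function.update_of_ne (hsW v hv)]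
          exact hσ v hv)
      (by
        intro y hy z hz hyz
        simp only [Finset.coe_insert, Set.mem_insert_iff, Finset.mem_coe] at hy hz
        rcases hy with rfl | hy <;> rcases hz with rfl | hz
        · rfl
        · rw [Function.update_self, Function.update_of_ne (hne z (hWP hz))] at hyz
          exact absurd hyz.symm (hsW z hz)
        · rw [Function.update_self, Function.update_of_ne (hne y (hWP hy))] at hyz
          exact absurd hyz (hsW y hy)
        · rw [Function.update_of_ne (hne y (hWP hy)),
            Function.update_of_ne (hne z (hWP hz))] at hyz
          exact hσi hy hz hyz)
    have hfx : f x = w' := by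
      rw [hf1 x (Finset.notMem_erase x X), Function.update_self]
    have hfg : ∀ v ∉ X, f v = g v := fun v hv => by
      have hvx : v ≠ x := fun e => hv (e ▸ hx)
      rw [hf1 v (fun h => hv (Finset.mem_of_mem_erase h)), Function.update_of_ne hvx]
    have hfl : ∀ y ∈ X, y ≠ x → w'.length < (f y).length := by
      intro y hy hyx
      obtain ⟨-, l, hl, -, e⟩ := hf2 y (Finset.mem_erase.2 ⟨hyx, hy⟩)
      rw [e, List.length_append]
      have := List.length_pos_iff.2 hl
      omega
    refine ⟨f, hfg, ?_, ?_, ?_⟩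
    · intro y hy
      by_cases hyx : y = x
      · subst hyx
        exact ⟨⟨_, _, hfx⟩, [.inl (s, N)], by simp, by simp, hfx⟩
      · obtain ⟨hp, l, hl, hld, e⟩ := hf2 y (Finset.mem_erase.2 ⟨hyx, hy⟩)
        exact ⟨hp, l ++ [.inl (s, N)], by simp, by simpa using hld, by simp [e, hw']⟩
    · intro y hy z hz hyz
      by_cases hyx : y = x <;> by_cases hzx : z = x
      · rw [hyx, hzx]
      · have := hfl z hz hzx
        rw [← hyz, hyx, hfx] at this
        omega
      · have := hfl y hy hyx
        rw [hyz, hzx, hfx] at this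
        omega
      · exact hf3 (Finset.mem_erase.2 ⟨hyx, hy⟩) (Finset.mem_erase.2 ⟨hzx, hz⟩) hyz
    · intro z hz y hy
      by_cases hzx : z = x
      swap
      · exact hf4 z (Finset.mem_erase.2 ⟨hzx, hz⟩) y (by grind)
      subst hzx
      by_cases hyz : y = z
      · subst hyz
        have : ¬ BackAdj (f y) (f y) := fun h => by
          have := h.suffix.2
          omega
        simp [this]
      by_cases hyX : y ∈ X
      · rw [G.adj_comm, or_comm]
        exact hf4 y (Finset.mem_erase.2 ⟨hyz, hyX⟩) z (by simp)
      have hyP : y ∈ P := by grind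
      rw [hfx, hfg y hyX]
      have hno : ¬ BackAdj (g y) w' := fun h => by
        have h1 := h.suffix.2
        have h2 := (hgw y hyP).length_le
        omega
      simp only [hno, or_false]
      constructor
      · intro hzy
        have hyW : y ∈ W := by
          have := hN y hzy
          grind
        exact ⟨σ y, Finset.mem_image.2 ⟨y, Finset.mem_filter.2 ⟨hyW, hzy⟩, rfl⟩, hsW y hyW,
          hσ y hyW⟩
      · rintro ⟨i, hi, -, hiy⟩
        obtain ⟨v, hv, rfl⟩ := Finset.mem_image.1 hi
        obtain ⟨hvW, hzv⟩ := Finset.mem_filter.1 hv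
        rw [hσ v hvW] at hiy
        obtain rfl := hg (hWP hvW) hyP hiy
        exact hzv
  | @split d W W₁ W₂ X₁ X₂ hX h₁ h₂ hW hL₁ hL₂ ih₁ ih₂ =>
    intro w g σ P hWP hPX hg hgw hσ hσi
    rw [Finset.disjoint_left] at hX hW hPX
    obtain ⟨f₁, ha₁, hb₁, hc₁, hd₁⟩ := ih₁ (.inr false :: w) g σ P (h₁.trans hWP)
      (by rw [Finset.disjoint_left]; grind) hg
      (fun y hy => (hgw y hy).trans (List.suffix_cons _ _)) (fun v hv => hσ v (h₁ hv))
      (hσi.mono (Finset.coe_subset.2 h₁))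
    have hf₁ : ∀ y ∈ P, f₁ y = g y := fun y hy => ha₁ y (by grind)
    obtain ⟨f, ha₂, hb₂, hc₂, hd₂⟩ := ih₂ (.inr true :: w) f₁ σ P (h₂.trans hWP)
      (by rw [Finset.disjoint_left]; grind)
      (fun y hy z hz hyz => hg hy hz (by rwa [hf₁ y hy, hf₁ z hz] at hyz))
      (fun y hy => by rw [hf₁ y hy]; exact (hgw y hy).trans (List.suffix_cons _ _))
      (fun v hv => by rw [hf₁ v (hWP (h₂ hv))]; exact hσ v (h₂ hv))
      (hσi.mono (Finset.coe_subset.2 h₂))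
    have hf : ∀ x ∈ X₁, f x = f₁ x := fun x hx => ha₂ x (hX hx)
    have hclash : ∀ x ∈ X₁, ∀ y ∈ X₂, ¬ f x <:+ f y ∧ ¬ f y <:+ f x := by
      intro x hx y hy
      obtain ⟨-, l, -, -, e⟩ := hb₁ x hx
      obtain ⟨-, l', -, -, e'⟩ := hb₂ y hy
      rw [← hf x hx] at e
      exact ⟨not_suffix_of_split (by simp) e e', not_suffix_of_split (by simp) e' e⟩
    have hcross : ∀ x ∈ X₁, ∀ y ∈ X₂, ¬ G.Adj x y ∧
        ¬ (BackAdj (f x) (f y) ∨ BackAdj (f y) (f x)) := by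
      intro x hx y hy
      refine ⟨fun hxy => ?_, ?_⟩
      · have := hL₁.adj_mem hx hxy
        grind
      · rintro (h | h)
        · exact (hclash x hx y hy).2 h.suffix.1
        · exact (hclash x hx y hy).1 h.suffix.1
    refine ⟨f, ?_, ?_, ?_, ?_⟩
    · intro v hv
      rw [ha₂ v (by grind), ha₁ v (by grind)]
    · intro x hx
      rcases Finset.mem_union.1 hx with hx | hx
      · obtain ⟨hp, l, hl, hld, e⟩ := hb₁ x hx
        rw [hf x hx]
        exact ⟨hp, l ++ [.inr false], by simp, by simpa using hld, by simp [e]⟩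
      · obtain ⟨hp, l, hl, hld, e⟩ := hb₂ x hx
        exact ⟨hp, l ++ [.inr true], by simp, by simpa using hld, by simp [e]⟩
    · intro x hx y hy hxy
      simp only [Finset.coe_union, Set.mem_union, Finset.mem_coe] at hx hy
      rcases hx with hx | hx <;> rcases hy with hy | hy
      · exact hc₁ hx hy (by rwa [hf x hx, hf y hy] at hxy)
      · exact absurd (hxy ▸ List.suffix_refl _) (hclash x hx y hy).1
      · exact absurd (hxy ▸ List.suffix_refl _) (hclash y hy x hx).1
      · exact hc₂ hx hy hxy
    · intro x hx y hy
      rcases Finset.mem_union.1 hx with hx | hx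
      · by_cases hy₂ : y ∈ X₂
        · have := hcross x hx y hy₂
          tauto
        · rw [hf x hx, ha₂ y hy₂]
          exact hd₁ x hx y (by grind)
      · by_cases hy₁ : y ∈ X₁
        · have := hcross y hy₁ x hx
          rw [G.adj_comm]
          tauto
        · exact hd₂ x hx y (by grind)

lemma containsInd_graph {V : Type*} [Fintype V] [DecidableEq V] {G : SimpleGraph V}
    (hr : 1 ≤ r) (h : Layout G r D ∅ Finset.univ) : ContainsInd (graph r D) G := by
  obtain ⟨f, -, hf, hinj, hadj⟩ := exists_embedding h [] (fun _ => []) (fun _ => ⟨0, hr⟩) ∅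
    (by simp) (by simp) (by simp) (by simp) (by simp) (by simp)
  have hlen : ∀ x, (f x).length ≤ D := by
    intro x
    obtain ⟨-, l, -, hl, e⟩ := hf x (Finset.mem_univ x)
    simpa [e] using hl
  have hinj' : Function.Injective f := fun x y hxy =>
    hinj (Finset.mem_coe.2 (Finset.mem_univ x)) (Finset.mem_coe.2 (Finset.mem_univ y)) hxy
  refine ⟨fun x => ⟨f x, hlen x, (hf x (Finset.mem_univ x)).1⟩,
    fun x y hxy => hinj' (congrArg Subtype.val hxy), fun x y => ?_⟩
  rw [hadj x (Finset.mem_univ x) y (by simp)]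
  refine ⟨fun h => ⟨fun e => ?_, h⟩, fun h => h.2⟩
  rw [show f x = f y from congrArg Subtype.val e] at h
  rcases h with h | h <;> exact lt_irrefl _ h.suffix.2

end UniversalGraph

lemma HasTreewidthAtMost.of_iso {α β : Type*} {G : SimpleGraph α} {G' : SimpleGraph β} {k : ℕ}
    (e : G ≃g G') (h : HasTreewidthAtMost G k) : HasTreewidthAtMost G' k := by
  obtain ⟨ι, hι, T, B, hT, hcov, hadj, hconn, hcard⟩ := h
  refine ⟨ι, hι, T, fun t => e.symm ⁻¹' B t, hT, fun v => hcov _,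
    fun u v huv => hadj _ _ (e.symm.map_adj_iff.2 huv), fun v => hconn _, fun t => ?_⟩
  rw [Set.ncard_preimage_of_injective_subset_range e.symm.injective
    (by rw [e.symm.surjective.range_eq]; exact Set.subset_univ _)]
  exact hcard t

lemma pow_le_pow_log {M k n : ℕ} (hn : 2 ≤ n) :
    M ^ (k * (Nat.log 2 n + 1)) ≤ n ^ (2 * k * M) := by
  have hlog : 1 ≤ Nat.log 2 n := Nat.log_pos (by norm_num) hn
  calc M ^ (k * (Nat.log 2 n + 1)) ≤ (2 ^ M) ^ (k * (Nat.log 2 n + 1)) :=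
        Nat.pow_le_pow_left Nat.lt_two_pow_self.le _
    _ = 2 ^ (M * (k * (Nat.log 2 n + 1))) := (pow_mul _ _ _).symm
    _ ≤ 2 ^ (Nat.log 2 n * (2 * k * M)) := by
        refine Nat.pow_le_pow_right (by norm_num) ?_
        calc M * (k * (Nat.log 2 n + 1)) ≤ M * (k * (2 * Nat.log 2 n)) := by gcongr; omega
          _ = Nat.log 2 n * (2 * k * M) := by ring
    _ = (2 ^ Nat.log 2 n) ^ (2 * k * M) := pow_mul _ _ _
    _ ≤ n ^ (2 * k * M) := Nat.pow_le_pow_left (Nat.pow_log_le_self 2 (by omega)) _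

/-- For every `k ≥ 1` there is a constant `c_k` such that for every
`n ≥ 2` there is a graph of treewidth at most `3k − 1` with at most `n^(c_k)` vertices
containing every `n`-vertex graph of treewidth at most `k` as an induced subgraph. -/
theorem statement4 (k : ℕ) (hk : 1 ≤ k) :
    ∃ c : ℕ, ∀ n : ℕ, 2 ≤ n →
      ∃ (N : ℕ) (U : SimpleGraph (Fin N)),
        HasTreewidthAtMost U (3 * k - 1) ∧
        N ≤ n ^ c ∧
        ∀ H : SimpleGraph (Fin n), HasTreewidthAtMost H k → ContainsInd U H := by
  refine ⟨2 * (4 * k + 6) * (Nat.card (UniversalGraph.Letter (3 * k)) + 1), fun n hn => ?_⟩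
  let D := (4 * k + 6) * (Nat.log 2 n + 1)
  let e := Finite.equivFin (UniversalGraph.Vert (3 * k) D)
  let i := SimpleGraph.Iso.map e (UniversalGraph.graph (3 * k) D)
  refine ⟨_, _, (UniversalGraph.hasTreewidthAtMost_graph (by omega)).of_iso i,
    UniversalGraph.card_vert_le.trans (pow_le_pow_log hn), fun H hH => ?_⟩
  obtain ⟨E⟩ := exists_elimOrder hH
  have hlay : Layout H (3 * k) D ∅ Finset.univ :=
    E.layout_univ hk (by simpa using Nat.lt_pow_succ_log_self (by norm_num) n)
  obtain ⟨f, hf, hadj⟩ := UniversalGraph.containsInd_graph (by omega) hlay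
  exact ⟨fun v => i (f v), i.injective.comp hf, fun a b => (hadj a b).trans i.map_adj_iff.symm⟩
end
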